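/- Sandwich bound for KPP solutions far to the right (Proposition 2.5). Assume condition (H1) holds, ψ(1) = 0 and 1 is the largest root of ψ. Let u be a solution of the KPP equation with bounded nonnegative initial condition, not identically zero, satisfying ∫_0^∞ y e^{√2 y} u(0,y) dy < ∞. For 0 < r < t and x ∈ ℝ define Ψ(r,t,x) := (e^{−√2(x − √2 t)} / √(2π(t−r))) ∫_0^∞ u(r, √2 r + y) e^{√2 y} e^{−(x − √2 t − y)²/(2(t−r))} (1 − e^{−2(x − m(t)) y/(t−r)}) dy, where m(t) := √2 t − (3/(2√2)) log t. Then there exist r₀ > 0 and a function γ : [r₀,∞) → [1,∞) with γ(r) → 1 as r → ∞, such that for all r ≥ r₀, t ≥ 8r and x ≥ m(t) + 9r: γ(r)^{−1} Ψ(r,t,x) ≤ u(t,x) ≤ γ(r) Ψ(r,t,x). -/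

import Mathlib

open MeasureTheory Set Filter Topology

/-- The branching mechanism ψ(λ) = −λ + βλ² + ∫₀^∞ (e^{−λy} − 1 + λy) n(dy). -/
noncomputable def psi (β : ℝ) (n : Measure ℝ) (l : ℝ) : ℝ :=
  -l + β * l ^ 2 + ∫ y in Ioi (0 : ℝ), (Real.exp (-l * y) - 1 + l * y) ∂n

/-- A solution of the KPP equation ∂u/∂t − (1/2)∂²u/∂x² = −ψ(u): a nonnegative function
on [0,∞) × ℝ, continuous on [0,∞) × ℝ, C^{1,2} on (0,∞) × ℝ, bounded on [0,T] × ℝ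
for every T > 0, satisfying the equation for all t > 0, x ∈ ℝ. -/
def IsKPPSolution (β : ℝ) (n : Measure ℝ) (u : ℝ → ℝ → ℝ) : Prop :=
  (∀ t : ℝ, 0 ≤ t → ∀ x : ℝ, 0 ≤ u t x) ∧
  ContinuousOn (fun p : ℝ × ℝ => u p.1 p.2) (Ici (0 : ℝ) ×ˢ (univ : Set ℝ)) ∧
  (∀ x : ℝ, ∀ t : ℝ, 0 < t → DifferentiableAt ℝ (fun s => u s x) t) ∧
  (∀ t : ℝ, 0 < t → ContDiff ℝ 2 (u t)) ∧
  (∀ T : ℝ, 0 < T → ∃ C : ℝ, ∀ t ∈ Icc (0 : ℝ) T, ∀ x : ℝ, |u t x| ≤ C) ∧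
  (∀ t : ℝ, 0 < t → ∀ x : ℝ,
    deriv (fun s => u s x) t - (1 / 2) * deriv (deriv (u t)) x = -psi β n (u t x))

/-- The centering term m(t) = √2 t − (3/(2√2)) log t. -/
noncomputable def mFun (t : ℝ) : ℝ :=
  Real.sqrt 2 * t - 3 / (2 * Real.sqrt 2) * Real.log t

/-- The quantity Ψ(r,t,x) built from a solution u of the KPP equation. -/
noncomputable def PsiFun (u : ℝ → ℝ → ℝ) (r t x : ℝ) : ℝ :=
  Real.exp (-(Real.sqrt 2 * (x - Real.sqrt 2 * t))) / Real.sqrt (2 * Real.pi * (t - r)) *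
    ∫ y in Ioi (0 : ℝ),
      u r (Real.sqrt 2 * r + y) * Real.exp (Real.sqrt 2 * y) *
        Real.exp (-(x - Real.sqrt 2 * t - y) ^ 2 / (2 * (t - r))) *
        (1 - Real.exp (-(2 * (x - mFun t) * y) / (t - r)))

namespace KPPB

lemma second_deriv_nonpos {f f1 : ℝ → ℝ} {b x : ℝ} (hf : ∀ y, HasDerivAt f (f1 y) y)
    (hf1 : HasDerivAt f1 b x) (hmax : ∀ y, f y ≤ f x) : b ≤ 0 := by
  by_contra hb
  push Not at hb
  have h1 : deriv f = f1 := funext fun y => (hf y).deriv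
  have hlm : IsLocalMax f x := Eventually.of_forall hmax
  have hd0 : deriv f x = 0 := hlm.deriv_eq_zero
  have hdd : deriv (deriv f) x = b := by rw [h1]; exact hf1.deriv
  have hmin := isLocalMin_of_deriv_deriv_pos (f := f) (x₀ := x) (by rw [hdd]; exact hb) hd0
    (hf x).continuousAt
  have hconst : f =ᶠ[𝓝 x] fun _ => f x := by
    filter_upwards [hmin] with y hy
    exact le_antisymm (hmax y) hy
  have h2 : deriv f =ᶠ[𝓝 x] deriv (fun _ => f x) := hconst.deriv
  have h3 := h2.deriv_eq
  rw [hdd] at h3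
  simp at h3
  linarith

lemma left_deriv_nonneg {f : ℝ → ℝ} {a t : ℝ} (ht : 0 < t) (hf : HasDerivAt f a t)
    (hmax : ∀ s ∈ Icc 0 t, f s ≤ f t) : 0 ≤ a := by
  have h := hf.hasDerivWithinAt (s := Iio t)
  rw [hasDerivWithinAt_iff_tendsto_slope' (by simp)] at h
  refine ge_of_tendsto h ?_
  have : Ioo 0 t ∈ 𝓝[<] t := Ioo_mem_nhdsLT ht
  filter_upwards [this] with s hs
  rw [slope_def_field]
  have := hmax s ⟨hs.1.le, hs.2.le⟩
  exact div_nonneg_of_nonpos (by linarith) (by linarith [hs.2])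

/-- Maximum principle on a strip. -/
theorem max_principle {T : ℝ} {w : ℝ → ℝ → ℝ}
    (hc : ContinuousOn (fun p : ℝ × ℝ => w p.1 p.2) (Icc 0 T ×ˢ univ))
    (hb : ∃ C, ∀ t ∈ Icc 0 T, ∀ x, w t x ≤ C) (h0 : ∀ x, w 0 x ≤ 0)
    (hd : ∀ t ∈ Ioc 0 T, ∀ x, 0 < w t x → ∃ a b, ∃ w1 : ℝ → ℝ,
      HasDerivAt (fun s => w s x) a t ∧ (∀ y, HasDerivAt (w t) (w1 y) y) ∧
      HasDerivAt w1 b x ∧ a - b / 2 ≤ 0) :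
    ∀ t ∈ Icc 0 T, ∀ x, w t x ≤ 0 := by
  intro t1 ht1 x1
  by_contra hpos
  push Not at hpos
  obtain ⟨C, hC⟩ := hb
  set η := w t1 x1 with hη
  have hK : 0 < 1 + x1 ^ 2 + 2 * t1 := by nlinarith [ht1.1, sq_nonneg x1]
  set ε := η / (2 * (1 + x1 ^ 2 + 2 * t1)) with hε
  have hε0 : 0 < ε := by positivity
  set g : ℝ → ℝ → ℝ := fun t x => w t x - ε * (1 + x ^ 2 + 2 * t) with hg
  have hg1 : 0 < g t1 x1 := by
    have : ε * (1 + x1 ^ 2 + 2 * t1) = η / 2 := by rw [hε]; field_simp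
    simp only [hg]; rw [this, ← hη]; linarith
  have hCpos : 0 < C := lt_of_lt_of_le hpos (hC t1 ht1 x1)
  set R := |x1| + 1 + C / ε with hR
  have hRx : |x1| ≤ R := by have : 0 < C / ε := by positivity
                            linarith
  have hR1 : 1 ≤ R := by have : 0 < C / ε := by positivity
                         linarith [abs_nonneg x1]
  have hout : ∀ t ∈ Icc 0 T, ∀ x, R < |x| → g t x < 0 := by
    intro t ht x hx
    have h1 := hC t ht x
    have h2 : C ≤ ε * R := by
      rw [hR]; have : ε * (C / ε) = C := by field_simp
      nlinarith [abs_nonneg x1]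
    have h3 : R ≤ x ^ 2 := by rw [← sq_abs]; nlinarith
    simp only [hg]
    nlinarith [ht.1]
  have hgc : ContinuousOn (fun p : ℝ × ℝ => g p.1 p.2) (Icc 0 T ×ˢ Icc (-R) R) := by
    refine ContinuousOn.sub (hc.mono ?_) (by fun_prop)
    exact prod_mono le_rfl (subset_univ _)
  obtain ⟨⟨ts, xs⟩, hmem, hmaxOn⟩ := (isCompact_Icc.prod isCompact_Icc).exists_isMaxOn
    ⟨(t1, x1), ht1, abs_le.mp hRx⟩ hgc
  have hmax0 : g t1 x1 ≤ g ts xs := hmaxOn (show (t1, x1) ∈ _ from ⟨ht1, abs_le.mp hRx⟩)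
  have hts : ts ∈ Icc 0 T := hmem.1
  have hgp : 0 < g ts xs := lt_of_lt_of_le hg1 hmax0
  have hmax : ∀ t ∈ Icc 0 T, ∀ x, g t x ≤ g ts xs := by
    intro t ht x
    by_cases hx : |x| ≤ R
    · exact hmaxOn (show (t, x) ∈ _ from ⟨ht, abs_le.mp hx⟩)
    · exact ((hout t ht x (not_le.mp hx)).trans hgp).le
  have hwp : 0 < w ts xs := by
    have : 0 ≤ ε * (1 + xs ^ 2 + 2 * ts) := by have := hts.1; positivity
    simp only [hg] at hgp; linarith
  have htpos : 0 < ts := by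
    rcases hts.1.lt_or_eq with h | h
    · exact h
    · rw [← h] at hwp; linarith [h0 xs]
  obtain ⟨a, b, w1, ha, hw1, hb1, hab⟩ := hd ts ⟨htpos, hts.2⟩ xs hwp
  have e1 : 0 ≤ a - ε * 2 := by
    refine left_deriv_nonneg (f := fun s => g s xs) htpos ?_ (fun s hs => hmax s ⟨hs.1, hs.2.trans hts.2⟩ xs)
    simp only [hg]
    refine ha.sub ?_
    have := (((hasDerivAt_id ts).const_mul 2).const_add (1 + xs ^ 2)).const_mul ε
    simpa using this
  have e2 : b - ε * 2 ≤ 0 := by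
    refine second_deriv_nonpos (f := g ts) (f1 := fun y => w1 y - ε * (2 * y)) (x := xs) ?_ ?_ (hmax ts hts)
    · intro y
      simp only [hg]
      refine (hw1 y).sub ?_
      have := (((hasDerivAt_pow 2 y).const_add 1).add_const (2 * ts)).const_mul ε
      simpa using this
    · refine hb1.sub ?_
      have := ((hasDerivAt_id xs).const_mul 2).const_mul ε
      simpa using this
  linarith

end KPPB

namespace KPPB

noncomputable def qf (β : ℝ) (n : Measure ℝ) (v : ℝ) : ℝ :=
  β * v ^ 2 + ∫ y in Ioi (0 : ℝ), (Real.exp (-v * y) - 1 + v * y) ∂n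

lemma psi_eq_qf (β : ℝ) (n : Measure ℝ) (v : ℝ) : psi β n v = -v + qf β n v := by
  unfold psi qf; ring

lemma gb_nonneg (x : ℝ) : 0 ≤ Real.exp (-x) - 1 + x := by
  have := Real.add_one_le_exp (-x); linarith

lemma gb_le {x : ℝ} (hx : 0 ≤ x) : Real.exp (-x) - 1 + x ≤ x := by
  have : Real.exp (-x) ≤ 1 := Real.exp_le_one_iff.mpr (by linarith)
  linarith

lemma gb_le_sq {x : ℝ} (hx : 0 ≤ x) : Real.exp (-x) - 1 + x ≤ x ^ 2 := by
  rcases le_or_gt x 1 with h | h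
  · have h1 := Real.abs_exp_sub_one_sub_id_le (x := -x) (by rw [abs_neg, abs_of_nonneg hx]; exact h)
    have h2 := (abs_le.mp h1).2
    nlinarith
  · have := gb_le hx
    nlinarith

lemma integrable_min {n : Measure ℝ}
    (hn : ∫⁻ y in Ioi (0 : ℝ), ENNReal.ofReal (min (y ^ 2) y) ∂n < ⊤) :
    IntegrableOn (fun y : ℝ => min (y ^ 2) y) (Ioi 0) n := by
  refine ⟨by fun_prop, ?_⟩
  rw [hasFiniteIntegral_iff_ofReal]
  · exact hn
  · filter_upwards [ae_restrict_mem measurableSet_Ioi] with y hy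
    exact le_min (by positivity) (le_of_lt hy)

lemma gb_le_min {v y K : ℝ} (hv : 0 ≤ v) (hy : 0 < y) (hK : v ≤ K) (hK1 : 1 ≤ K) :
    Real.exp (-v * y) - 1 + v * y ≤ K * v * min (y ^ 2) y := by
  have e : -v * y = -(v * y) := by ring
  rw [e]
  have hvy : 0 ≤ v * y := by positivity
  rcases min_choice (y ^ 2) y with h | h <;> rw [h]
  · refine (gb_le_sq hvy).trans ?_
    have : v * (v * y ^ 2) ≤ K * (v * y ^ 2) := by gcongr
    nlinarith
  · refine (gb_le hvy).trans ?_
    nlinarith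

lemma gb_integrable {n : Measure ℝ}
    (hn : ∫⁻ y in Ioi (0 : ℝ), ENNReal.ofReal (min (y ^ 2) y) ∂n < ⊤) {v : ℝ} (hv : 0 ≤ v) :
    IntegrableOn (fun y : ℝ => Real.exp (-v * y) - 1 + v * y) (Ioi 0) n := by
  refine Integrable.mono' ((integrable_min hn).const_mul ((v + 1) * v)) (by fun_prop) ?_
  filter_upwards [ae_restrict_mem measurableSet_Ioi] with y hy
  have e : -v * y = -(v * y) := by ring
  have := gb_le_min hv hy (K := v + 1) (by linarith) (by linarith)
  rw [Real.norm_of_nonneg (by rw [e]; exact gb_nonneg _)]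
  exact this

lemma qf_nonneg {β : ℝ} {n : Measure ℝ} (hβ : 0 ≤ β) (v : ℝ) : 0 ≤ qf β n v := by
  unfold qf
  have : 0 ≤ ∫ y in Ioi (0 : ℝ), (Real.exp (-v * y) - 1 + v * y) ∂n := by
    refine integral_nonneg fun y => ?_
    have e : -v * y = -(v * y) := by ring
    simp only [e]
    exact gb_nonneg _
  positivity

lemma qf_le {β : ℝ} {n : Measure ℝ} (hβ : 0 ≤ β)
    (hn : ∫⁻ y in Ioi (0 : ℝ), ENNReal.ofReal (min (y ^ 2) y) ∂n < ⊤) (K : ℝ) (hK1 : 1 ≤ K) :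
    ∃ C, 0 ≤ C ∧ ∀ v, 0 ≤ v → v ≤ K → qf β n v ≤ C * v := by
  have hI : 0 ≤ ∫ y in Ioi (0 : ℝ), min (y ^ 2) y ∂n := by
    refine setIntegral_nonneg measurableSet_Ioi fun y hy => le_min (by positivity) (le_of_lt hy)
  refine ⟨β * K + K * ∫ y in Ioi (0 : ℝ), min (y ^ 2) y ∂n, by positivity, fun v hv hvK => ?_⟩
  have h1 : ∫ y in Ioi (0 : ℝ), (Real.exp (-v * y) - 1 + v * y) ∂n
      ≤ ∫ y in Ioi (0 : ℝ), K * v * min (y ^ 2) y ∂n := by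
    refine setIntegral_mono_on (gb_integrable hn hv) ((integrable_min hn).const_mul _)
      measurableSet_Ioi fun y hy => gb_le_min hv hy hvK hK1
  rw [integral_const_mul] at h1
  unfold qf
  have h2 : β * v ^ 2 ≤ β * K * v := by nlinarith [mul_nonneg hβ hv, mul_nonneg hβ (mul_nonneg hv (sub_nonneg.mpr hvK))]
  nlinarith

lemma qf_cont {β : ℝ} {n : Measure ℝ}
    (hn : ∫⁻ y in Ioi (0 : ℝ), ENNReal.ofReal (min (y ^ 2) y) ∂n < ⊤) :
    Continuous fun v : ℝ => qf β n (max v 0) := by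
  unfold qf
  refine Continuous.add (by fun_prop) ?_
  rw [continuous_iff_continuousAt]
  intro v0
  refine continuousAt_of_dominated (bound := fun y => (|v0| + 2) * (|v0| + 2) * min (y ^ 2) y)
    (Eventually.of_forall fun v => by fun_prop) ?_ ((integrable_min hn).const_mul _)
    (Eventually.of_forall fun y => by fun_prop)
  have hn1 : ∀ᶠ v in 𝓝 v0, v < v0 + 1 := eventually_lt_nhds (by linarith)
  filter_upwards [hn1] with v hv
  filter_upwards [ae_restrict_mem measurableSet_Ioi] with y hy
  have hm : max v 0 ≤ |v0| + 2 := max_le (by linarith [le_abs_self v0]) (by positivity)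
  have e : -(max v 0) * y = -((max v 0) * y) := by ring
  have h1 := gb_le_min (le_max_right v 0) hy hm (by linarith [abs_nonneg v0])
  rw [Real.norm_of_nonneg (by rw [e]; exact gb_nonneg _)]
  refine h1.trans ?_
  have : 0 ≤ min (y ^ 2) y := le_min (by positivity) (le_of_lt hy)
  have h0 := abs_nonneg v0
  gcongr

lemma psi_nonneg_of_one_le {β : ℝ} {n : Measure ℝ} (hβ : 0 ≤ β)
    (hn : ∫⁻ y in Ioi (0 : ℝ), ENNReal.ofReal (min (y ^ 2) y) ∂n < ⊤)
    (h1 : psi β n 1 = 0) {v : ℝ} (hv : 1 ≤ v) : 0 ≤ psi β n v := by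
  rw [psi_eq_qf] at h1 ⊢
  have hq1 : qf β n 1 = 1 := by linarith
  have hle : v * qf β n 1 ≤ qf β n v := by
    unfold qf
    have hi : ∫ y in Ioi (0 : ℝ), v * (Real.exp (-1 * y) - 1 + 1 * y) ∂n ≤
        ∫ y in Ioi (0 : ℝ), (Real.exp (-v * y) - 1 + v * y) ∂n := by
      refine setIntegral_mono_on ((gb_integrable hn zero_le_one).const_mul _)
        (gb_integrable hn (by linarith)) measurableSet_Ioi fun y hy => ?_
      have hb := one_add_mul_self_le_rpow_one_add (s := Real.exp (-y) - 1)
        (by linarith [Real.exp_pos (-y)]) hv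
      have e : (1 + (Real.exp (-y) - 1)) ^ v = Real.exp (-v * y) := by
        rw [show (1 + (Real.exp (-y) - 1)) = Real.exp (-y) by ring, ← Real.exp_mul]
        congr 1; ring
      rw [e] at hb
      rw [show (-1 : ℝ) * y = -y by ring]
      nlinarith
    rw [integral_const_mul] at hi
    have : v * β ≤ β * v ^ 2 := by nlinarith [mul_nonneg hβ (by linarith : 0 ≤ v)]
    nlinarith
  rw [hq1] at hle
  linarith

lemma poly_exp_bound {w : ℝ} (hw : 0 ≤ w) : (1 + w) ^ 4 * Real.exp (-(w / 2)) ≤ 1152 := by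
  have h := Real.pow_div_factorial_le_exp ((1 + w) / 2) (by linarith) 4
  have e : Real.exp ((1 + w) / 2) = Real.exp (1 / 2) * Real.exp (w / 2) := by
    rw [← Real.exp_add]; congr 1; ring
  have e3 : Real.exp (1 / 2) ≤ 3 := by
    have := Real.exp_one_lt_d9
    have h2 : Real.exp (1 / 2) ≤ Real.exp 1 := Real.exp_le_exp.mpr (by norm_num)
    linarith
  rw [e] at h
  have : (Nat.factorial 4 : ℝ) = 24 := by norm_num [Nat.factorial]
  rw [this] at h
  have h4 : (1 + w) ^ 4 ≤ 1152 * Real.exp (w / 2) := by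
    have := Real.exp_pos (w / 2)
    have e5 : ((1 + w) / 2) ^ 4 / 24 = (1 + w) ^ 4 / 384 := by ring
    rw [e5] at h
    nlinarith
  rw [Real.exp_neg, ← div_eq_mul_inv, div_le_iff₀ (Real.exp_pos _)]
  exact h4

lemma integrable_log {n : Measure ℝ}
    (hn : ∫⁻ y in Ioi (0 : ℝ), ENNReal.ofReal (min (y ^ 2) y) ∂n < ⊤)
    {γ₀ γ : ℝ} (hγ : 0 < γ) (hγle : γ ≤ γ₀)
    (hH1 : ∫⁻ y in Ioi (1 : ℝ), ENNReal.ofReal (y * Real.log y ^ (2 + γ₀)) ∂n < ⊤) :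
    IntegrableOn (fun y : ℝ => y * Real.log y ^ (2 + γ)) (Ioi 1) n := by
  have h0 : IntegrableOn (fun y : ℝ => y * Real.log y ^ (2 + γ₀)) (Ioi 1) n := by
    refine ⟨by fun_prop, ?_⟩
    rw [hasFiniteIntegral_iff_ofReal]
    · exact hH1
    · filter_upwards [ae_restrict_mem measurableSet_Ioi] with y hy
      have hy1 : (1 : ℝ) < y := hy
      have := Real.log_pos hy1
      have : 0 < y := by linarith
      positivity
  have h1 : IntegrableOn (fun y : ℝ => min (y ^ 2) y) (Ioi 1) n :=
    (integrable_min hn).mono_set (Ioi_subset_Ioi zero_le_one)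
  refine Integrable.mono' (h1.add h0) (by fun_prop) ?_
  filter_upwards [ae_restrict_mem measurableSet_Ioi] with y hy
  have hy1 : (1 : ℝ) < y := hy
  have hl := Real.log_pos hy1
  have hy0 : 0 < y := by linarith
  rw [Real.norm_of_nonneg (by positivity)]
  have hm : min (y ^ 2) y = y := min_eq_right (by nlinarith)
  simp only [Pi.add_apply]
  rw [hm]
  have : Real.log y ^ (2 + γ) ≤ 1 + Real.log y ^ (2 + γ₀) := by
    rcases le_or_gt (Real.log y) 1 with h | h
    · have := Real.rpow_le_one hl.le h (by linarith : 0 ≤ 2 + γ)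
      have : 0 ≤ Real.log y ^ (2 + γ₀) := by positivity
      linarith
    · have := Real.rpow_le_rpow_of_exponent_le h.le (by linarith : 2 + γ ≤ 2 + γ₀)
      linarith
  nlinarith

lemma qf_decay {β : ℝ} {n : Measure ℝ} (hβ : 0 ≤ β)
    (hn : ∫⁻ y in Ioi (0 : ℝ), ENNReal.ofReal (min (y ^ 2) y) ∂n < ⊤)
    {γ₀ γ : ℝ} (hγ : 0 < γ) (hγle : γ ≤ γ₀) (hγ1 : γ ≤ 1)
    (hH1 : ∫⁻ y in Ioi (1 : ℝ), ENNReal.ofReal (y * Real.log y ^ (2 + γ₀)) ∂n < ⊤)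
    (K : ℝ) (hK1 : 1 ≤ K) (A : ℝ) (hA : 0 ≤ A) :
    ∃ C, 0 ≤ C ∧ ∀ w v, 0 ≤ w → 0 ≤ v → v ≤ K → v ≤ A * (1 + w) * Real.exp (-(Real.sqrt 2 * w)) →
      qf β n v ≤ C * (1 + w) ^ (-(2 + γ)) * v := by
  obtain ⟨Cq, hCq, hq⟩ := qf_le hβ hn K hK1
  set I := ∫ y in Ioi (0 : ℝ), min (y ^ 2) y ∂n with hI
  set J := ∫ y in Ioi (1 : ℝ), y * Real.log y ^ (2 + γ) ∂n with hJ
  have hI0 : 0 ≤ I := setIntegral_nonneg measurableSet_Ioi fun y hy => le_min (by positivity) (le_of_lt hy)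
  have hJ0 : 0 ≤ J := setIntegral_nonneg measurableSet_Ioi fun y hy => by
    have hy1 : (1 : ℝ) < y := hy
    have := Real.log_pos hy1
    have : 0 < y := by linarith
    positivity
  have hlogI := integrable_log hn hγ hγle hH1
  refine ⟨Cq * 8 + (β + I) * A * 1152 + 4 ^ (2 + γ) * J, by positivity, ?_⟩
  intro w v hw hv hvK hvA
  have hpw : (0 : ℝ) < (1 + w) ^ (-(2 + γ)) := by positivity
  rcases lt_or_ge w 1 with hw1 | hw1
  · have h1 := hq v hv hvK
    have h2 : 1 ≤ 8 * (1 + w) ^ (-(2 + γ)) := by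
      have h3 : (1 + w) ^ (2 + γ) ≤ 8 := by
        calc (1 + w) ^ (2 + γ) ≤ (2 : ℝ) ^ (2 + γ) :=
              Real.rpow_le_rpow (by linarith) (by linarith) (by linarith)
          _ ≤ (2 : ℝ) ^ (3 : ℝ) := Real.rpow_le_rpow_of_exponent_le (by norm_num) (by linarith)
          _ = 8 := by norm_num
      rw [Real.rpow_neg (by linarith), ← div_eq_mul_inv, le_div_iff₀ (by positivity)]
      linarith
    have h4 : Cq * v ≤ Cq * 8 * (1 + w) ^ (-(2 + γ)) * v := by
      have : Cq * v * 1 ≤ Cq * v * (8 * (1 + w) ^ (-(2 + γ))) := by gcongr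
      nlinarith
    refine h1.trans (h4.trans ?_)
    gcongr
    have : 0 ≤ (β + I) * A * 1152 + 4 ^ (2 + γ) * J := by positivity
    linarith
  · set Y := Real.exp (w / 2) with hY
    have hY1 : 1 ≤ Y := Real.one_le_exp (by linarith)
    have hpt : ∀ y, 0 < y → Real.exp (-v * y) - 1 + v * y ≤
        v * (v * Y) * min (y ^ 2) y + v * ((w / 2) ^ (-(2 + γ))) *
          (Ioi (1 : ℝ)).indicator (fun y : ℝ => y * Real.log y ^ (2 + γ)) y := by
      intro y hy
      have e : -v * y = -(v * y) := by ring
      have hvy : 0 ≤ v * y := by positivity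
      rw [e]
      rcases le_or_gt y Y with h | h
      · have h1 : 0 ≤ v * ((w / 2) ^ (-(2 + γ))) *
          (Ioi (1 : ℝ)).indicator (fun y : ℝ => y * Real.log y ^ (2 + γ)) y := by
          refine mul_nonneg (by positivity) (indicator_nonneg (fun z hz => ?_) y)
          have hz1 : (1 : ℝ) < z := hz
          have := Real.log_pos hz1
          have : 0 < z := by linarith
          positivity
        have h2 : (v * y) ^ 2 ≤ v * (v * Y) * min (y ^ 2) y := by
          have e2 : (v * y) ^ 2 = v * v * y ^ 2 := by ring
          have e3 : v * (v * Y) * min (y ^ 2) y = v * v * (Y * min (y ^ 2) y) := by ring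
          rw [e2, e3]
          refine mul_le_mul_of_nonneg_left ?_ (by positivity)
          rcases min_choice (y ^ 2) y with h' | h' <;> rw [h'] <;> nlinarith
        linarith [gb_le_sq hvy]
      · have hy1 : 1 < y := by linarith
        rw [indicator_of_mem (show y ∈ Ioi (1 : ℝ) from hy1)]
        have hlog : w / 2 ≤ Real.log y := by
          rw [Real.le_log_iff_exp_le hy]; exact h.le
        have h3 : 1 ≤ (w / 2) ^ (-(2 + γ)) * Real.log y ^ (2 + γ) := by
          rw [Real.rpow_neg (by linarith), inv_mul_eq_div, le_div_iff₀ (by positivity), one_mul]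
          exact Real.rpow_le_rpow (by linarith) hlog (by linarith)
        have h4 : 0 ≤ v * (v * Y) * min (y ^ 2) y := by
          have : 0 ≤ min (y ^ 2) y := le_min (by positivity) hy.le
          positivity
        have h5 : v * y * 1 ≤ v * y * ((w / 2) ^ (-(2 + γ)) * Real.log y ^ (2 + γ)) := by gcongr
        have := gb_le hvy
        nlinarith
    have hint2 : IntegrableOn (fun y => (Ioi (1 : ℝ)).indicator (fun y : ℝ => y * Real.log y ^ (2 + γ)) y) (Ioi 0) n :=
      ((integrable_indicator_iff measurableSet_Ioi).mpr hlogI).integrableOn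
    have hJ2 : ∫ y in Ioi (0 : ℝ), (Ioi (1 : ℝ)).indicator (fun y : ℝ => y * Real.log y ^ (2 + γ)) y ∂n = J := by
      rw [setIntegral_indicator measurableSet_Ioi, hJ]
      rw [inter_eq_self_of_subset_right (Ioi_subset_Ioi zero_le_one)]
    have hi := setIntegral_mono_on (gb_integrable hn hv)
      (((integrable_min hn).const_mul (v * (v * Y))).add (hint2.const_mul (v * ((w / 2) ^ (-(2 + γ))))))
      measurableSet_Ioi (fun y hy => hpt y hy)
    simp only [Pi.add_apply] at hi
    rw [integral_add ((integrable_min hn).const_mul (v * (v * Y))) (hint2.const_mul (v * ((w / 2) ^ (-(2 + γ))))), integral_const_mul, integral_const_mul, hJ2, ← hI] at hi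
    have hvY : v * Y ≤ A * 1152 * (1 + w) ^ (-(2 + γ)) := by
      have h6 : v * Y ≤ A * (1 + w) * Real.exp (-(w / 2)) := by
        calc v * Y ≤ A * (1 + w) * Real.exp (-(Real.sqrt 2 * w)) * Y := by gcongr
          _ = A * (1 + w) * Real.exp (-(Real.sqrt 2 * w) + w / 2) := by rw [Real.exp_add, hY]; ring
          _ ≤ A * (1 + w) * Real.exp (-(w / 2)) := by
            gcongr
            have : 1 ≤ Real.sqrt 2 := by rw [Real.one_le_sqrt]; norm_num
            nlinarith
      have h7 : (1 + w) * Real.exp (-(w / 2)) ≤ 1152 * (1 + w) ^ (-(2 + γ)) := by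
        have h8 : (1 + w) ^ (-(3 : ℝ)) ≤ (1 + w) ^ (-(2 + γ)) :=
          Real.rpow_le_rpow_of_exponent_le (by linarith) (by linarith)
        have h9 : (1 + w) * Real.exp (-(w / 2)) ≤ 1152 * (1 + w) ^ (-(3 : ℝ)) := by
          rw [Real.rpow_neg (by linarith), ← div_eq_mul_inv, le_div_iff₀ (by positivity)]
          have := poly_exp_bound hw
          have e3 : (1 + w) ^ (3 : ℝ) = (1 + w) ^ 3 := by norm_cast
          rw [e3]
          nlinarith
        linarith
      calc v * Y ≤ A * ((1 + w) * Real.exp (-(w / 2))) := by linarith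
        _ ≤ A * (1152 * (1 + w) ^ (-(2 + γ))) := by gcongr
        _ = _ := by ring
    have hvv : v ≤ v * Y := by nlinarith
    have hw2 : (w / 2) ^ (-(2 + γ)) ≤ 4 ^ (2 + γ) * (1 + w) ^ (-(2 + γ)) := by
      have e1 : (4 : ℝ) ^ (2 + γ) * (1 + w) ^ (-(2 + γ)) = ((1 + w) / 4) ^ (-(2 + γ)) := by
        rw [Real.div_rpow (by linarith) (by norm_num), Real.rpow_neg (by norm_num : (0:ℝ) ≤ 4)]
        field_simp
      rw [e1]
      exact Real.rpow_le_rpow_of_nonpos (by linarith) (by linarith) (by linarith)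
    unfold qf
    have hf : β * v ^ 2 ≤ β * v * (A * 1152 * (1 + w) ^ (-(2 + γ))) := by
      have : β * v * v ≤ β * v * (A * 1152 * (1 + w) ^ (-(2 + γ))) := by
        gcongr; linarith
      nlinarith
    have hf2 : v * (v * Y) * I ≤ v * (A * 1152 * (1 + w) ^ (-(2 + γ))) * I := by gcongr
    have hf3 : v * (w / 2) ^ (-(2 + γ)) * J ≤ v * (4 ^ (2 + γ) * (1 + w) ^ (-(2 + γ))) * J := by gcongr
    have hf4 : 0 ≤ Cq * 8 * (1 + w) ^ (-(2 + γ)) * v := by positivity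
    calc _ ≤ β * v * (A * 1152 * (1 + w) ^ (-(2 + γ))) + (v * (A * 1152 * (1 + w) ^ (-(2 + γ))) * I + v * (4 ^ (2 + γ) * (1 + w) ^ (-(2 + γ))) * J) := by linarith
      _ ≤ _ := by nlinarith

end KPPB

namespace KPPB

/-- Bundled data for a globally bounded solution. -/
structure Sol (u : ℝ → ℝ → ℝ) (q : ℝ → ℝ) (K Cq : ℝ) : Prop where
  nonneg : ∀ t x, 0 ≤ u t x
  le : ∀ t x, u t x ≤ K
  cont : Continuous (fun p : ℝ × ℝ => u p.1 p.2)
  dt : ∀ t x, 0 < t → DifferentiableAt ℝ (fun s => u s x) t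
  c2 : ∀ t, 0 < t → ContDiff ℝ 2 (u t)
  eq : ∀ t x, 0 < t → deriv (fun s => u s x) t = 1 / 2 * deriv (deriv (u t)) x + u t x - q (u t x)
  qcont : Continuous q
  q0 : ∀ v, 0 ≤ v → 0 ≤ q v
  qle : ∀ v, 0 ≤ v → v ≤ K → q v ≤ Cq * v
  K1 : 1 ≤ K
  Cq0 : 0 ≤ Cq

lemma c2_d1 {f : ℝ → ℝ} (h : ContDiff ℝ 2 f) : ContDiff ℝ 1 (deriv f) := by
  have h2 : ContDiff ℝ (1 + 1) f := by norm_num; exact h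
  rw [contDiff_succ_iff_deriv] at h2
  exact h2.2.2

lemma c2_hd {f : ℝ → ℝ} (h : ContDiff ℝ 2 f) (x : ℝ) : HasDerivAt f (deriv f x) x :=
  (h.differentiable (by norm_num) x).hasDerivAt

lemma c2_hd2 {f : ℝ → ℝ} (h : ContDiff ℝ 2 f) (x : ℝ) :
    HasDerivAt (deriv f) (deriv (deriv f) x) x :=
  ((c2_d1 h).differentiable (by norm_num) x).hasDerivAt

lemma c2_cont2 {f : ℝ → ℝ} (h : ContDiff ℝ 2 f) : Continuous (deriv (deriv f)) :=
  (c2_d1 h).continuous_deriv (by norm_num)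

lemma c2_cont1 {f : ℝ → ℝ} (h : ContDiff ℝ 2 f) : Continuous (deriv f) :=
  (c2_d1 h).continuous

theorem sol_of_kpp {β : ℝ} {n : Measure ℝ} (hβ : 0 ≤ β)
    (hn : ∫⁻ y in Ioi (0 : ℝ), ENNReal.ofReal (min (y ^ 2) y) ∂n < ⊤)
    (h1 : psi β n 1 = 0) {u : ℝ → ℝ → ℝ} (hu : IsKPPSolution β n u)
    (hbdd : ∃ C : ℝ, ∀ x : ℝ, u 0 x ≤ C) :
    ∃ K Cq, Sol (fun t x => u (max t 0) x) (fun v => qf β n (max v 0)) K Cq := by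
  obtain ⟨hnn, hc, hdt, hc2, hb, heq⟩ := hu
  obtain ⟨C, hC⟩ := hbdd
  set K := max 1 C with hK
  have hK1 : 1 ≤ K := le_max_left _ _
  obtain ⟨Cq, hCq, hq⟩ := qf_le hβ hn K hK1
  have hle : ∀ t x, 0 ≤ t → u t x ≤ K := by
    intro t x ht
    have hT : 0 < t + 1 := by linarith
    obtain ⟨D, hD⟩ := hb (t + 1) hT
    have := max_principle (T := t + 1) (w := fun s y => u s y - K) ?_ ?_ ?_ ?_ t ⟨ht, by linarith⟩ x
    · simpa using this
    · refine ContinuousOn.sub (hc.mono ?_) (by fun_prop)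
      exact prod_mono Icc_subset_Ici_self le_rfl
    · exact ⟨D, fun s hs y => by have := (abs_le.mp (hD s hs y)).2; linarith⟩
    · intro y; have := hC y; have := le_max_right 1 C; linarith
    · intro s hs y hy
      refine ⟨deriv (fun s => u s y) s, deriv (deriv (u s)) y, deriv (u s), ?_, ?_, ?_, ?_⟩
      · exact (hdt y s hs.1).hasDerivAt.sub_const K
      · intro z; exact (c2_hd (hc2 s hs.1) z).sub_const K
      · exact c2_hd2 (hc2 s hs.1) y
      · have e := heq s hs.1 y
        have := psi_nonneg_of_one_le hβ hn h1 (v := u s y) (by linarith)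
        linarith
  refine ⟨K, Cq, ⟨fun t x => hnn _ (le_max_right _ _) x, fun t x => hle _ x (le_max_right _ _),
    ?_, ?_, ?_, ?_, qf_cont hn, fun v hv => qf_nonneg hβ _, ?_, hK1, hCq⟩⟩
  · have : Continuous (fun p : ℝ × ℝ => ((max p.1 0, p.2) : ℝ × ℝ)) := by fun_prop
    exact hc.comp_continuous this (fun p => ⟨show (0:ℝ) ≤ max p.1 0 from le_max_right _ _, mem_univ _⟩)
  · intro t x ht
    refine (hdt x t ht).congr_of_eventuallyEq ?_
    filter_upwards [eventually_gt_nhds ht] with s hs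
    rw [max_eq_left hs.le]
  · intro t ht
    simp only [max_eq_left ht.le]; exact hc2 t ht
  · intro t x ht
    have e1 : deriv (fun s => u (max s 0) x) t = deriv (fun s => u s x) t := by
      apply Filter.EventuallyEq.deriv_eq
      filter_upwards [eventually_gt_nhds ht] with s hs
      rw [max_eq_left hs.le]
    have := heq t ht x
    rw [psi_eq_qf] at this
    simp only [max_eq_left ht.le, e1]
    rw [max_eq_left (hnn t ht.le x)]
    linarith
  · intro v hv hvK
    simp only [max_eq_left hv]; exact hq v hv hvK

namespace Sol
variable {u : ℝ → ℝ → ℝ} {q : ℝ → ℝ} {K Cq : ℝ}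

lemma barrier_aux (S : Sol u q K Cq) {s x0 M1 M : ℝ} (hs : 0 < s) (hM1 : |deriv (u s) x0| ≤ M1)
    (hM1M : 2 * M1 ≤ M) 
    (hini : ∀ x, |u s x - u s x0 - deriv (u s) x0 * (x - x0)| ≤ M / 2 * (x - x0) ^ 2)
    {σ : ℝ} (hσ : |σ| = 1) {h : ℝ} (hh : 0 ≤ h) :
    σ * (u (s + h) x0 - u s x0) ≤ (M / 2 + (K + Cq * K)) * h := by
  have hM10 : 0 ≤ M1 := (abs_nonneg _).trans hM1
  have hσ1 := (abs_le.mp hσ.le)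
  have habs : ∀ z c : ℝ, |z| ≤ c → σ * z ≤ c := fun z c hz => by
    calc σ * z ≤ |σ * z| := le_abs_self _
      _ = |z| := by rw [abs_mul, hσ, one_mul]
      _ ≤ c := hz
  have := max_principle (T := h) (w := fun τ x => σ * (u (s + τ) x - u s x0 - deriv (u s) x0 * (x - x0))
    - (M / 2 * ((x - x0) ^ 2 + τ) + (K + Cq * K) * τ)) ?_ ?_ ?_ ?_ h ⟨hh, le_rfl⟩ x0
  · simp only [sub_self, mul_zero, sub_zero] at this
    nlinarith
  · refine Continuous.continuousOn ?_
    have : Continuous (fun p : ℝ × ℝ => u (s + p.1) p.2) :=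
      S.cont.comp (by fun_prop : Continuous (fun p : ℝ × ℝ => ((s + p.1, p.2) : ℝ × ℝ)))
    exact (((this.sub continuous_const).sub (by fun_prop)).const_mul _).sub (by fun_prop)
  · refine ⟨2 * K + M1, fun t ht x => ?_⟩
    have hK := S.K1
    have hb1 : |u (s + t) x - u s x0 - deriv (u s) x0 * (x - x0)| ≤ 2 * K + M1 * |x - x0| := by
      have e1 : |deriv (u s) x0 * (x - x0)| ≤ M1 * |x - x0| := by rw [abs_mul]; gcongr
      have e2 : |u (s + t) x - u s x0| ≤ 2 * K := by
        rw [abs_le]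
        constructor <;> linarith [S.nonneg (s + t) x, S.nonneg s x0, S.le (s + t) x, S.le s x0]
      exact (abs_sub _ _).trans (add_le_add e2 e1)
    have hb2 := habs _ _ hb1
    have hd : M1 * |x - x0| ≤ M1 + M / 2 * (x - x0) ^ 2 := by
      rw [← sq_abs (x - x0)]
      nlinarith [sq_nonneg (|x - x0| - 1), mul_nonneg hM10 (sq_nonneg (|x - x0| - 1)), sq_nonneg (|x-x0|), mul_nonneg (sub_nonneg.mpr hM1M) (sq_nonneg (|x-x0|)), mul_nonneg hM10 (sq_nonneg (|x - x0|))]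
    have hC := mul_nonneg S.Cq0 (by linarith : 0 ≤ K)
    have : 0 ≤ (K + Cq * K) * t := mul_nonneg (by linarith) ht.1
    have : 0 ≤ M * t := mul_nonneg (by linarith) ht.1
    linarith
  · intro x
    have := habs _ _ (hini x)
    simp only [add_zero, mul_zero]; linarith
  · intro t ht x hx
    have hst : 0 < s + t := by linarith [ht.1]
    have c2 := S.c2 (s + t) hst
    refine ⟨σ * (deriv (fun r => u r x) (s + t)) - (M / 2 * 1 + (K + Cq * K) * 1),
      σ * deriv (deriv (u (s + t))) x - M / 2 * 2,
      fun y => σ * (deriv (u (s + t)) y - deriv (u s) x0 * 1) - M / 2 * (2 * (y - x0)), ?_, ?_, ?_, ?_⟩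
    · refine HasDerivAt.sub (HasDerivAt.const_mul σ ?_) ?_
      · have h1 : HasDerivAt (fun r => u r x) (deriv (fun r => u r x) (s + t)) (s + t) :=
          (S.dt (s + t) x hst).hasDerivAt
        exact ((h1.comp_const_add s t).sub_const _).sub_const _
      · exact (((hasDerivAt_id' t).const_add _).const_mul _).add ((hasDerivAt_id' t).const_mul _)
    · intro y
      refine HasDerivAt.sub (HasDerivAt.const_mul σ ?_) ?_
      · exact ((c2_hd c2 y).sub_const _).sub (((hasDerivAt_id' y).sub_const x0).const_mul _)
      · have h2 := ((((hasDerivAt_id' y).sub_const x0).fun_pow 2).add_const t).const_mul (M / 2)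
        have h3 := h2.add_const ((K + Cq * K) * t)
        simpa using h3
    · have h3 := ((c2_hd2 c2 x).sub_const (deriv (u s) x0 * 1)).const_mul σ
      have h4 := (((hasDerivAt_id' x).sub_const x0).const_mul 2).const_mul (M / 2)
      exact (h3.sub h4).congr_deriv (by ring)
    · rw [S.eq (s + t) x hst]
      have h5 : σ * (u (s + t) x - q (u (s + t) x)) ≤ K + Cq * K := by
        apply habs
        have n1 := S.nonneg (s + t) x
        have n2 := S.le (s + t) x
        have n3 := S.q0 _ n1
        have n4 := S.qle _ n1 n2
        have n5 := mul_le_mul_of_nonneg_left n2 S.Cq0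
        rw [abs_le]; constructor <;> nlinarith [S.K1, S.Cq0]
      nlinarith

lemma barrier (S : Sol u q K Cq) {s : ℝ} (hs : 0 < s) (R : ℝ) :
    ∃ L, 0 ≤ L ∧ ∀ x0 ∈ Icc (-R) R, ∀ h, 0 ≤ h → |u (s + h) x0 - u s x0| ≤ L * h := by
  have c2 := S.c2 s hs
  obtain ⟨M0, hM0⟩ := (isCompact_Icc (a := -R - 1) (b := R + 1)).exists_bound_of_continuousOn
    (c2_cont2 c2).continuousOn
  obtain ⟨M1, hM1⟩ := (isCompact_Icc (a := -R - 1) (b := R + 1)).exists_bound_of_continuousOn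
    (c2_cont1 c2).continuousOn
  have hK := S.K1
  set N0 := |M0|
  set N1 := |M1|
  have hN0 : 0 ≤ N0 := abs_nonneg _
  have hN1 : 0 ≤ N1 := abs_nonneg _
  have hC := mul_nonneg S.Cq0 (by linarith : 0 ≤ K)
  refine ⟨(2 * (N0 + 2 * K + N1)) / 2 + (K + Cq * K), by positivity, fun x0 hx0 h hh => ?_⟩
  have hd1 : |deriv (u s) x0| ≤ N1 :=
    (hM1 x0 ⟨by linarith [hx0.1], by linarith [hx0.2]⟩).trans (le_abs_self _)
  have hini : ∀ x, |u s x - u s x0 - deriv (u s) x0 * (x - x0)| ≤ (2 * (N0 + 2 * K + N1)) / 2 * (x - x0) ^ 2 := by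
    intro x
    rcases le_or_gt |x - x0| 1 with hx | hx
    · set I := Icc (x0 - |x - x0|) (x0 + |x - x0|) with hI
      have hsub : ∀ y ∈ I, y ∈ Icc (-R - 1) (R + 1) := fun y hy =>
        ⟨by linarith [hy.1, hx0.1], by linarith [hy.2, hx0.2]⟩
      have hx0I : x0 ∈ I := ⟨by linarith [abs_nonneg (x - x0)], by linarith [abs_nonneg (x - x0)]⟩
      have hxI : x ∈ I := ⟨by linarith [neg_abs_le (x - x0)], by linarith [le_abs_self (x - x0)]⟩
      have e1 : ∀ y ∈ I, |deriv (u s) y - deriv (u s) x0| ≤ N0 * |x - x0| := by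
        intro y hy
        have := Convex.norm_image_sub_le_of_norm_hasDerivWithin_le (f := deriv (u s))
          (f' := deriv (deriv (u s))) (s := I) (C := N0) (x := x0) (y := y)
          (fun z hz => (c2_hd2 c2 z).hasDerivWithinAt)
          (fun z hz => (hM0 z (hsub z hz)).trans (le_abs_self _)) (convex_Icc _ _) hx0I hy
        rw [Real.norm_eq_abs, Real.norm_eq_abs] at this
        refine this.trans ?_
        refine mul_le_mul_of_nonneg_left ?_ hN0
        rw [abs_le]; exact ⟨by linarith [hy.1], by linarith [hy.2]⟩
      have e2 := Convex.norm_image_sub_le_of_norm_hasDerivWithin_le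
          (f := fun y => u s y - deriv (u s) x0 * y)
          (f' := fun y => deriv (u s) y - deriv (u s) x0 * 1) (s := I) (C := N0 * |x - x0|) (x := x0) (y := x)
          (fun z hz => ((c2_hd c2 z).sub ((hasDerivAt_id' z).const_mul _)).hasDerivWithinAt)
          (fun z hz => by rw [mul_one]; exact e1 z hz) (convex_Icc _ _) hx0I hxI
      rw [Real.norm_eq_abs, Real.norm_eq_abs] at e2
      have e3 : u s x - u s x0 - deriv (u s) x0 * (x - x0) = u s x - deriv (u s) x0 * x - (u s x0 - deriv (u s) x0 * x0) := by ring
      rw [e3]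
      refine e2.trans ?_
      rw [mul_assoc, ← sq, sq_abs]
      have : 0 ≤ (2 * K + N1) * (x - x0) ^ 2 := by positivity
      nlinarith
    · have e1 : |deriv (u s) x0 * (x - x0)| ≤ N1 * |x - x0| := by rw [abs_mul]; gcongr
      have e2 : |u s x - u s x0| ≤ 2 * K := by
        rw [abs_le]
        constructor <;> linarith [S.nonneg s x, S.nonneg s x0, S.le s x, S.le s x0]
      refine (abs_sub _ _).trans ((add_le_add e2 e1).trans ?_)
      rw [← sq_abs (x - x0)]
      have : |x - x0| ≤ |x - x0| ^ 2 := by nlinarith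
      have : 1 ≤ |x - x0| ^ 2 := by nlinarith
      have := mul_nonneg hN0 (sq_nonneg |x - x0|)
      nlinarith
  rw [abs_le]
  have b1 := S.barrier_aux hs hd1 (M := 2 * (N0 + 2 * K + N1)) (by linarith) hini (σ := 1) (by simp) hh
  have b2 := S.barrier_aux hs hd1 (M := 2 * (N0 + 2 * K + N1)) (by linarith) hini (σ := -1) (by simp) hh
  constructor <;> linarith

end Sol
end KPPB

namespace KPPB
namespace Sol
variable {u : ℝ → ℝ → ℝ} {q : ℝ → ℝ} {K Cq : ℝ}

lemma interval_restrict {f : ℝ → ℝ} {R a b : ℝ} (ha : -R ≤ a) (hab : a ≤ b) (hb : b ≤ R)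
    (hf : IntervalIntegrable f volume (-R) R)
    (h1 : ∀ x, x < a → f x = 0) (h2 : ∀ x, b < x → f x = 0) :
    ∫ x in (-R)..R, f x = ∫ x in a..b, f x := by
  have i1 : IntervalIntegrable f volume (-R) a :=
    hf.mono_set (by rw [uIcc_of_le ha, uIcc_of_le (by linarith)]; exact Icc_subset_Icc le_rfl (by linarith))
  have i2 : IntervalIntegrable f volume a b :=
    hf.mono_set (by rw [uIcc_of_le hab, uIcc_of_le (by linarith)]; exact Icc_subset_Icc ha hb)
  have i3 : IntervalIntegrable f volume b R :=
    hf.mono_set (by rw [uIcc_of_le hb, uIcc_of_le (by linarith)]; exact Icc_subset_Icc (by linarith) le_rfl)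
  rw [← intervalIntegral.integral_add_adjacent_intervals i1 (i2.trans i3),
    ← intervalIntegral.integral_add_adjacent_intervals i2 i3]
  have e1 : ∫ x in (-R)..a, f x = 0 := by
    rw [intervalIntegral.integral_of_le ha, integral_Ioc_eq_integral_Ioo]
    exact setIntegral_eq_zero_of_forall_eq_zero fun x hx => h1 x hx.2
  have e2 : ∫ x in b..R, f x = 0 := by
    rw [intervalIntegral.integral_of_le hb]
    exact setIntegral_eq_zero_of_forall_eq_zero fun x hx => h2 x hx.1
  rw [e1, e2]; ring

/-- Compactly supported Green identity on the moving half line `x ≥ ℓ + κ s`. -/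
theorem green_compact (S : Sol u q K Cq) {r t l κ N : ℝ} (hr : 0 ≤ r) (hrt : r ≤ t) (hN : 0 < N)
    {φ φd φw φww : ℝ → ℝ → ℝ}
    (cφ : Continuous (fun p : ℝ × ℝ => φ p.1 p.2)) (cφd : Continuous (fun p : ℝ × ℝ => φd p.1 p.2))
    (cφw : Continuous (fun p : ℝ × ℝ => φw p.1 p.2))
    (cφww : Continuous (fun p : ℝ × ℝ => φww p.1 p.2))
    (h0 : ∀ s, φ s 0 = 0) (hN0 : ∀ s w, N ≤ w → φ s w = 0) (hNd : ∀ s w, N ≤ w → φd s w = 0)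
    (hNw : ∀ s, φw s N = 0)
    (hd : ∀ s ∈ Ioo r t, ∀ w, HasDerivAt (fun σ => φ σ (w - κ * (σ - s))) (φd s w) s)
    (hw : ∀ s ∈ Ioo r t, ∀ w, HasDerivAt (φ s) (φw s w) w)
    (hww : ∀ s ∈ Ioo r t, ∀ w, HasDerivAt (φw s) (φww s w) w) :
    (∫ w in (0:ℝ)..N, u t (l + κ * t + w) * φ t w) - (∫ w in (0:ℝ)..N, u r (l + κ * r + w) * φ r w)
      = ∫ s in r..t, (1 / 2 * u s (l + κ * s) * φw s 0 + ∫ w in (0:ℝ)..N,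
          (u s (l + κ * s + w) * (φd s w + 1 / 2 * φww s w + φ s w)
            - q (u s (l + κ * s + w)) * φ s w)) := by
  set lam : ℝ → ℝ := fun s => l + κ * s with hlam
  have cu : Continuous (fun p : ℝ × ℝ => u (p.1) (l + κ * p.1 + p.2)) :=
    S.cont.comp (by fun_prop : Continuous (fun p : ℝ × ℝ => ((p.1, l + κ * p.1 + p.2) : ℝ × ℝ)))
  set F : ℝ → ℝ := fun s => ∫ w in (0:ℝ)..N, u s (lam s + w) * φ s w with hF
  set G : ℝ → ℝ := fun s => 1 / 2 * u s (lam s) * φw s 0 + ∫ w in (0:ℝ)..N,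
          (u s (lam s + w) * (φd s w + 1 / 2 * φww s w + φ s w)
            - q (u s (lam s + w)) * φ s w) with hG
  have hFc : Continuous F := by
    apply intervalIntegral.continuous_parametric_intervalIntegral_of_continuous'
    exact cu.mul cφ
  have hGc : Continuous G := by
    refine Continuous.add ?_ ?_
    · have c1 : Continuous fun s => u s (lam s) :=
        S.cont.comp (by fun_prop : Continuous (fun s : ℝ => ((s, l + κ * s) : ℝ × ℝ)))
      have c2 : Continuous fun s => φw s 0 :=
        cφw.comp (by fun_prop : Continuous (fun s : ℝ => ((s, 0) : ℝ × ℝ)))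
      exact (continuous_const.mul c1).mul c2
    · apply intervalIntegral.continuous_parametric_intervalIntegral_of_continuous'
      exact (cu.mul ((cφd.add (continuous_const.mul cφww)).add cφ)).sub ((S.qcont.comp cu).mul cφ)
  -- the common spatial window
  set R : ℝ := |l| + |κ| * |t| + N + 1 with hRdef
  have hlamR : ∀ s ∈ Icc r t, -R ≤ lam s ∧ lam s + N ≤ R := by
    intro s hs
    have h1 : |κ * s| ≤ |κ| * |t| := by
      rw [abs_mul]
      refine mul_le_mul_of_nonneg_left ?_ (abs_nonneg _)
      rw [abs_of_nonneg (hr.trans hs.1), abs_of_nonneg (hr.trans hrt)]; exact hs.2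
    have h2 := abs_le.mp h1
    have h3 := abs_le.mp (le_refl |l|)
    simp only [hlam]
    constructor <;> linarith
  set Φ : ℝ → ℝ → ℝ := fun s x => φ s (max (x - lam s) 0) with hΦ
  have hΦ0 : ∀ s x, x ≤ lam s → Φ s x = 0 := by
    intro s x hx
    simp only [hΦ]; rw [max_eq_right (by linarith), h0]
  have hΦ1 : ∀ s x, lam s ≤ x → Φ s x = φ s (x - lam s) := by
    intro s x hx
    simp only [hΦ]; rw [max_eq_left (by linarith)]
  have cΦ : Continuous (fun p : ℝ × ℝ => Φ p.1 p.2) :=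
    cφ.comp (by fun_prop : Continuous (fun p : ℝ × ℝ => ((p.1, max (p.2 - (l + κ * p.1)) 0) : ℝ × ℝ)))
  have hFΦ : ∀ s ∈ Icc r t, F s = ∫ x in (-R)..R, u s x * Φ s x := by
    intro s hs
    obtain ⟨b1, b2⟩ := hlamR s hs
    rw [interval_restrict b1 (by linarith) b2]
    · simp only [hF]
      have := intervalIntegral.integral_comp_add_left (a := 0) (b := N) (fun x => u s x * Φ s x) (lam s)
      rw [add_zero] at this
      rw [← this]
      refine intervalIntegral.integral_congr fun w hw => ?_
      rw [uIcc_of_le hN.le] at hw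
      beta_reduce
      rw [hΦ1 _ _ (by linarith [hw.1])]
      congr 2; ring
    · refine Continuous.intervalIntegrable ?_ _ _
      exact (S.cont.comp (by fun_prop : Continuous (fun x : ℝ => ((s, x) : ℝ × ℝ)))).mul
        (cΦ.comp (by fun_prop : Continuous (fun x : ℝ => ((s, x) : ℝ × ℝ))))
    · intro x hx; rw [hΦ0 _ _ hx.le, mul_zero]
    · intro x hx; rw [hΦ1 _ _ (by linarith), hN0 _ _ (by linarith), mul_zero]
  -- bounds for the test function on compacts
  obtain ⟨B1, hB1⟩ := ((isCompact_Icc (a := r) (b := t)).prod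
    (isCompact_Icc (a := -(2 * R)) (b := 2 * R))).exists_bound_of_continuousOn cφd.continuousOn
  obtain ⟨B2, hB2⟩ := ((isCompact_Icc (a := r) (b := t)).prod
    (isCompact_Icc (a := -(2 * R)) (b := 2 * R))).exists_bound_of_continuousOn cφw.continuousOn
  obtain ⟨B3, hB3⟩ := ((isCompact_Icc (a := r) (b := t)).prod
    (isCompact_Icc (a := -(2 * R)) (b := 2 * R))).exists_bound_of_continuousOn cφ.continuousOn
  have hRpos : 0 < R := by positivity
  have hxl : ∀ s ∈ Icc r t, ∀ x ∈ Icc (-R) R, x - lam s ∈ Icc (-(2 * R)) (2 * R) := by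
    intro s hs x hx
    obtain ⟨b1, b2⟩ := hlamR s hs
    exact ⟨by linarith [hx.1], by linarith [hx.2]⟩
  have hsm : ∀ s ∈ Ioo r t, ∀ w ∈ Icc 0 (2 * R), |φ s w| ≤ |B2| * w := by
    intro s hs w hwm
    have := Convex.norm_image_sub_le_of_norm_hasDerivWithin_le (f := φ s) (f' := φw s)
      (s := Icc 0 (2 * R)) (C := |B2|) (x := 0) (y := w)
      (fun z hz => (hw s hs z).hasDerivWithinAt)
      (fun z hz => (hB2 (s, z) ⟨⟨hs.1.le, hs.2.le⟩, by linarith [hz.1], hz.2⟩).trans (le_abs_self _))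
      (convex_Icc _ _) ⟨le_rfl, by linarith⟩ hwm
    rw [h0, sub_zero, sub_zero, Real.norm_eq_abs, Real.norm_eq_abs, abs_of_nonneg hwm.1] at this
    exact this
  have hpath : ∀ s ∈ Ioo r t, ∀ x, HasDerivAt (fun σ => φ σ (x - lam σ)) (φd s (x - lam s)) s := by
    intro s hs x
    have := hd s hs (x - lam s)
    convert this using 3
    simp only [hlam]; ring
  have hlip : ∀ s ∈ Ioo r t, ∀ s' ∈ Ioo s t, ∀ x ∈ Icc (-R) R,
      |Φ s' x - Φ s x| ≤ (|B1| + |B2| * |κ|) * (s' - s) := by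
    intro s hs s' hs' x hx
    have hs'2 : s' ∈ Ioo r t := ⟨hs.1.trans hs'.1, hs'.2⟩
    have hsI : s ∈ Icc r t := ⟨hs.1.le, hs.2.le⟩
    have hsI' : s' ∈ Icc r t := ⟨hs'2.1.le, hs'2.2.le⟩
    have hss : 0 < s' - s := by linarith [hs'.1]
    have hκ : |lam s' - lam s| ≤ |κ| * (s' - s) := by
      simp only [hlam]
      rw [show l + κ * s' - (l + κ * s) = κ * (s' - s) by ring, abs_mul, abs_of_pos hss]
    have hκ' := abs_le.mp hκ
    have hk0 : 0 ≤ |B1| * (s' - s) := by positivity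
    have hk1 : 0 ≤ |B2| * |κ| * (s' - s) := by positivity
    rcases le_or_gt x (lam s) with h | h
    · rw [hΦ0 _ _ h, sub_zero]
      rcases le_or_gt x (lam s') with h' | h'
      · rw [hΦ0 _ _ h', abs_zero]; nlinarith
      · rw [hΦ1 _ _ h'.le]
        have := hsm s' hs'2 (x - lam s') ⟨by linarith, (hxl s' hsI' x hx).2⟩
        have e : |B2| * (x - lam s') ≤ |B2| * (|κ| * (s' - s)) := by gcongr; linarith
        nlinarith
    · rw [hΦ1 _ _ h.le]
      rcases le_or_gt x (lam s') with h' | h'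
      · rw [hΦ0 _ _ h', zero_sub, abs_neg]
        have := hsm s hs (x - lam s) ⟨by linarith, (hxl s hsI x hx).2⟩
        have e : |B2| * (x - lam s) ≤ |B2| * (|κ| * (s' - s)) := by gcongr; linarith
        nlinarith
      · rw [hΦ1 _ _ h'.le]
        have := Convex.norm_image_sub_le_of_norm_hasDerivWithin_le (f := fun σ => φ σ (x - lam σ))
          (f' := fun σ => φd σ (x - lam σ)) (s := Icc s s') (C := |B1|) (x := s) (y := s')
          (fun σ hσ => (hpath σ ⟨hs.1.trans_le hσ.1, hσ.2.trans_lt hs'.2⟩ x).hasDerivWithinAt)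
          (fun σ hσ => (hB1 (σ, x - lam σ) ⟨⟨hs.1.le.trans hσ.1, hσ.2.trans hs'.2.le⟩,
            hxl σ ⟨hs.1.le.trans hσ.1, hσ.2.trans hs'.2.le⟩ x hx⟩).trans (le_abs_self _))
          (convex_Icc _ _) ⟨le_rfl, hs'.1.le⟩ ⟨hs'.1.le, le_rfl⟩
        rw [Real.norm_eq_abs, Real.norm_eq_abs, abs_of_pos hss] at this
        nlinarith
  -- right derivative
  have hder : ∀ s ∈ Ioo r t, HasDerivWithinAt F (G s) (Ioi s) s := by
    intro s hs
    have hs0 : 0 < s := lt_of_le_of_lt hr hs.1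
    have hsI : s ∈ Icc r t := ⟨hs.1.le, hs.2.le⟩
    have c2 := S.c2 s hs0
    obtain ⟨b1, b2⟩ := hlamR s hsI
    set ut : ℝ → ℝ := fun x => 1 / 2 * deriv (deriv (u s)) x + u s x - q (u s x) with hut
    have cus : Continuous (u s) := c2.continuous
    have cut : Continuous ut :=
      ((continuous_const.mul (c2_cont2 c2)).add cus).sub (S.qcont.comp cus)
    have cφs : Continuous (φ s) := cφ.comp (by fun_prop : Continuous (fun x : ℝ => ((s, x) : ℝ × ℝ)))
    have cφds : Continuous (φd s) := cφd.comp (by fun_prop : Continuous (fun x : ℝ => ((s, x) : ℝ × ℝ)))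
    have cφws : Continuous (φw s) := cφw.comp (by fun_prop : Continuous (fun x : ℝ => ((s, x) : ℝ × ℝ)))
    have cφwws : Continuous (φww s) := cφww.comp (by fun_prop : Continuous (fun x : ℝ => ((s, x) : ℝ × ℝ)))
    set d : ℝ → ℝ := fun x => (Ioi (lam s)).indicator
      (fun x => ut x * φ s (x - lam s) + u s x * φd s (x - lam s)) x with hdd
    obtain ⟨L, hL0, hL⟩ := S.barrier hs0 R
    rw [hasDerivWithinAt_iff_tendsto_slope' (by simp)]
    have hIoo : Ioo s t ∈ 𝓝[>] s := Ioo_mem_nhdsGT hs.2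
    have key : Tendsto (fun s' => ∫ x in (-R)..R, (s' - s)⁻¹ * (u s' x * Φ s' x - u s x * Φ s x))
        (𝓝[>] s) (𝓝 (∫ x in (-R)..R, d x)) := by
      refine intervalIntegral.tendsto_integral_filter_of_dominated_convergence
        (fun _ => L * |B3| + K * (|B1| + |B2| * |κ|)) ?_ ?_ ?_ ?_
      · refine Eventually.of_forall fun s' => Continuous.aestronglyMeasurable ?_
        have a1 : Continuous fun x => u s' x := S.cont.comp (by fun_prop : Continuous (fun x : ℝ => ((s', x) : ℝ × ℝ)))
        have a2 : Continuous fun x => Φ s' x := cΦ.comp (by fun_prop : Continuous (fun x : ℝ => ((s', x) : ℝ × ℝ)))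
        have a3 : Continuous fun x => Φ s x := cΦ.comp (by fun_prop : Continuous (fun x : ℝ => ((s, x) : ℝ × ℝ)))
        exact continuous_const.mul ((a1.mul a2).sub (cus.mul a3))
      · filter_upwards [hIoo] with s' hs'
        refine Eventually.of_forall fun x hx => ?_
        rw [uIoc_of_le (by linarith)] at hx
        have hx' : x ∈ Icc (-R) R := ⟨hx.1.le, hx.2⟩
        have hss : 0 < s' - s := by linarith [hs'.1]
        have hsI' : s' ∈ Icc r t := ⟨(hs.1.trans hs'.1).le, hs'.2.le⟩
        have e1 : |u s' x - u s x| ≤ L * (s' - s) := by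
          have := hL x hx' (s' - s) hss.le
          rwa [show s + (s' - s) = s' by ring] at this
        have e2 := hlip s hs s' hs' x hx'
        have e3 : |Φ s' x| ≤ |B3| := by
          simp only [hΦ]
          have m := hxl s' hsI' x hx'
          exact (hB3 (s', max (x - lam s') 0) ⟨hsI', le_max_of_le_left m.1, max_le m.2 (by linarith)⟩).trans (le_abs_self _)
        have e4 : |u s x| ≤ K := by rw [abs_of_nonneg (S.nonneg s x)]; exact S.le s x
        rw [Real.norm_eq_abs, abs_mul, abs_inv, abs_of_pos hss, inv_mul_le_iff₀ hss]
        have e5 : u s' x * Φ s' x - u s x * Φ s x = (u s' x - u s x) * Φ s' x + u s x * (Φ s' x - Φ s x) := by ring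
        rw [e5]
        refine (abs_add_le _ _).trans ?_
        rw [abs_mul, abs_mul]
        have m1 : |u s' x - u s x| * |Φ s' x| ≤ L * (s' - s) * |B3| := by gcongr
        have m2 : |u s x| * |Φ s' x - Φ s x| ≤ K * ((|B1| + |B2| * |κ|) * (s' - s)) :=
          mul_le_mul e4 e2 (abs_nonneg _) (by linarith [S.K1])
        nlinarith
      · exact intervalIntegrable_const
      · have hne : ∀ᵐ x : ℝ, x ≠ lam s := by
          rw [ae_iff]; simp
        filter_upwards [hne] with x hx _
        have hux : HasDerivAt (fun σ => u σ x) (ut x) s := by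
          have := (S.dt s x hs0).hasDerivAt
          rw [S.eq s x hs0] at this
          exact this
        have lamc : Continuous lam := by fun_prop
        have hprod : HasDerivAt (fun σ => u σ x * Φ σ x) (d x) s := by
          rcases lt_or_gt_of_ne hx with h | h
          · have hz : (fun σ => u σ x * Φ σ x) =ᶠ[𝓝 s] fun _ => (0 : ℝ) := by
              filter_upwards [lamc.continuousAt.eventually (lt_mem_nhds h)] with σ hσ
              rw [hΦ0 _ _ hσ.le, mul_zero]
            have hdx : d x = 0 := by
              simp only [hdd]; exact indicator_of_notMem (by simp; exact h.le) _
            rw [hdx]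
            exact (hasDerivAt_const s (0 : ℝ)).congr_of_eventuallyEq hz
          · have hdx : d x = ut x * φ s (x - lam s) + u s x * φd s (x - lam s) := by
              simp only [hdd]; exact indicator_of_mem (by exact h) _
            have hz : (fun σ => u σ x * Φ σ x) =ᶠ[𝓝 s] fun σ => u σ x * φ σ (x - lam σ) := by
              filter_upwards [lamc.continuousAt.eventually (gt_mem_nhds h)] with σ hσ
              rw [hΦ1 _ _ hσ.le]
            rw [hdx]
            exact (hux.mul (hpath s hs x)).congr_of_eventuallyEq hz
        have := (hprod.hasDerivWithinAt (s := Ioi s))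
        rw [hasDerivWithinAt_iff_tendsto_slope' (by simp)] at this
        refine this.congr fun s' => ?_
        rw [slope_def_field]; field_simp
    have hGd : ∫ x in (-R)..R, d x = G s := by
      have cdd : Continuous (fun x => ut x * φ s (x - lam s) + u s x * φd s (x - lam s)) := by fun_prop
      rw [interval_restrict b1 (by linarith) b2]
      · have e0 : ∫ x in (lam s)..(lam s + N), d x = ∫ x in (lam s)..(lam s + N), (ut x * φ s (x - lam s) + u s x * φd s (x - lam s)) := by
          rw [intervalIntegral.integral_of_le (by linarith), intervalIntegral.integral_of_le (by linarith)]
          refine setIntegral_congr_fun measurableSet_Ioc fun x hx => ?_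
          simp only [hdd]; exact indicator_of_mem (by exact hx.1) _
        rw [e0]
        have := intervalIntegral.integral_comp_add_left (a := 0) (b := N) (fun x => (ut x * φ s (x - lam s) + u s x * φd s (x - lam s))) (lam s)
        rw [add_zero] at this
        rw [← this]
        simp only [add_sub_cancel_left]
        set U : ℝ → ℝ := fun w => u s (lam s + w) with hU
        set U1 : ℝ → ℝ := fun w => deriv (u s) (lam s + w) with hU1
        set U2 : ℝ → ℝ := fun w => deriv (deriv (u s)) (lam s + w) with hU2
        have cU : Continuous U := cus.comp (by fun_prop)
        have cU1 : Continuous U1 := (c2_cont1 c2).comp (by fun_prop)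
        have cU2 : Continuous U2 := (c2_cont2 c2).comp (by fun_prop)
        have dU : ∀ w, HasDerivAt U (U1 w) w := fun w => (c2_hd c2 (lam s + w)).comp_const_add (lam s) w
        have dU1 : ∀ w, HasDerivAt U1 (U2 w) w := fun w => (c2_hd2 c2 (lam s + w)).comp_const_add (lam s) w
        have p1 := intervalIntegral.integral_mul_deriv_eq_deriv_mul (a := 0) (b := N)
          (fun w _ => hw s hs w) (fun w _ => dU1 w) (cφws.intervalIntegrable _ _) (cU2.intervalIntegrable _ _)
        have p2 := intervalIntegral.integral_mul_deriv_eq_deriv_mul (a := 0) (b := N)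
          (fun w _ => hww s hs w) (fun w _ => dU w) (cφwws.intervalIntegrable _ _) (cU1.intervalIntegrable _ _)
        rw [h0, hN0 s N le_rfl] at p1
        rw [hNw] at p2
        have hU0 : U 0 = u s (lam s) := by simp [hU]
        simp only [hG]
        have q1 : ∫ w in (0:ℝ)..N, (ut (lam s + w) * φ s w + u s (lam s + w) * φd s w)
            = 1 / 2 * (∫ w in (0:ℝ)..N, φ s w * U2 w) + ∫ w in (0:ℝ)..N, ((U w - q (U w)) * φ s w + U w * φd s w) := by
          rw [← intervalIntegral.integral_const_mul, ← intervalIntegral.integral_add]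
          · refine intervalIntegral.integral_congr fun w _ => ?_
            simp only [hut, hU, hU2]; ring
          · exact Continuous.intervalIntegrable (by fun_prop) _ _
          · refine Continuous.intervalIntegrable ?_ _ _
            have := S.qcont
            fun_prop
        have q2 : ∫ w in (0:ℝ)..N, (u s (lam s + w) * (φd s w + 1 / 2 * φww s w + φ s w) - q (u s (lam s + w)) * φ s w)
            = 1 / 2 * (∫ w in (0:ℝ)..N, φww s w * U w) + ∫ w in (0:ℝ)..N, ((U w - q (U w)) * φ s w + U w * φd s w) := by
          rw [← intervalIntegral.integral_const_mul, ← intervalIntegral.integral_add]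
          · refine intervalIntegral.integral_congr fun w _ => ?_
            simp only [hU]; ring
          · exact Continuous.intervalIntegrable (by fun_prop) _ _
          · refine Continuous.intervalIntegrable ?_ _ _
            have := S.qcont
            fun_prop
        rw [q1, q2, p1, p2, hU0]
        ring
      · rw [intervalIntegrable_iff]
        exact (cdd.integrableOn_uIoc).indicator measurableSet_Ioi
      · intro x hx
        simp only [hdd]; exact indicator_of_notMem (by simp; exact hx.le) _
      · intro x hx
        simp only [hdd]; rw [indicator_of_mem (show x ∈ Ioi (lam s) by simp; linarith),
          hN0 _ _ (by linarith), hNd _ _ (by linarith)]; ring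
    rw [hGd] at key
    refine key.congr' ?_
    filter_upwards [hIoo] with s' hs'
    have hsI' : s' ∈ Icc r t := ⟨(hs.1.trans hs'.1).le, hs'.2.le⟩
    rw [slope_def_field, hFΦ s' hsI', hFΦ s hsI, intervalIntegral.integral_const_mul,
      intervalIntegral.integral_sub, div_eq_inv_mul]
    · refine Continuous.intervalIntegrable ?_ _ _
      exact (S.cont.comp (by fun_prop : Continuous (fun x : ℝ => ((s', x) : ℝ × ℝ)))).mul
        (cΦ.comp (by fun_prop : Continuous (fun x : ℝ => ((s', x) : ℝ × ℝ))))
    · refine Continuous.intervalIntegrable ?_ _ _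
      exact (S.cont.comp (by fun_prop : Continuous (fun x : ℝ => ((s, x) : ℝ × ℝ)))).mul
        (cΦ.comp (by fun_prop : Continuous (fun x : ℝ => ((s, x) : ℝ × ℝ))))
  have := intervalIntegral.integral_eq_sub_of_hasDeriv_right (a := r) (b := t) (f := F) (f' := G)
    hFc.continuousOn (by rw [min_eq_left hrt, max_eq_right hrt]; exact hder) (hGc.intervalIntegrable _ _)
  exact this.symm

end Sol
end KPPB

namespace KPPB

lemma exists_cutoff : ∃ χ χ1 χ2 : ℝ → ℝ, ∃ C : ℝ, 0 ≤ C ∧ Continuous χ ∧ Continuous χ1 ∧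
    Continuous χ2 ∧ (∀ w, HasDerivAt χ (χ1 w) w) ∧ (∀ w, HasDerivAt χ1 (χ2 w) w) ∧
    (∀ w, w ≤ 1 → χ w = 1) ∧ (∀ w, w ≤ 0 → χ1 w = 0) ∧ (∀ w, 3 ≤ w → χ w = 0) ∧
    (∀ w, 3 ≤ w → χ1 w = 0) ∧ (∀ w, 0 ≤ χ w) ∧ (∀ w, χ w ≤ 1) ∧ (∀ w, |χ1 w| ≤ C) ∧
    (∀ w, |χ2 w| ≤ C) := by
  set χ : ℝ → ℝ := fun w => Real.smoothTransition (2 - w) with hχ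
  have hc : ContDiff ℝ 2 χ := by
    exact Real.smoothTransition.contDiff.comp (by fun_prop)
  have one : ∀ w, w ≤ 1 → χ w = 1 := fun w hw => Real.smoothTransition.one_of_one_le (by linarith)
  have zero : ∀ w, 2 ≤ w → χ w = 0 := fun w hw => Real.smoothTransition.zero_of_nonpos (by linarith)
  have d1l : ∀ w, w < 1 → deriv χ w = 0 := by
    intro w hw
    have : χ =ᶠ[𝓝 w] fun _ => (1 : ℝ) := by
      filter_upwards [eventually_lt_nhds hw] with z hz using one z hz.le
    rw [this.deriv_eq]; simp
  have d1r : ∀ w, 2 < w → deriv χ w = 0 := by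
    intro w hw
    have : χ =ᶠ[𝓝 w] fun _ => (0 : ℝ) := by
      filter_upwards [eventually_gt_nhds hw] with z hz using zero z hz.le
    rw [this.deriv_eq]; simp
  have d2l : ∀ w, w < 1 → deriv (deriv χ) w = 0 := by
    intro w hw
    have : deriv χ =ᶠ[𝓝 w] fun _ => (0 : ℝ) := by
      filter_upwards [eventually_lt_nhds hw] with z hz using d1l z hz
    rw [this.deriv_eq]; simp
  have d2r : ∀ w, 2 < w → deriv (deriv χ) w = 0 := by
    intro w hw
    have : deriv χ =ᶠ[𝓝 w] fun _ => (0 : ℝ) := by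
      filter_upwards [eventually_gt_nhds hw] with z hz using d1r z hz
    rw [this.deriv_eq]; simp
  obtain ⟨C1, h1⟩ := (isCompact_Icc (a := (0:ℝ)) (b := 3)).exists_bound_of_continuousOn
    (c2_cont1 hc).continuousOn
  obtain ⟨C2, h2⟩ := (isCompact_Icc (a := (0:ℝ)) (b := 3)).exists_bound_of_continuousOn
    (c2_cont2 hc).continuousOn
  refine ⟨χ, deriv χ, deriv (deriv χ), |C1| + |C2|, by positivity, hc.continuous, c2_cont1 hc,
    c2_cont2 hc, c2_hd hc, c2_hd2 hc, one, fun w hw => d1l w (by linarith), fun w hw => zero w (by linarith),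
    fun w hw => d1r w (by linarith), fun w => Real.smoothTransition.nonneg _,
    fun w => Real.smoothTransition.le_one _, ?_, ?_⟩
  · intro w
    by_cases hw : w ∈ Icc (0:ℝ) 3
    · exact (h1 w hw).trans (by linarith [le_abs_self C1, abs_nonneg C2])
    · have : deriv χ w = 0 := by
        rw [mem_Icc, not_and_or, not_le, not_le] at hw
        rcases hw with hw | hw
        · exact d1l w (by linarith)
        · exact d1r w (by linarith)
      rw [this, abs_zero]; positivity
  · intro w
    by_cases hw : w ∈ Icc (0:ℝ) 3
    · exact (h2 w hw).trans (by linarith [le_abs_self C2, abs_nonneg C1])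
    · have : deriv (deriv χ) w = 0 := by
        rw [mem_Icc, not_and_or, not_le, not_le] at hw
        rcases hw with hw | hw
        · exact d2l w (by linarith)
        · exact d2r w (by linarith)
      rw [this, abs_zero]; positivity

/-- The exponentially tilted solution in the moving frame. -/
noncomputable def Wf (u : ℝ → ℝ → ℝ) (κ l s w : ℝ) : ℝ :=
  Real.exp (κ * w + (κ ^ 2 / 2 - 1) * s) * u s (l + κ * s + w)

noncomputable def Sf (u : ℝ → ℝ → ℝ) (q : ℝ → ℝ) (κ l s w : ℝ) : ℝ :=
  Real.exp (κ * w + (κ ^ 2 / 2 - 1) * s) * q (u s (l + κ * s + w))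

namespace Sol
variable {u : ℝ → ℝ → ℝ} {q : ℝ → ℝ} {K Cq : ℝ}

lemma Wf_nonneg (S : Sol u q K Cq) (κ l s w : ℝ) : 0 ≤ Wf u κ l s w :=
  mul_nonneg (Real.exp_pos _).le (S.nonneg _ _)

lemma Sf_nonneg (S : Sol u q K Cq) (κ l s w : ℝ) : 0 ≤ Sf u q κ l s w :=
  mul_nonneg (Real.exp_pos _).le (S.q0 _ (S.nonneg _ _))

lemma Wf_cont (S : Sol u q K Cq) (κ l : ℝ) : Continuous (fun p : ℝ × ℝ => Wf u κ l p.1 p.2) := by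
  unfold Wf
  have : Continuous (fun p : ℝ × ℝ => u p.1 (l + κ * p.1 + p.2)) :=
    S.cont.comp (by fun_prop : Continuous (fun p : ℝ × ℝ => ((p.1, l + κ * p.1 + p.2) : ℝ × ℝ)))
  exact Continuous.mul (by fun_prop) this

lemma Sf_cont (S : Sol u q K Cq) (κ l : ℝ) : Continuous (fun p : ℝ × ℝ => Sf u q κ l p.1 p.2) := by
  unfold Sf
  have : Continuous (fun p : ℝ × ℝ => u p.1 (l + κ * p.1 + p.2)) :=
    S.cont.comp (by fun_prop : Continuous (fun p : ℝ × ℝ => ((p.1, l + κ * p.1 + p.2) : ℝ × ℝ)))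
  exact Continuous.mul (by fun_prop) (S.qcont.comp this)

theorem green_ineq (S : Sol u q K Cq) {r t l κ : ℝ} (hr : 0 ≤ r) (hrt : r ≤ t)
    {h hs hw hww : ℝ → ℝ → ℝ} {b : ℝ → ℝ} {C1 : ℝ}
    (ch : Continuous (fun p : ℝ × ℝ => h p.1 p.2)) (chs : Continuous (fun p : ℝ × ℝ => hs p.1 p.2))
    (chw : Continuous (fun p : ℝ × ℝ => hw p.1 p.2))
    (chww : Continuous (fun p : ℝ × ℝ => hww p.1 p.2))
    (h0 : ∀ s, h s 0 = 0)
    (dhs : ∀ s ∈ Ioo r t, ∀ w, HasDerivAt (fun σ => h σ (w - κ * (σ - s))) (hs s w - κ * hw s w) s)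
    (dhw : ∀ s ∈ Ioo r t, ∀ w, HasDerivAt (h s) (hw s w) w)
    (dhww : ∀ s ∈ Ioo r t, ∀ w, HasDerivAt (hw s) (hww s w) w)
    (hI : ∀ s ∈ Icc r t, IntegrableOn (fun w => Wf u κ l s w * (|h s w| + |hw s w|)) (Ioi 0) ∧
      ∫ w in Ioi (0:ℝ), Wf u κ l s w * (|h s w| + |hw s w|) ≤ C1)
    (hb : IntervalIntegrable b volume r t)
    (he : ∀ s ∈ Ioo r t, ∃ e : ℝ → ℝ, (∀ w, 0 < w → 0 ≤ e w) ∧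
      (∀ w, 0 < w → Wf u κ l s w * (hs s w + 1 / 2 * hww s w) - Sf u q κ l s w * h s w ≤ e w) ∧
      IntegrableOn e (Ioi 0) ∧ ∫ w in Ioi (0:ℝ), e w ≤ b s) :
    (∫ w in Ioi (0:ℝ), Wf u κ l t w * h t w) - (∫ w in Ioi (0:ℝ), Wf u κ l r w * h r w)
      ≤ ∫ s in r..t, (1 / 2 * Wf u κ l s 0 * hw s 0 + b s) := by
  obtain ⟨χ, χ1, χ2, C, hC, cχ, cχ1, cχ2, dχ, dχ1, χone, χ1z, χz, χ1z3, χ0, χle, χ1b, χ2b⟩ := exists_cutoff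
  have cW := S.Wf_cont κ l
  have cS := S.Sf_cont κ l
  have cWs : ∀ s, Continuous (fun w => Wf u κ l s w) := fun s =>
    cW.comp (by fun_prop : Continuous (fun x : ℝ => ((s, x) : ℝ × ℝ)))
  have cSs : ∀ s, Continuous (fun w => Sf u q κ l s w) := fun s =>
    cS.comp (by fun_prop : Continuous (fun x : ℝ => ((s, x) : ℝ × ℝ)))
  have chs1 : ∀ s, Continuous (fun w => h s w) := fun s =>
    ch.comp (by fun_prop : Continuous (fun x : ℝ => ((s, x) : ℝ × ℝ)))
  have chs2 : ∀ s, Continuous (fun w => hw s w) := fun s =>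
    chw.comp (by fun_prop : Continuous (fun x : ℝ => ((s, x) : ℝ × ℝ)))
  have chs3 : ∀ s, Continuous (fun w => hs s w) := fun s =>
    chs.comp (by fun_prop : Continuous (fun x : ℝ => ((s, x) : ℝ × ℝ)))
  have chs4 : ∀ s, Continuous (fun w => hww s w) := fun s =>
    chww.comp (by fun_prop : Continuous (fun x : ℝ => ((s, x) : ℝ × ℝ)))
  set θ : ℝ := κ ^ 2 / 2 - 1 with hθ
  set E : ℝ → ℝ → ℝ := fun s w => Real.exp (κ * w + θ * s) with hE
  -- step 1: the inequality for each cutoff scale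
  have step : ∀ N : ℝ, 1 ≤ N →
      (∫ w in (0:ℝ)..(3 * N), Wf u κ l t w * (h t w * χ (w / N)))
        - (∫ w in (0:ℝ)..(3 * N), Wf u κ l r w * (h r w * χ (w / N)))
      ≤ (∫ s in r..t, (1 / 2 * Wf u κ l s 0 * hw s 0 + b s)) + C * C1 * (t - r) / N := by
    intro N hN
    have hNp : 0 < N := by linarith
    have dX : ∀ w, HasDerivAt (fun w => χ (w / N)) (χ1 (w / N) / N) w := by
      intro w
      have := (dχ (w / N)).comp w ((hasDerivAt_id' w).div_const N)
      exact this.congr_deriv (by ring)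
    have dX1 : ∀ w, HasDerivAt (fun w => χ1 (w / N) / N) (χ2 (w / N) / N / N) w := by
      intro w
      have := ((dχ1 (w / N)).comp w ((hasDerivAt_id' w).div_const N)).div_const N
      exact this.congr_deriv (by ring)
    have cE : Continuous (fun p : ℝ × ℝ => E p.1 p.2) := by simp only [hE]; fun_prop
    have cX : Continuous (fun p : ℝ × ℝ => χ (p.2 / N)) := by fun_prop
    have cX1 : Continuous (fun p : ℝ × ℝ => χ1 (p.2 / N) / N) := by fun_prop
    have cX2 : Continuous (fun p : ℝ × ℝ => χ2 (p.2 / N) / N / N) := by fun_prop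
    have dE : ∀ s w, HasDerivAt (E s) (E s w * κ) w := by
      intro s w
      have := (((hasDerivAt_id' w).const_mul κ).add_const (θ * s)).exp
      exact this.congr_deriv (by simp only [hE]; ring)
    have dEp : ∀ s w, HasDerivAt (fun σ => E σ (w - κ * (σ - s))) (E s w * (θ - κ ^ 2)) s := by
      intro s w
      have h1 : HasDerivAt (fun σ => κ * (w - κ * (σ - s)) + θ * σ) (κ * (-(κ * 1)) + θ * 1) s :=
        ((((((hasDerivAt_id' s).sub_const s).const_mul κ).const_sub w).const_mul κ)).add ((hasDerivAt_id' s).const_mul θ)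
      have := h1.exp
      refine this.congr_deriv ?_
      simp only [hE, sub_self, mul_zero, sub_zero]; ring
    have dXp : ∀ s w, HasDerivAt (fun σ => χ ((w - κ * (σ - s)) / N)) (-(κ * (χ1 (w / N) / N))) s := by
      intro s w
      have h1 : HasDerivAt (fun σ => w - κ * (σ - s)) (-(κ * 1)) s :=
        ((((hasDerivAt_id' s).sub_const s).const_mul κ).const_sub w)
      have h2 := dX w
      have h3 : HasDerivAt (fun w => χ (w / N)) (χ1 (w / N) / N) (w - κ * (s - s)) := by simpa using h2
      have := h3.comp s h1
      refine this.congr_deriv ?_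
      ring
    have G := S.green_compact (l := l) (κ := κ) (r := r) (t := t) (N := 3 * N) hr hrt (by linarith)
      (φ := fun s w => E s w * (h s w * χ (w / N)))
      (φd := fun s w => E s w * (θ - κ ^ 2) * (h s w * χ (w / N)) + E s w * ((hs s w - κ * hw s w) * χ (w / N) + h s w * (-(κ * (χ1 (w / N) / N)))))
      (φw := fun s w => E s w * κ * (h s w * χ (w / N)) + E s w * (hw s w * χ (w / N) + h s w * (χ1 (w / N) / N)))
      (φww := fun s w => (E s w * κ * κ * (h s w * χ (w / N)) + E s w * κ * (hw s w * χ (w / N) + h s w * (χ1 (w / N) / N)))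
        + (E s w * κ * (hw s w * χ (w / N) + h s w * (χ1 (w / N) / N)) + E s w * ((hww s w * χ (w / N) + hw s w * (χ1 (w / N) / N)) + (hw s w * (χ1 (w / N) / N) + h s w * (χ2 (w / N) / N / N)))))
      (cE.mul (ch.mul cX))
      (((cE.mul continuous_const).mul (ch.mul cX)).add (cE.mul (((chs.sub (chw.const_mul κ)).mul cX).add (ch.mul ((cX1.const_mul κ).neg)))))
      (((cE.mul continuous_const).mul (ch.mul cX)).add (cE.mul ((chw.mul cX).add (ch.mul cX1))))
      (((((cE.mul continuous_const).mul continuous_const).mul (ch.mul cX)).add ((cE.mul continuous_const).mul ((chw.mul cX).add (ch.mul cX1)))).add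
        (((cE.mul continuous_const).mul ((chw.mul cX).add (ch.mul cX1))).add (cE.mul (((chww.mul cX).add (chw.mul cX1)).add ((chw.mul cX1).add (ch.mul cX2))))))
      (fun s => by simp only [h0]; ring)
      (fun s w hw3 => by rw [χz (w / N) (by rw [le_div_iff₀ hNp]; exact hw3)]; ring)
      (fun s w hw3 => by rw [χz (w / N) (by rw [le_div_iff₀ hNp]; exact hw3), χ1z3 (w / N) (by rw [le_div_iff₀ hNp]; exact hw3)]; ring)
      (fun s => by rw [χz (3 * N / N) (by rw [le_div_iff₀ hNp]), χ1z3 (3 * N / N) (by rw [le_div_iff₀ hNp])]; ring)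
      (fun s hsm w => by
        have := (dEp s w).mul ((dhs s hsm w).mul (dXp s w))
        refine this.congr_deriv ?_
        simp only [Pi.mul_apply, sub_self, mul_zero, sub_zero])
      (fun s hsm w => (dE s w).mul ((dhw s hsm w).mul (dX w)))
      (fun s hsm w => ((((dE s w).mul_const κ).mul ((dhw s hsm w).mul (dX w))).add ((dE s w).mul (((dhww s hsm w).mul (dX w)).add ((dhw s hsm w).mul (dX1 w))))))
    have eW : ∀ s w, u s (l + κ * s + w) * (E s w * (h s w * χ (w / N))) = Wf u κ l s w * (h s w * χ (w / N)) := by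
      intro s w; simp only [Wf, hE]; ring
    simp only [eW] at G
    rw [G]
    have rhs : (∫ s in r..t, (1 / 2 * Wf u κ l s 0 * hw s 0 + b s)) + C * C1 * (t - r) / N =
        ∫ s in r..t, ((1 / 2 * Wf u κ l s 0 * hw s 0 + b s) + C * C1 / N) := by
      rw [intervalIntegral.integral_add _ intervalIntegrable_const]
      · simp; ring
      · refine IntervalIntegrable.add (Continuous.intervalIntegrable ?_ _ _) hb
        have c1 : Continuous fun s => Wf u κ l s 0 := cW.comp (by fun_prop : Continuous (fun s : ℝ => ((s, 0) : ℝ × ℝ)))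
        have c2 : Continuous fun s => hw s 0 := chw.comp (by fun_prop : Continuous (fun s : ℝ => ((s, 0) : ℝ × ℝ)))
        exact (continuous_const.mul c1).mul c2
    rw [rhs]
    have cu : Continuous (fun p : ℝ × ℝ => u (p.1) (l + κ * p.1 + p.2)) :=
      S.cont.comp (by fun_prop : Continuous (fun p : ℝ × ℝ => ((p.1, l + κ * p.1 + p.2) : ℝ × ℝ)))
    -- rewrite the integrand
    have inner : ∀ s w, (u s (l + κ * s + w) * ((E s w * (θ - κ ^ 2) * (h s w * χ (w / N)) + E s w * ((hs s w - κ * hw s w) * χ (w / N) + h s w * (-(κ * (χ1 (w / N) / N)))))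
        + 1 / 2 * ((E s w * κ * κ * (h s w * χ (w / N)) + E s w * κ * (hw s w * χ (w / N) + h s w * (χ1 (w / N) / N)))
        + (E s w * κ * (hw s w * χ (w / N) + h s w * (χ1 (w / N) / N)) + E s w * ((hww s w * χ (w / N) + hw s w * (χ1 (w / N) / N)) + (hw s w * (χ1 (w / N) / N) + h s w * (χ2 (w / N) / N / N)))))
        + E s w * (h s w * χ (w / N))) - q (u s (l + κ * s + w)) * (E s w * (h s w * χ (w / N))))
        = (Wf u κ l s w * (hs s w + 1 / 2 * hww s w) - Sf u q κ l s w * h s w) * χ (w / N)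
          + Wf u κ l s w * (hw s w * (χ1 (w / N) / N) + 1 / 2 * h s w * (χ2 (w / N) / N / N)) := by
      intro s w
      simp only [Wf, Sf, hE, hθ]; ring
    simp only [inner]
    have hfe : ∀ s w, q (u s (l + κ * s + w)) * (E s w * (h s w * χ (w / N))) = Sf u q κ l s w * (h s w * χ (w / N)) := by
      intro s w; simp only [Sf, hE]; ring
    refine intervalIntegral.integral_mono_on_of_le_Ioo hrt ?_ ?_ ?_
    · refine Continuous.intervalIntegrable ?_ _ _
      refine Continuous.add ?_ ?_
      · have a1 : Continuous fun s => u s (l + κ * s) :=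
          S.cont.comp (by fun_prop : Continuous (fun s : ℝ => ((s, l + κ * s) : ℝ × ℝ)))
        have a2 : Continuous fun s => E s 0 := cE.comp (by fun_prop : Continuous (fun s : ℝ => ((s, 0) : ℝ × ℝ)))
        have a3 : Continuous fun s => h s 0 := ch.comp (by fun_prop : Continuous (fun s : ℝ => ((s, 0) : ℝ × ℝ)))
        have a4 : Continuous fun s => hw s 0 := chw.comp (by fun_prop : Continuous (fun s : ℝ => ((s, 0) : ℝ × ℝ)))
        exact (continuous_const.mul a1).mul (((a2.mul continuous_const).mul (a3.mul continuous_const)).add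
          (a2.mul ((a4.mul continuous_const).add (a3.mul continuous_const))))
      · apply intervalIntegral.continuous_parametric_intervalIntegral_of_continuous'
        exact (((cW.mul (chs.add (continuous_const.mul chww))).sub (cS.mul ch)).mul cX).add
          (cW.mul ((chw.mul cX1).add ((continuous_const.mul ch).mul cX2)))
    · refine IntervalIntegrable.add (IntervalIntegrable.add (Continuous.intervalIntegrable ?_ _ _) hb) intervalIntegrable_const
      have c1 : Continuous fun s => Wf u κ l s 0 := cW.comp (by fun_prop : Continuous (fun s : ℝ => ((s, 0) : ℝ × ℝ)))
      have c2 : Continuous fun s => hw s 0 := chw.comp (by fun_prop : Continuous (fun s : ℝ => ((s, 0) : ℝ × ℝ)))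
      exact (continuous_const.mul c1).mul c2
    · intro s hsm
      have hsI : s ∈ Icc r t := ⟨hsm.1.le, hsm.2.le⟩
      obtain ⟨e, e0, ele, eint, eb⟩ := he s hsm
      obtain ⟨iI, iC⟩ := hI s hsI
      have bdry : 1 / 2 * u s (l + κ * s) * (E s 0 * κ * (h s 0 * χ (0 / N)) + E s 0 * (hw s 0 * χ (0 / N) + h s 0 * (χ1 (0 / N) / N)))
          = 1 / 2 * Wf u κ l s 0 * hw s 0 := by
        rw [h0, zero_div, χone 0 (by norm_num)]
        simp only [Wf, hE]
        rw [add_zero]; ring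
      rw [bdry]
      have cWi : Continuous (fun w => (Wf u κ l s w * (hs s w + 1 / 2 * hww s w) - Sf u q κ l s w * h s w) * χ (w / N)) := by
        have := cWs s; have := cSs s; have := chs1 s; have := chs3 s; have := chs4 s
        fun_prop
      have cWi2 : Continuous (fun w => Wf u κ l s w * (hw s w * (χ1 (w / N) / N) + 1 / 2 * h s w * (χ2 (w / N) / N / N))) := by
        have := cWs s; have := chs1 s; have := chs2 s
        fun_prop
      rw [intervalIntegral.integral_add (cWi.intervalIntegrable _ _) (cWi2.intervalIntegrable _ _)]
      have t1 : ∫ w in (0:ℝ)..(3 * N), (Wf u κ l s w * (hs s w + 1 / 2 * hww s w) - Sf u q κ l s w * h s w) * χ (w / N) ≤ b s := by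
        rw [intervalIntegral.integral_of_le (by linarith)]
        calc _ ≤ ∫ w in Ioc 0 (3 * N), e w := by
              refine setIntegral_mono_on (cWi.integrableOn_Ioc) (eint.mono_set Ioc_subset_Ioi_self) measurableSet_Ioc fun w hwm => ?_
              have a1 := ele w hwm.1
              have a2 := e0 w hwm.1
              have a3 := χ0 (w / N)
              have a4 := χle (w / N)
              calc _ ≤ e w * χ (w / N) := by gcongr
                _ ≤ e w := by nlinarith
          _ ≤ ∫ w in Ioi 0, e w := by
              refine setIntegral_mono_set eint ?_ (Ioc_subset_Ioi_self).eventuallyLE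
              filter_upwards [ae_restrict_mem measurableSet_Ioi] with w hwm using e0 w hwm
          _ ≤ b s := eb
      have t2 : ∫ w in (0:ℝ)..(3 * N), Wf u κ l s w * (hw s w * (χ1 (w / N) / N) + 1 / 2 * h s w * (χ2 (w / N) / N / N)) ≤ C * C1 / N := by
        rw [intervalIntegral.integral_of_le (by linarith)]
        calc _ ≤ ∫ w in Ioc 0 (3 * N), C / N * (Wf u κ l s w * (|h s w| + |hw s w|)) := by
              refine setIntegral_mono_on (cWi2.integrableOn_Ioc) ((iI.mono_set Ioc_subset_Ioi_self).const_mul _) measurableSet_Ioc fun w hwm => ?_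
              have w0 := S.Wf_nonneg κ l s w
              have k1 : hw s w * (χ1 (w / N) / N) ≤ C / N * |hw s w| := by
                calc _ ≤ |hw s w * (χ1 (w / N) / N)| := le_abs_self _
                  _ = |hw s w| * (|χ1 (w / N)| / N) := by rw [abs_mul, abs_div, abs_of_pos hNp]
                  _ ≤ |hw s w| * (C / N) := by gcongr; exact χ1b _
                  _ = _ := by ring
              have k2 : 1 / 2 * h s w * (χ2 (w / N) / N / N) ≤ C / N * |h s w| := by
                calc _ ≤ |1 / 2 * h s w * (χ2 (w / N) / N / N)| := le_abs_self _
                  _ = 1 / 2 * |h s w| * (|χ2 (w / N)| / N / N) := by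
                    rw [abs_mul, abs_mul, abs_of_pos (by norm_num : (0:ℝ) < 1 / 2), abs_div, abs_div, abs_of_pos hNp]
                  _ ≤ 1 * |h s w| * (C / N / 1) := by gcongr; · norm_num
                                                      · exact χ2b _
                  _ = _ := by ring
              calc _ ≤ Wf u κ l s w * (C / N * |hw s w| + C / N * |h s w|) := by gcongr
                _ = _ := by ring
          _ ≤ ∫ w in Ioi 0, C / N * (Wf u κ l s w * (|h s w| + |hw s w|)) := by
              refine setIntegral_mono_set (iI.const_mul _) ?_ (Ioc_subset_Ioi_self).eventuallyLE
              refine Eventually.of_forall fun w => ?_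
              have w0 := S.Wf_nonneg κ l s w
              positivity
          _ = C / N * ∫ w in Ioi 0, (Wf u κ l s w * (|h s w| + |hw s w|)) := integral_const_mul _ _
          _ ≤ C / N * C1 := by gcongr
          _ = _ := by ring
      linarith
  -- step 2: limit
  have lim : ∀ s ∈ Icc r t, Tendsto (fun N : ℝ => ∫ w in (0:ℝ)..(3 * N), Wf u κ l s w * (h s w * χ (w / N))) atTop
      (𝓝 (∫ w in Ioi (0:ℝ), Wf u κ l s w * h s w)) := by
    intro s hsI
    obtain ⟨iI, iC⟩ := hI s hsI
    have L1 : Tendsto (fun N : ℝ => ∫ w in Ioi (0:ℝ), (Ioc 0 (3 * N)).indicator (fun w => Wf u κ l s w * (h s w * χ (w / N))) w) atTop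
      (𝓝 (∫ w in Ioi (0:ℝ), Wf u κ l s w * h s w)) := by
      refine tendsto_integral_filter_of_dominated_convergence (fun w => Wf u κ l s w * (|h s w| + |hw s w|)) ?_ ?_ iI ?_
      · refine Eventually.of_forall fun N => ?_
        refine AEStronglyMeasurable.indicator ?_ measurableSet_Ioc
        have := cWs s; have := chs1 s
        exact (by fun_prop : Continuous (fun w => Wf u κ l s w * (h s w * χ (w / N)))).aestronglyMeasurable
      · refine Eventually.of_forall fun N => Eventually.of_forall fun w => ?_
        refine (norm_indicator_le_norm_self _ _).trans ?_
        have w0 := S.Wf_nonneg κ l s w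
        rw [Real.norm_eq_abs, abs_mul, abs_mul, abs_of_nonneg w0, abs_of_nonneg (χ0 _)]
        gcongr
        have := χle (w / N)
        have := abs_nonneg (h s w)
        have := abs_nonneg (hw s w)
        nlinarith
      · filter_upwards [ae_restrict_mem measurableSet_Ioi] with w hwm
        have hwm' : 0 < w := hwm
        refine tendsto_const_nhds.congr' ?_
        filter_upwards [eventually_ge_atTop (max w 1)] with N hN
        have hN1 : 1 ≤ N := (le_max_right _ _).trans hN
        have hNw : w ≤ N := (le_max_left _ _).trans hN
        rw [indicator_of_mem (show w ∈ Ioc 0 (3 * N) from ⟨hwm', by linarith⟩), χone _ (by rw [div_le_one (by linarith)]; exact hNw), mul_one]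
    refine L1.congr' ?_
    filter_upwards [eventually_ge_atTop 1] with N hN
    rw [setIntegral_indicator measurableSet_Ioc, intervalIntegral.integral_of_le (by linarith),
      inter_eq_self_of_subset_right Ioc_subset_Ioi_self]
  have L := (lim t ⟨hrt, le_rfl⟩).sub (lim r ⟨le_rfl, hrt⟩)
  have Rr : Tendsto (fun N : ℝ => (∫ s in r..t, (1 / 2 * Wf u κ l s 0 * hw s 0 + b s)) + C * C1 * (t - r) / N) atTop
      (𝓝 ((∫ s in r..t, (1 / 2 * Wf u κ l s 0 * hw s 0 + b s)) + 0)) :=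
    tendsto_const_nhds.add (tendsto_const_nhds.div_atTop tendsto_id)
  rw [add_zero] at Rr
  exact le_of_tendsto_of_tendsto L Rr (by filter_upwards [eventually_ge_atTop 1] with N hN using step N hN)

end Sol
end KPPB

namespace KPPB

/-- Gaussian heat kernel. -/
noncomputable def pk (τ x : ℝ) : ℝ := Real.exp (-x ^ 2 / (2 * τ)) / Real.sqrt (2 * Real.pi * τ)

/-- Dirichlet heat kernel on the half line. -/
noncomputable def kk (τ w w' : ℝ) : ℝ := pk τ (w - w') - pk τ (w + w')

noncomputable def kw (τ w w' : ℝ) : ℝ :=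
  -((w - w') / τ) * pk τ (w - w') - -((w + w') / τ) * pk τ (w + w')

noncomputable def kww (τ w w' : ℝ) : ℝ :=
  ((w - w') ^ 2 / τ ^ 2 - 1 / τ) * pk τ (w - w') - ((w + w') ^ 2 / τ ^ 2 - 1 / τ) * pk τ (w + w')

lemma pk_pos {τ : ℝ} (hτ : 0 < τ) (x : ℝ) : 0 < pk τ x := by
  unfold pk; have := Real.pi_pos; positivity

lemma pk_nonneg (τ : ℝ) (x : ℝ) : 0 ≤ pk τ x := by
  unfold pk; positivity

lemma pk_hasDerivAt {a b : ℝ → ℝ} {a' b' σ : ℝ} (ha : HasDerivAt a a' σ) (hb : HasDerivAt b b' σ)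
    (hp : 0 < a σ) : HasDerivAt (fun σ => pk (a σ) (b σ))
      (a' * (1 / 2 * (b σ ^ 2 / a σ ^ 2 - 1 / a σ)) * pk (a σ) (b σ) + b' * (-(b σ / a σ)) * pk (a σ) (b σ)) σ := by
  unfold pk
  have hpi := Real.pi_pos
  have hs : 0 < Real.sqrt (2 * Real.pi * a σ) := by positivity
  have h1 : HasDerivAt (fun σ => Real.exp (-(b σ) ^ 2 / (2 * a σ))) _ σ :=
    (((hb.fun_pow 2).fun_neg).fun_div (ha.const_mul 2) (by positivity)).exp
  have h2 : HasDerivAt (fun σ => Real.sqrt (2 * Real.pi * a σ)) _ σ :=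
    (ha.const_mul (2 * Real.pi)).sqrt (by positivity)
  refine (h1.fun_div h2 hs.ne').congr_deriv ?_
  have e1 : Real.sqrt (2 * Real.pi * a σ) ^ 2 = 2 * Real.pi * a σ := Real.sq_sqrt (by positivity)
  have hq : ∀ S x : ℝ, S ^ 2 = 2 * Real.pi * a σ → 0 < S →
      (Real.exp x * ((-(((2:ℕ):ℝ) * b σ ^ (2 - 1) * b') * (2 * a σ) - -(b σ ^ 2) * (2 * a')) / (2 * a σ) ^ 2) * S - Real.exp x * (2 * Real.pi * a' / (2 * S))) / S ^ 2
      = a' * (1 / 2 * (b σ ^ 2 / a σ ^ 2 - 1 / a σ)) * (Real.exp x / S) + b' * (-(b σ / a σ)) * (Real.exp x / S) := by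
    intro S x hS hS0
    have h2 : 2 * Real.pi * a' / (2 * S) = a' / (2 * a σ) * S := by
      have : Real.pi = S ^ 2 / (2 * a σ) := by field_simp; linarith
      rw [this]; field_simp
    rw [h2]
    push_cast
    field_simp
    ring
  exact hq _ _ e1 hs

lemma pk_cont {X : Type*} [TopologicalSpace X] {a b : X → ℝ} (ha : Continuous a) (hb : Continuous b)
    (hp : ∀ x, 0 < a x) : Continuous (fun x => pk (a x) (b x)) := by
  unfold pk
  have hpi := Real.pi_pos
  refine Continuous.div ?_ (by fun_prop) (fun x => ?_)
  · exact Real.continuous_exp.comp (Continuous.div (by fun_prop) (by fun_prop) (fun x => by have := hp x; positivity))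
  · have := hp x
    positivity

lemma pk_mono_abs {τ x y : ℝ} (hτ : 0 < τ) (h : |x| ≤ |y|) : pk τ y ≤ pk τ x := by
  unfold pk
  have := sq_le_sq.mpr h
  exact div_le_div_of_nonneg_right (Real.exp_le_exp.mpr (div_le_div_of_nonneg_right (by linarith) (by positivity))) (Real.sqrt_nonneg _)

lemma kk_nonneg {τ w w' : ℝ} (hτ : 0 < τ) (hw : 0 ≤ w) (hw' : 0 ≤ w') : 0 ≤ kk τ w w' := by
  unfold kk
  have := pk_mono_abs (x := w - w') (y := w + w') hτ (by
    rw [abs_of_nonneg (by linarith : 0 ≤ w + w'), abs_le]; constructor <;> linarith)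
  linarith

lemma kk_zero (τ w' : ℝ) : kk τ 0 w' = 0 := by
  unfold kk pk; simp

lemma gauss_dom {T σ w w' : ℝ} (hT : 0 < T) (hσ : 0 ≤ σ) (hw' : 0 ≤ w') :
    Real.exp (σ * w) * Real.exp |w - w'| * Real.exp (-(w - w') ^ 2 / (2 * T)) ≤
      Real.exp ((σ + 1) * w' + T * (σ + 2) ^ 2 / 2) * Real.exp (-w) := by
  rw [← Real.exp_add, ← Real.exp_add, ← Real.exp_add]
  apply Real.exp_le_exp.mpr
  set x := w - w' with hx
  have hwx : w = x + w' := by rw [hx]; ring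
  rw [hwx]
  have h1 : x ≤ |x| := le_abs_self x
  have h2 : (σ + 2) * |x| ≤ x ^ 2 / (2 * T) + T * (σ + 2) ^ 2 / 2 := by
    have : 0 ≤ (|x| - T * (σ + 2)) ^ 2 / (2 * T) := by positivity
    rw [show (|x| - T * (σ + 2)) ^ 2 / (2 * T) = |x| ^ 2 / (2 * T) - (σ + 2) * |x| + T * (σ + 2) ^ 2 / 2 by field_simp; ring, sq_abs] at this
    linarith
  have h3 : (σ + 1) * x ≤ (σ + 1) * |x| := by gcongr
  rw [neg_div]
  nlinarith

lemma pk_le {τ T1 T2 x : ℝ} (h1 : 0 < T1) (h2 : T1 ≤ τ) (h3 : τ ≤ T2) :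
    pk τ x ≤ Real.exp (-x ^ 2 / (2 * T2)) / Real.sqrt (2 * Real.pi * T1) := by
  unfold pk
  have hpi := Real.pi_pos
  have h4 : -x ^ 2 / (2 * τ) ≤ -x ^ 2 / (2 * T2) := by
    rw [neg_div, neg_div]
    have : x ^ 2 / (2 * T2) ≤ x ^ 2 / (2 * τ) := by gcongr; linarith
    linarith
  have h5 : Real.sqrt (2 * Real.pi * T1) ≤ Real.sqrt (2 * Real.pi * τ) := by gcongr
  have h6 : 0 < Real.sqrt (2 * Real.pi * T1) := by positivity
  have h7 := Real.exp_le_exp.mpr h4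
  gcongr

/-- Domination of kernel and its derivative. -/
lemma kk_dom {τ T1 T2 σ w w' : ℝ} (h1 : 0 < T1) (h2 : T1 ≤ τ) (h3 : τ ≤ T2) (hσ : 0 ≤ σ)
    (hw : 0 ≤ w) (hw' : 0 ≤ w') :
    Real.exp (σ * w) * (|kk τ w w'| + |kw τ w w'|) ≤
      (2 + 2 / T1 * (1 + 2 * w')) / Real.sqrt (2 * Real.pi * T1) *
        (Real.exp ((σ + 1) * w' + T2 * (σ + 2) ^ 2 / 2) * Real.exp (-w)) := by
  have hτ : 0 < τ := by linarith
  have hpi := Real.pi_pos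
  have hT2 : 0 < T2 := by linarith
  set x := w - w' with hx
  have p1 := pk_le (x := x) h1 h2 h3
  have p2 : pk τ (w + w') ≤ pk τ x := pk_mono_abs hτ (by
    rw [abs_of_nonneg (by linarith : 0 ≤ w + w'), abs_le]; constructor <;> linarith)
  have n1 := pk_nonneg τ x
  have n2 := pk_nonneg τ (w + w')
  have k1 : |kk τ w w'| ≤ 2 * pk τ x := by
    unfold kk; rw [← hx, abs_le]; constructor <;> linarith
  have hsum : w + w' ≤ |x| + 2 * w' := by have := le_abs_self x; linarith
  have k2 : |kw τ w w'| ≤ 2 / T1 * (|x| + 2 * w') * pk τ x := by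
    unfold kw; rw [← hx]
    refine (abs_sub _ _).trans ?_
    rw [abs_mul, abs_mul, abs_neg, abs_neg, abs_div, abs_div, abs_of_pos hτ, abs_of_nonneg n1, abs_of_nonneg n2,
      abs_of_nonneg (by linarith : 0 ≤ w + w')]
    have a1 : |x| / τ * pk τ x ≤ (|x| + 2 * w') / T1 * pk τ x := by
      gcongr; linarith
    have a2 : (w + w') / τ * pk τ (w + w') ≤ (|x| + 2 * w') / T1 * pk τ x := by
      gcongr
    calc _ ≤ (|x| + 2 * w') / T1 * pk τ x + (|x| + 2 * w') / T1 * pk τ x := add_le_add a1 a2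
      _ = _ := by ring
  have ex : |x| + 1 ≤ Real.exp |x| := Real.add_one_le_exp _
  have tot : |kk τ w w'| + |kw τ w w'| ≤ (2 + 2 / T1 * (1 + 2 * w')) * Real.exp |x| * pk τ x := by
    have a0 := abs_nonneg x
    have : (2 : ℝ) + 2 / T1 * (|x| + 2 * w') ≤ (2 + 2 / T1 * (1 + 2 * w')) * Real.exp |x| := by
      have b1 : (2:ℝ) ≤ 2 * Real.exp |x| := by linarith
      have b2 : |x| + 2 * w' ≤ (1 + 2 * w') * Real.exp |x| := by nlinarith
      have b3 : 2 / T1 * (|x| + 2 * w') ≤ 2 / T1 * ((1 + 2 * w') * Real.exp |x|) := by gcongr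
      linarith
    calc _ ≤ (2 + 2 / T1 * (|x| + 2 * w')) * pk τ x := by linarith
      _ ≤ _ := by gcongr
  calc _ ≤ Real.exp (σ * w) * ((2 + 2 / T1 * (1 + 2 * w')) * Real.exp |x| * (Real.exp (-x ^ 2 / (2 * T2)) / Real.sqrt (2 * Real.pi * T1))) := by
        gcongr
        refine tot.trans ?_
        gcongr
    _ = (2 + 2 / T1 * (1 + 2 * w')) / Real.sqrt (2 * Real.pi * T1) * (Real.exp (σ * w) * Real.exp |x| * Real.exp (-x ^ 2 / (2 * T2))) := by ring
    _ ≤ _ := by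
      have := gauss_dom (w := w) hT2 hσ hw'
      rw [← hx] at this
      gcongr

lemma integrable_exp_neg_Ioi : IntegrableOn (fun w : ℝ => Real.exp (-w)) (Ioi 0) := by
  exact integrableOn_exp_neg_Ioi 0

namespace Sol
variable {u : ℝ → ℝ → ℝ} {q : ℝ → ℝ} {K Cq : ℝ}

lemma Wf_le (S : Sol u q K Cq) (κ l : ℝ) {s w T : ℝ} (hs : 0 ≤ s) (hsT : s ≤ T) (hw : 0 ≤ w) :
    Wf u κ l s w ≤ K * Real.exp (|κ ^ 2 / 2 - 1| * T) * Real.exp (|κ| * w) := by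
  unfold Wf
  have h1 : Real.exp (κ * w + (κ ^ 2 / 2 - 1) * s) ≤ Real.exp (|κ ^ 2 / 2 - 1| * T + |κ| * w) := by
    apply Real.exp_le_exp.mpr
    have a1 : κ * w ≤ |κ| * w := by gcongr; exact le_abs_self _
    have a2 : (κ ^ 2 / 2 - 1) * s ≤ |κ ^ 2 / 2 - 1| * T := by
      have := le_abs_self (κ ^ 2 / 2 - 1)
      calc _ ≤ |κ ^ 2 / 2 - 1| * s := by gcongr
        _ ≤ _ := by gcongr
    linarith
  rw [Real.exp_add (|κ ^ 2 / 2 - 1| * T)] at h1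
  have := S.K1
  calc _ ≤ Real.exp (|κ ^ 2 / 2 - 1| * T) * Real.exp (|κ| * w) * K :=
        mul_le_mul h1 (S.le _ _) (S.nonneg _ _) (by positivity)
    _ = _ := by ring

/-- Green inequality tested against the (signed, exponentially weighted) Dirichlet kernel. -/
theorem kernel_green (S : Sol u q K Cq) {r t t' l κ w' g ε : ℝ} (hr : 0 ≤ r) (hrt : r ≤ t') (htt : t' < t)
    (hw' : 0 ≤ w') (hε : |ε| = 1) {b : ℝ → ℝ} (hb : IntervalIntegrable b volume r t')
    (he : ∀ s ∈ Ioo r t', ∃ e : ℝ → ℝ, (∀ w, 0 < w → 0 ≤ e w) ∧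
      (∀ w, 0 < w → ε * (Real.exp (g * s) * ((g * Wf u κ l s w - Sf u q κ l s w) * kk (t - s) w w')) ≤ e w) ∧
      IntegrableOn e (Ioi 0) ∧ ∫ w in Ioi (0:ℝ), e w ≤ b s) :
    ε * (Real.exp (g * t') * (∫ w in Ioi (0:ℝ), Wf u κ l t' w * kk (t - t') w w')
        - Real.exp (g * r) * (∫ w in Ioi (0:ℝ), Wf u κ l r w * kk (t - r) w w'))
      ≤ ∫ s in r..t', (ε * (Real.exp (g * s) * (Wf u κ l s 0 * (w' / (t - s) * pk (t - s) w'))) + b s) := by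
  set τ : ℝ → ℝ := fun s => t - min s t' with hτ
  have τpos : ∀ s, 0 < τ s := fun s => by simp only [hτ]; have := min_le_right s t'; linarith
  have τeq : ∀ s, s ≤ t' → τ s = t - s := fun s hs => by simp only [hτ]; rw [min_eq_left hs]
  have cτ : Continuous τ := by fun_prop
  have cτ2 : Continuous (fun p : ℝ × ℝ => τ p.1) := by fun_prop
  have cp1 : Continuous (fun p : ℝ × ℝ => pk (τ p.1) (p.2 - w')) := pk_cont cτ2 (by fun_prop) (fun p => τpos _)
  have cp2 : Continuous (fun p : ℝ × ℝ => pk (τ p.1) (p.2 + w')) := pk_cont cτ2 (by fun_prop) (fun p => τpos _)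
  have ne1 : ∀ p : ℝ × ℝ, τ p.1 ≠ 0 := fun p => (τpos _).ne'
  have ne2 : ∀ p : ℝ × ℝ, τ p.1 ^ 2 ≠ 0 := fun p => pow_ne_zero 2 (τpos _).ne'
  have ck : Continuous (fun p : ℝ × ℝ => kk (τ p.1) p.2 w') := cp1.sub cp2
  have ckw : Continuous (fun p : ℝ × ℝ => kw (τ p.1) p.2 w') :=
    (((Continuous.div (by fun_prop) cτ2 ne1).neg).mul cp1).sub (((Continuous.div (by fun_prop) cτ2 ne1).neg).mul cp2)
  have ckww : Continuous (fun p : ℝ × ℝ => kww (τ p.1) p.2 w') :=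
    (((Continuous.div (by fun_prop) (cτ2.pow 2) ne2).sub (Continuous.div continuous_const cτ2 ne1)).mul cp1).sub
      (((Continuous.div (by fun_prop) (cτ2.pow 2) ne2).sub (Continuous.div continuous_const cτ2 ne1)).mul cp2)
  have cE : Continuous (fun p : ℝ × ℝ => ε * Real.exp (g * p.1)) := by fun_prop
  have dpk : ∀ T x, 0 < T → HasDerivAt (pk T) (-(x / T) * pk T x) x := by
    intro T x hT
    have := pk_hasDerivAt (a := fun _ => T) (b := fun y => y) (hasDerivAt_const x T) (hasDerivAt_id' x) hT
    exact this.congr_deriv (by ring)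
  have dpk2 : ∀ T x, 0 < T → HasDerivAt (fun x => -(x / T) * pk T x) ((x ^ 2 / T ^ 2 - 1 / T) * pk T x) x := by
    intro T x hT
    have := (((hasDerivAt_id' x).div_const T).fun_neg).fun_mul (dpk T x hT)
    exact this.congr_deriv (by field_simp; ring)
  have dk : ∀ T w, 0 < T → HasDerivAt (fun w => kk T w w') (kw T w w') w := by
    intro T w hT
    exact ((dpk T (w - w') hT).comp_sub_const w w').sub ((dpk T (w + w') hT).comp_add_const w w')
  have dk2 : ∀ T w, 0 < T → HasDerivAt (fun w => kw T w w') (kww T w w') w := by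
    intro T w hT
    exact ((dpk2 T (w - w') hT).comp_sub_const w w').sub ((dpk2 T (w + w') hT).comp_add_const w w')
  have dpath : ∀ s, s < t' → ∀ w, HasDerivAt (fun σ => kk (τ σ) (w - κ * (σ - s)) w')
      (-(1 / 2 * kww (τ s) w w') - κ * kw (τ s) w w') s := by
    intro s hs w
    have e1 : (fun σ => kk (τ σ) (w - κ * (σ - s)) w') =ᶠ[𝓝 s] fun σ => kk (t - σ) (w - κ * (σ - s)) w' := by
      filter_upwards [eventually_lt_nhds hs] with σ hσ
      rw [τeq σ hσ.le]
    refine HasDerivAt.congr_of_eventuallyEq ?_ e1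
    have d1 : HasDerivAt (fun σ => t - σ) (-1) s := (hasDerivAt_id' s).const_sub t
    have d2 : HasDerivAt (fun σ => w - κ * (σ - s)) (-(κ * 1)) s :=
      (((hasDerivAt_id' s).sub_const s).const_mul κ).const_sub w
    have q1 := pk_hasDerivAt d1 (d2.sub_const w') (by linarith)
    have q2 := pk_hasDerivAt d1 (d2.add_const w') (by linarith)
    refine (q1.sub q2).congr_deriv ?_
    simp only [sub_self, mul_zero, sub_zero, kww, kw, τeq s hs.le]
    ring
  set D := K * Real.exp (|κ ^ 2 / 2 - 1| * t) with hD
  have hK := S.K1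
  have hD0 : 0 ≤ D := by positivity
  set M := (2 + 2 / (t - t') * (1 + 2 * w')) / Real.sqrt (2 * Real.pi * (t - t')) *
        (Real.exp ((|κ| + 1) * w' + (t - r) * (|κ| + 2) ^ 2 / 2)) with hM
  have hT0 : 0 < t - t' := by linarith
  have hM0 : 0 ≤ M := by positivity
  have G := S.green_ineq (r := r) (t := t') (l := l) (κ := κ)
    (h := fun s w => ε * Real.exp (g * s) * kk (τ s) w w')
    (hw := fun s w => ε * Real.exp (g * s) * kw (τ s) w w')
    (hww := fun s w => ε * Real.exp (g * s) * kww (τ s) w w')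
    (hs := fun s w => ε * Real.exp (g * s) * (g * kk (τ s) w w' - 1 / 2 * kww (τ s) w w'))
    (b := b) (C1 := Real.exp (|g| * t) * (D * M)) hr hrt (cE.mul ck) (cE.mul ((continuous_const.mul ck).sub (continuous_const.mul ckww)))
    (cE.mul ckw) (cE.mul ckww) (fun s => by rw [kk_zero, mul_zero]) ?_ ?_ ?_ ?_ hb ?_
  · have e0 : ∀ s a, ∫ w in Ioi (0:ℝ), Wf u κ l s w * (ε * a * kk (τ s) w w') =
        ε * (a * ∫ w in Ioi (0:ℝ), Wf u κ l s w * kk (τ s) w w') := by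
      intro s a
      rw [← integral_const_mul, ← integral_const_mul]
      congr 1; ext w; ring
    rw [e0, e0, τeq t' le_rfl, τeq r hrt, ← mul_sub] at G
    refine G.trans (le_of_eq ?_)
    refine intervalIntegral.integral_congr fun s hs => ?_
    rw [uIcc_of_le hrt] at hs
    simp only [τeq s hs.2, kw, zero_sub, zero_add, pk, neg_sq]
    ring_nf
  · intro s hs w
    have d1 : HasDerivAt (fun σ => ε * Real.exp (g * σ)) (ε * (Real.exp (g * s) * (g * 1))) s :=
      (((hasDerivAt_id' s).const_mul g).exp).const_mul ε
    refine (d1.mul (dpath s hs.2 w)).congr_deriv ?_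
    simp only [sub_self, mul_zero, sub_zero]
    ring
  · intro s hs w
    exact (dk (τ s) w (τpos s)).const_mul _
  · intro s hs w
    exact (dk2 (τ s) w (τpos s)).const_mul _
  · intro s hs
    have hs0 : 0 ≤ s := hr.trans hs.1
    have hst : s ≤ t := by linarith [hs.2]
    have bound : ∀ w ∈ Ioi (0:ℝ), Wf u κ l s w * (|ε * Real.exp (g * s) * kk (τ s) w w'| + |ε * Real.exp (g * s) * kw (τ s) w w'|)
        ≤ Real.exp (|g| * t) * (D * M) * Real.exp (-w) := by
      intro w hw
      have hw0 : 0 ≤ w := le_of_lt hw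
      have b1 := S.Wf_le κ l hs0 hst hw0
      have b2 := kk_dom (τ := τ s) (T1 := t - t') (T2 := t - r) (σ := |κ|) (w := w) (w' := w') hT0
        (by rw [τeq s hs.2]; linarith [hs.2]) (by rw [τeq s hs.2]; linarith [hs.1]) (abs_nonneg _) hw0 hw'
      have b3 : Real.exp (g * s) ≤ Real.exp (|g| * t) := by
        apply Real.exp_le_exp.mpr
        calc g * s ≤ |g| * s := by gcongr; exact le_abs_self _
          _ ≤ _ := by gcongr
      have ab : ∀ z, |ε * Real.exp (g * s) * z| = Real.exp (g * s) * |z| := fun z => by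
        rw [abs_mul, abs_mul, hε, one_mul, abs_of_pos (Real.exp_pos _)]
      rw [ab, ab]
      calc _ = Real.exp (g * s) * (Wf u κ l s w * (|kk (τ s) w w'| + |kw (τ s) w w'|)) := by ring
        _ ≤ Real.exp (|g| * t) * (D * Real.exp (|κ| * w) * (|kk (τ s) w w'| + |kw (τ s) w w'|)) := by
            have := S.Wf_nonneg κ l s w
            gcongr
        _ = Real.exp (|g| * t) * (D * (Real.exp (|κ| * w) * (|kk (τ s) w w'| + |kw (τ s) w w'|))) := by ring
        _ ≤ Real.exp (|g| * t) * (D * (M * Real.exp (-w))) := by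
            refine mul_le_mul_of_nonneg_left (mul_le_mul_of_nonneg_left (b2.trans (le_of_eq ?_)) hD0) (Real.exp_pos _).le
            rw [hM]; ring
        _ = _ := by ring
    have cc : Continuous (fun w => Wf u κ l s w * (|ε * Real.exp (g * s) * kk (τ s) w w'| + |ε * Real.exp (g * s) * kw (τ s) w w'|)) := by
      have a1 : Continuous (fun w => Wf u κ l s w) := (S.Wf_cont κ l).comp (by fun_prop : Continuous (fun x : ℝ => ((s, x) : ℝ × ℝ)))
      have a2 : Continuous (fun w => kk (τ s) w w') := ck.comp (by fun_prop : Continuous (fun x : ℝ => ((s, x) : ℝ × ℝ)))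
      have a3 : Continuous (fun w => kw (τ s) w w') := ckw.comp (by fun_prop : Continuous (fun x : ℝ => ((s, x) : ℝ × ℝ)))
      fun_prop
    have int : IntegrableOn (fun w => Wf u κ l s w * (|ε * Real.exp (g * s) * kk (τ s) w w'| + |ε * Real.exp (g * s) * kw (τ s) w w'|)) (Ioi 0) := by
      refine Integrable.mono' (integrable_exp_neg_Ioi.const_mul (Real.exp (|g| * t) * (D * M))) cc.aestronglyMeasurable ?_
      filter_upwards [ae_restrict_mem measurableSet_Ioi] with w hw
      have := S.Wf_nonneg κ l s w
      rw [Real.norm_of_nonneg (by positivity)]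
      exact bound w hw
    refine ⟨int, ?_⟩
    calc _ ≤ ∫ w in Ioi (0:ℝ), Real.exp (|g| * t) * (D * M) * Real.exp (-w) :=
          setIntegral_mono_on int (integrable_exp_neg_Ioi.const_mul _) measurableSet_Ioi bound
      _ = _ := by rw [integral_const_mul, integral_exp_neg_Ioi_zero, mul_one]
  · intro s hs
    obtain ⟨e, e0, e1, e2, e3⟩ := he s hs
    refine ⟨e, e0, fun w hw => ?_, e2, e3⟩
    refine le_trans (le_of_eq ?_) (e1 w hw)
    rw [τeq s hs.2.le]; ring

end Sol
end KPPB

namespace KPPB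

lemma pk_exp_dom {τ σ x a : ℝ} (hτ : 0 < τ) (hσ : 0 ≤ σ) :
    Real.exp (σ * |x|) * pk τ (x - a) ≤
      Real.exp (σ * |a| + σ ^ 2 * τ) / Real.sqrt (2 * Real.pi * τ) * Real.exp (-(1 / (4 * τ)) * (x - a) ^ 2) := by
  unfold pk
  rw [mul_div_assoc', div_mul_eq_mul_div, ← Real.exp_add, ← Real.exp_add]
  refine div_le_div_of_nonneg_right (Real.exp_le_exp.mpr ?_) (Real.sqrt_nonneg _)
  have h1 : |x| ≤ |a| + |x - a| := by
    have := abs_add_le a (x - a)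
    simpa using this
  have h2 : σ * |x - a| ≤ (x - a) ^ 2 / (4 * τ) + σ ^ 2 * τ := by
    have : 0 ≤ (|x - a| - 2 * τ * σ) ^ 2 / (4 * τ) := by positivity
    rw [show (|x - a| - 2 * τ * σ) ^ 2 / (4 * τ) = |x - a| ^ 2 / (4 * τ) - σ * |x - a| + σ ^ 2 * τ by field_simp; ring, sq_abs] at this
    linarith
  have h3 : σ * |x| ≤ σ * (|a| + |x - a|) := by gcongr
  have h4 : -(x - a) ^ 2 / (2 * τ) = -(2 * ((x - a) ^ 2 / (4 * τ))) := by field_simp; ring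
  have h5 : -(1 / (4 * τ)) * (x - a) ^ 2 = - ((x - a) ^ 2 / (4 * τ)) := by ring
  rw [h4, h5]
  linarith

lemma pk_exp_integrable {τ σ a : ℝ} (hτ : 0 < τ) (hσ : 0 ≤ σ) :
    Integrable (fun x => Real.exp (σ * |x|) * pk τ (x - a)) := by
  have h1 : Integrable (fun x : ℝ => Real.exp (-(1 / (4 * τ)) * (x - a) ^ 2)) :=
    (integrable_exp_neg_mul_sq (b := 1 / (4 * τ)) (by positivity)).comp_sub_right a
  refine Integrable.mono' (h1.const_mul (Real.exp (σ * |a| + σ ^ 2 * τ) / Real.sqrt (2 * Real.pi * τ))) ?_ ?_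
  · have := pk_cont (X := ℝ) (a := fun _ => τ) (b := fun x => x - a) (by fun_prop) (by fun_prop) (fun _ => hτ)
    exact (Continuous.mul (by fun_prop) this).aestronglyMeasurable
  · refine Eventually.of_forall fun x => ?_
    have := pk_nonneg τ (x - a)
    rw [Real.norm_of_nonneg (by positivity)]
    exact pk_exp_dom hτ hσ

lemma pk_integrable {τ a : ℝ} (hτ : 0 < τ) : Integrable (fun x => pk τ (x - a)) := by
  have := pk_exp_integrable (τ := τ) (a := a) hτ (le_refl 0)
  simpa using this

lemma pk_integral {τ : ℝ} (hτ : 0 < τ) (a : ℝ) : ∫ x, pk τ (x - a) = 1 := by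
  rw [integral_sub_right_eq_self (fun x => pk τ x) a]
  unfold pk
  rw [integral_div]
  have : (fun x : ℝ => Real.exp (-x ^ 2 / (2 * τ))) = fun x => Real.exp (-(1 / (2 * τ)) * x ^ 2) := by
    ext x; congr 1; ring
  rw [this, integral_gaussian]
  have : Real.pi / (1 / (2 * τ)) = 2 * Real.pi * τ := by field_simp
  rw [this]
  have := Real.pi_pos
  exact div_self (by positivity)

lemma pk_scale {τ ξ : ℝ} (hτ : 0 < τ) : Real.sqrt τ * pk τ (Real.sqrt τ * ξ) = pk 1 ξ := by
  unfold pk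
  have := Real.pi_pos
  have h1 : Real.sqrt (2 * Real.pi * τ) = Real.sqrt (2 * Real.pi * 1) * Real.sqrt τ := by
    rw [← Real.sqrt_mul (by positivity), mul_one]
  have h2 : 0 < Real.sqrt τ := Real.sqrt_pos.mpr hτ
  have h3 : Real.sqrt τ ^ 2 = τ := Real.sq_sqrt hτ.le
  rw [h1, mul_pow, h3]
  have h4 : -(τ * ξ ^ 2) / (2 * τ) = -ξ ^ 2 / (2 * 1) := by field_simp
  rw [h4]
  field_simp

/-- approximation of identity -/
theorem pk_approx {f : ℝ → ℝ → ℝ} (hf : Continuous (fun p : ℝ × ℝ => f p.1 p.2)) {t D σ a : ℝ} (ht : 0 < t)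
    (hσ : 0 ≤ σ) (hD : 0 ≤ D) (hb : ∀ s, 0 ≤ s → s ≤ t → ∀ w, 0 < w → |f s w| ≤ D * Real.exp (σ * w))
    (ha : a ≠ 0) :
    Tendsto (fun s => ∫ w in Ioi (0:ℝ), f s w * pk (t - s) (w - a)) (𝓝[<] t) (𝓝 (if 0 < a then f t a else 0)) := by
  have key : ∀ s, s < t → ∫ w in Ioi (0:ℝ), f s w * pk (t - s) (w - a) =
      ∫ ξ, (if 0 < a + Real.sqrt (t - s) * ξ then f s (a + Real.sqrt (t - s) * ξ) else 0) * pk 1 ξ := by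
    intro s hs
    have hτ : 0 < t - s := by linarith
    have hsq : 0 < Real.sqrt (t - s) := Real.sqrt_pos.mpr hτ
    rw [← integral_indicator measurableSet_Ioi]
    rw [← integral_add_left_eq_self _ a]
    have := Measure.integral_comp_mul_left (fun x => indicator (Ioi 0) (fun w => f s w * pk (t - s) (w - a)) (a + x)) (Real.sqrt (t - s))
    rw [abs_of_pos (by positivity), smul_eq_mul] at this
    have h2 : ∫ x, indicator (Ioi 0) (fun w => f s w * pk (t - s) (w - a)) (a + x) =
        Real.sqrt (t - s) * ∫ x, indicator (Ioi 0) (fun w => f s w * pk (t - s) (w - a)) (a + Real.sqrt (t - s) * x) := by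
      rw [this]; field_simp
    rw [h2, ← integral_const_mul]
    congr 1
    ext ξ
    simp only [indicator, mem_Ioi, add_sub_cancel_left]
    split_ifs
    · rw [← pk_scale (ξ := ξ) hτ]; ring
    · simp
  have e1 : (fun s => ∫ w in Ioi (0:ℝ), f s w * pk (t - s) (w - a)) =ᶠ[𝓝[<] t] fun s =>
      ∫ ξ, (if 0 < a + Real.sqrt (t - s) * ξ then f s (a + Real.sqrt (t - s) * ξ) else 0) * pk 1 ξ := by
    filter_upwards [self_mem_nhdsWithin] with s hs
    exact key s hs
  refine Tendsto.congr' e1.symm ?_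
  have e2 : (if 0 < a then f t a else 0) = ∫ ξ, (if 0 < a then f t a else 0) * pk 1 ξ := by
    rw [integral_const_mul]
    have := pk_integral one_pos 0
    simp only [sub_zero] at this
    rw [this, mul_one]
  rw [e2]
  refine tendsto_integral_filter_of_dominated_convergence
    (fun ξ => D * Real.exp (σ * |a|) * (Real.exp (σ * Real.sqrt t * |ξ|) * pk 1 (ξ - 0))) ?_ ?_ ?_ ?_
  · filter_upwards [self_mem_nhdsWithin] with s hs
    refine AEStronglyMeasurable.mul ?_ ?_
    · have c : Continuous (fun ξ => f s (a + Real.sqrt (t - s) * ξ)) := hf.comp (by fun_prop : Continuous (fun ξ : ℝ => ((s, a + Real.sqrt (t - s) * ξ) : ℝ × ℝ)))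
      exact (Measurable.ite (measurableSet_lt measurable_const (by fun_prop)) c.measurable measurable_const).aestronglyMeasurable
    · exact (pk_cont (a := fun _ => (1:ℝ)) (b := fun x => x) (by fun_prop) (by fun_prop) (fun _ => one_pos)).aestronglyMeasurable
  · filter_upwards [self_mem_nhdsWithin, mem_nhdsWithin_of_mem_nhds (lt_mem_nhds ht)] with s hs hs0
    have hs : s < t := hs
    have hs0 : 0 < s := hs0
    refine Eventually.of_forall fun ξ => ?_
    have p0 := pk_nonneg 1 ξ
    rw [norm_mul, Real.norm_of_nonneg p0, sub_zero, ← mul_assoc]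
    refine mul_le_mul_of_nonneg_right ?_ p0
    split_ifs with h
    · refine (hb s hs0.le hs.le _ h).trans ?_
      rw [mul_assoc, ← Real.exp_add]
      refine mul_le_mul_of_nonneg_left (Real.exp_le_exp.mpr ?_) hD
      have h1 : Real.sqrt (t - s) ≤ Real.sqrt t := Real.sqrt_le_sqrt (by linarith)
      have h2 : Real.sqrt (t - s) * ξ ≤ Real.sqrt t * |ξ| := by
        calc _ ≤ Real.sqrt (t - s) * |ξ| := by gcongr; exact le_abs_self _
          _ ≤ _ := by gcongr
      have h3 := le_abs_self a
      calc _ ≤ σ * (|a| + Real.sqrt t * |ξ|) := by gcongr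
        _ = _ := by ring
    · rw [norm_zero]; positivity
  · exact (pk_exp_integrable one_pos (by positivity)).const_mul _
  · refine Eventually.of_forall fun ξ => Tendsto.mul_const _ ?_
    have c1 : Tendsto (fun s => a + Real.sqrt (t - s) * ξ) (𝓝[<] t) (𝓝 a) := by
      have : Continuous (fun s => a + Real.sqrt (t - s) * ξ) := by fun_prop
      have := (this.tendsto t).mono_left (nhdsWithin_le_nhds (s := Iio t))
      simpa using this
    have c2 : Tendsto (fun s => s) (𝓝[<] t) (𝓝 t) := tendsto_nhdsWithin_of_tendsto_nhds tendsto_id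
    rcases lt_or_gt_of_ne ha with h | h
    · rw [if_neg (by linarith)]
      refine Tendsto.congr' ?_ tendsto_const_nhds
      filter_upwards [c1.eventually (gt_mem_nhds h)] with s hs
      rw [if_neg (by linarith)]
    · rw [if_pos h]
      have c3 : Tendsto (fun s => f s (a + Real.sqrt (t - s) * ξ)) (𝓝[<] t) (𝓝 (f t a)) :=
        (hf.tendsto (t, a)).comp (c2.prodMk_nhds c1)
      refine Tendsto.congr' ?_ c3
      filter_upwards [c1.eventually (lt_mem_nhds h)] with s hs
      rw [if_pos hs]

namespace Sol
variable {u : ℝ → ℝ → ℝ} {q : ℝ → ℝ} {K Cq : ℝ}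

lemma Wf_pk_integrable (S : Sol u q K Cq) (κ l : ℝ) {s τ a : ℝ} (hs : 0 ≤ s) (hτ : 0 < τ) :
    IntegrableOn (fun w => Wf u κ l s w * pk τ (w - a)) (Ioi 0) := by
  have hK := S.K1
  refine Integrable.mono' ((pk_exp_integrable (a := a) hτ (abs_nonneg κ)).const_mul (K * Real.exp (|κ ^ 2 / 2 - 1| * s))).integrableOn ?_ ?_
  · have c1 : Continuous (fun w => Wf u κ l s w) := (S.Wf_cont κ l).comp (by fun_prop : Continuous (fun x : ℝ => ((s, x) : ℝ × ℝ)))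
    have c2 := pk_cont (X := ℝ) (a := fun _ => τ) (b := fun x => x - a) (by fun_prop) (by fun_prop) (fun _ => hτ)
    exact (c1.mul c2).aestronglyMeasurable
  · filter_upwards [ae_restrict_mem measurableSet_Ioi] with w hw
    have hw : 0 < w := hw
    have p0 := pk_nonneg τ (w - a)
    have w0 := S.Wf_nonneg κ l s w
    rw [Real.norm_of_nonneg (by positivity), ← mul_assoc]
    refine mul_le_mul_of_nonneg_right ?_ p0
    rw [abs_of_pos hw]
    exact S.Wf_le κ l hs le_rfl hw.le

lemma Wf_kk_integrable (S : Sol u q K Cq) (κ l : ℝ) {s τ w' : ℝ} (hs : 0 ≤ s) (hτ : 0 < τ) :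
    IntegrableOn (fun w => Wf u κ l s w * kk τ w w') (Ioi 0) := by
  have h := (S.Wf_pk_integrable κ l (a := w') hs hτ).sub (S.Wf_pk_integrable κ l (a := -w') hs hτ)
  refine h.congr (Eventually.of_forall fun w => ?_)
  simp only [Pi.sub_apply, kk, sub_neg_eq_add]; ring

lemma kk_limit (S : Sol u q K Cq) (κ l : ℝ) {t w' : ℝ} (ht : 0 < t) (hw' : 0 < w') :
    Tendsto (fun s => ∫ w in Ioi (0:ℝ), Wf u κ l s w * kk (t - s) w w') (𝓝[<] t) (𝓝 (Wf u κ l t w')) := by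
  have hK := S.K1
  have hb : ∀ s, 0 ≤ s → s ≤ t → ∀ w, 0 < w → |Wf u κ l s w| ≤ (K * Real.exp (|κ ^ 2 / 2 - 1| * t)) * Real.exp (|κ| * w) := by
    intro s hs hst w hw
    rw [abs_of_nonneg (S.Wf_nonneg κ l s w)]
    exact S.Wf_le κ l hs hst hw.le
  have h1 := pk_approx (a := w') (S.Wf_cont κ l) ht (abs_nonneg κ) (by positivity) hb hw'.ne'
  have h2 := pk_approx (a := -w') (S.Wf_cont κ l) ht (abs_nonneg κ) (by positivity) hb (by linarith)
  rw [if_pos hw'] at h1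
  rw [if_neg (by linarith)] at h2
  have h3 := h1.sub h2
  rw [sub_zero] at h3
  refine Tendsto.congr' ?_ h3
  filter_upwards [self_mem_nhdsWithin, mem_nhdsWithin_of_mem_nhds (lt_mem_nhds ht)] with s hs hs0
  have hs : s < t := hs
  have hs0 : 0 < s := hs0
  rw [← integral_sub (S.Wf_pk_integrable κ l hs0.le (by linarith)) (S.Wf_pk_integrable κ l hs0.le (by linarith))]
  congr 1; ext w
  simp only [kk, sub_neg_eq_add]; ring

/-- the boundary flux -/
noncomputable def flux (u : ℝ → ℝ → ℝ) (κ l t w' s : ℝ) : ℝ := Wf u κ l s 0 * (w' / (t - s) * pk (t - s) w')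

theorem kernel_upper' (S : Sol u q K Cq) {r t t' l κ w' B : ℝ} (hr : 0 ≤ r) (hrt : r ≤ t') (htt : t' < t) (hw' : 0 < w')
    (hB : ∫ s in r..t', flux u κ l t w' s ≤ B) :
    ∫ w in Ioi (0:ℝ), Wf u κ l t' w * kk (t - t') w w' ≤ (∫ w in Ioi (0:ℝ), Wf u κ l r w * kk (t - r) w w') + B := by
  have h := S.kernel_green (r := r) (t := t) (t' := t') (l := l) (κ := κ) (w' := w') (g := 0) (ε := 1) (b := fun _ => 0)
    hr hrt htt hw'.le (by norm_num) (by simp) (fun s hs => ⟨fun _ => 0, fun _ _ => le_rfl, fun w hw => ?_, by simp, by simp⟩)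
  · simp only [zero_mul, Real.exp_zero, one_mul, add_zero] at h
    unfold flux at hB
    linarith
  · have h1 := S.Sf_nonneg κ l s w
    have h2 := kk_nonneg (τ := t - s) (w := w) (w' := w') (by linarith [hs.2]) hw.le hw'.le
    simp only [zero_mul, Real.exp_zero, one_mul, zero_sub, neg_mul]
    have := mul_nonneg h1 h2
    linarith

theorem kernel_upper (S : Sol u q K Cq) {r t l κ w' B : ℝ} (hr : 0 ≤ r) (hrt : r < t) (hw' : 0 < w')
    (hB : ∀ t', r < t' → t' < t → ∫ s in r..t', flux u κ l t w' s ≤ B) :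
    Wf u κ l t w' ≤ (∫ w in Ioi (0:ℝ), Wf u κ l r w * kk (t - r) w w') + B := by
  refine le_of_tendsto (S.kk_limit κ l (by linarith) hw') ?_
  filter_upwards [self_mem_nhdsWithin, mem_nhdsWithin_of_mem_nhds (lt_mem_nhds hrt)] with s hs hs0
  exact S.kernel_upper' hr (le_of_lt hs0) hs hw' (hB s hs0 hs)

theorem kernel_lower (S : Sol u q K Cq) {r t l κ w' g B : ℝ} (hr : 0 ≤ r) (hrt : r < t) (hw' : 0 < w') {b : ℝ → ℝ}
    (hb : ∀ t', r < t' → t' < t → IntervalIntegrable b volume r t')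
    (hB : ∀ t', r < t' → t' < t → ∫ s in r..t', b s ≤ B)
    (he : ∀ s ∈ Ioo r t, ∃ e : ℝ → ℝ, (∀ w, 0 < w → 0 ≤ e w) ∧
      (∀ w, 0 < w → (Real.exp (g * s) * ((Sf u q κ l s w - g * Wf u κ l s w) * kk (t - s) w w')) ≤ e w) ∧
      IntegrableOn e (Ioi 0) ∧ ∫ w in Ioi (0:ℝ), e w ≤ b s) :
    Real.exp (g * r) * (∫ w in Ioi (0:ℝ), Wf u κ l r w * kk (t - r) w w') - B ≤ Real.exp (g * t) * Wf u κ l t w' := by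
  have lim := (((by fun_prop : Continuous (fun s : ℝ => Real.exp (g * s))).tendsto t).mono_left (nhdsWithin_le_nhds (s := Iio t))).mul (S.kk_limit κ l (by linarith : 0 < t) hw')
  refine ge_of_tendsto lim ?_
  filter_upwards [self_mem_nhdsWithin, mem_nhdsWithin_of_mem_nhds (lt_mem_nhds hrt)] with t' hs hs0
  have hs : t' < t := hs
  have hs0 : r < t' := hs0
  have h := S.kernel_green (r := r) (t := t) (t' := t') (l := l) (κ := κ) (w' := w') (g := g) (ε := -1) (b := b)
    hr hs0.le hs hw'.le (by norm_num) (hb t' hs0 hs) (fun s hss => ?_)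
  · have h2 : ∫ s in r..t', (-1 * (Real.exp (g * s) * (Wf u κ l s 0 * (w' / (t - s) * pk (t - s) w'))) + b s) ≤ ∫ s in r..t', b s := by
      refine intervalIntegral.integral_mono_on hs0.le ?_ (hb t' hs0 hs) fun s hss => ?_
      · refine IntervalIntegrable.add ?_ (hb t' hs0 hs)
        apply ContinuousOn.intervalIntegrable
        rw [uIcc_of_le hs0.le]
        have c1 : Continuous (fun s => Wf u κ l s 0) := (S.Wf_cont κ l).comp (by fun_prop : Continuous (fun x : ℝ => ((x, 0) : ℝ × ℝ)))
        have c2 : ContinuousOn (fun s => w' / (t - s) * pk (t - s) w') (Icc r t') := by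
          unfold pk
          have hp := Real.pi_pos
          have n1 : ∀ s ∈ Icc r t', 0 < t - s := fun s hs' => by linarith [hs'.2]
          refine ContinuousOn.mul (ContinuousOn.div (by fun_prop) (by fun_prop) (fun s h => (n1 s h).ne')) (ContinuousOn.div ?_ (by fun_prop) ?_)
          · exact Real.continuous_exp.comp_continuousOn (ContinuousOn.div (by fun_prop) (by fun_prop) (fun s h => by have := n1 s h; positivity))
          · intro s h
            have := n1 s h
            positivity
        exact continuousOn_const.mul ((by fun_prop : ContinuousOn (fun s => Real.exp (g * s)) (Icc r t')).mul (c1.continuousOn.mul c2))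
      · have a1 := S.Wf_nonneg κ l s 0
        have a2 := pk_nonneg (t - s) w'
        have a3 : 0 < t - s := by linarith [hss.2]
        have : 0 ≤ Real.exp (g * s) * (Wf u κ l s 0 * (w' / (t - s) * pk (t - s) w')) := by positivity
        linarith
    have h3 := hB t' hs0 hs
    linarith
  · obtain ⟨e, e0, e1, e2, e3⟩ := he s ⟨hss.1, hss.2.trans hs⟩
    refine ⟨e, e0, fun w hw => ?_, e2, e3⟩
    refine le_trans (le_of_eq ?_) (e1 w hw)
    ring

end Sol
end KPPB

namespace KPPB

lemma two_le_sqrt_two_pi : 2 ≤ Real.sqrt (2 * Real.pi) := by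
  have : Real.sqrt 4 ≤ Real.sqrt (2 * Real.pi) := Real.sqrt_le_sqrt (by linarith [Real.pi_gt_three])
  rwa [show (4:ℝ) = 2 ^ 2 by norm_num, Real.sqrt_sq (by norm_num)] at this

lemma rpow_neg_half {τ : ℝ} (hτ : 0 < τ) : τ ^ (-(1/2) : ℝ) = (Real.sqrt τ)⁻¹ := by
  rw [Real.rpow_neg hτ.le, Real.sqrt_eq_rpow]

lemma rpow_neg_three_half {τ : ℝ} (hτ : 0 < τ) : τ ^ (-(3/2) : ℝ) = (Real.sqrt τ)⁻¹ / τ := by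
  rw [← rpow_neg_half hτ, show (-(3/2) : ℝ) = -(1/2) - 1 by norm_num, Real.rpow_sub hτ, Real.rpow_one]

lemma pk_eq {τ x : ℝ} (hτ : 0 < τ) : pk τ x = (Real.sqrt (2 * Real.pi))⁻¹ * τ ^ (-(1/2) : ℝ) * Real.exp (-(x ^ 2 / (2 * τ))) := by
  unfold pk
  have := Real.pi_pos
  rw [rpow_neg_half hτ, Real.sqrt_mul (by positivity)]
  rw [neg_div]
  have h2 : 0 < Real.sqrt τ := Real.sqrt_pos.mpr hτ
  have h3 : 0 < Real.sqrt (2 * Real.pi) := by positivity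
  field_simp

lemma inv_sqrt_le : (Real.sqrt (2 * Real.pi))⁻¹ ≤ 1 / 2 := by
  have := two_le_sqrt_two_pi
  rw [inv_le_comm₀ (by linarith) (by norm_num)]
  linarith

lemma pk_le_half {τ : ℝ} (hτ : 0 < τ) (x : ℝ) : pk τ x ≤ 1 / 2 * τ ^ (-(1/2) : ℝ) := by
  rw [pk_eq hτ]
  have h1 : Real.exp (-(x ^ 2 / (2 * τ))) ≤ 1 := by
    rw [Real.exp_le_one_iff]; have : 0 ≤ x ^ 2 / (2 * τ) := by positivity
    linarith
  have h2 := inv_sqrt_le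
  have h3 : 0 ≤ τ ^ (-(1/2) : ℝ) := by positivity
  calc _ ≤ (1 / 2) * τ ^ (-(1/2) : ℝ) * 1 := by gcongr
    _ = _ := by ring

/-- factorised form of the Dirichlet kernel -/
lemma kk_eq {τ w w' : ℝ} (hτ : 0 < τ) : kk τ w w' = pk τ (w - w') * (1 - Real.exp (-(2 * w * w' / τ))) := by
  unfold kk
  have : pk τ (w + w') = pk τ (w - w') * Real.exp (-(2 * w * w' / τ)) := by
    rw [pk_eq hτ, pk_eq hτ, mul_assoc _ (Real.exp _), ← Real.exp_add]
    congr 2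
    field_simp; ring
  rw [this]; ring

lemma kk_le_pk {τ w w' : ℝ} (_ : 0 < τ) : kk τ w w' ≤ pk τ (w - w') := by
  unfold kk; linarith [pk_nonneg τ (w + w')]

lemma kk_le_lin {τ w w' : ℝ} (hτ : 0 < τ) (hw : 0 ≤ w) (hw' : 0 ≤ w') :
    kk τ w w' ≤ w * w' * τ ^ (-(3/2) : ℝ) := by
  rw [kk_eq hτ]
  have h1 : 1 - Real.exp (-(2 * w * w' / τ)) ≤ 2 * w * w' / τ := by
    have := Real.add_one_le_exp (-(2 * w * w' / τ)); linarith
  have h2 := pk_le_half hτ (w - w')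
  have h3 := pk_nonneg τ (w - w')
  have h4 : 0 ≤ 2 * w * w' / τ := by positivity
  have h5 : 0 ≤ τ ^ (-(1/2) : ℝ) := by positivity
  calc _ ≤ pk τ (w - w') * (2 * w * w' / τ) := by gcongr
    _ ≤ (1 / 2 * τ ^ (-(1/2) : ℝ)) * (2 * w * w' / τ) := by gcongr
    _ = _ := by
      rw [rpow_neg_three_half hτ, rpow_neg_half hτ]; field_simp

/-- `τ^{-3/2} e^{-A/τ} ≤ 2 (τ+A)^{-3/2}` -/
lemma rpow_exp_le {τ A : ℝ} (hτ : 0 < τ) (hA : 0 ≤ A) :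
    τ ^ (-(3/2) : ℝ) * Real.exp (-(A / τ)) ≤ 2 * (τ + A) ^ (-(3/2) : ℝ) := by
  set y := A / τ with hy
  have hy0 : 0 ≤ y := by positivity
  have h1 : τ + A = τ * (1 + y) := by rw [hy]; field_simp
  rw [h1, Real.mul_rpow hτ.le (by positivity)]
  have h2 : (1 + y) ^ (3/2 : ℝ) ≤ 2 * Real.exp y := by
    have a1 : (1 + y) ^ (3/2 : ℝ) ≤ (1 + y) ^ (2 : ℝ) := Real.rpow_le_rpow_of_exponent_le (by linarith) (by norm_num)
    have a2 := Real.quadratic_le_exp_of_nonneg hy0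
    rw [Real.rpow_two] at a1
    nlinarith
  have h3 : 0 < (1 + y) ^ (3/2 : ℝ) := by positivity
  rw [Real.rpow_neg (by positivity : 0 ≤ 1 + y), Real.exp_neg]
  have h4 : (Real.exp y)⁻¹ ≤ 2 * ((1 + y) ^ (3/2 : ℝ))⁻¹ := by
    rw [inv_le_iff_one_le_mul₀ (Real.exp_pos _), mul_comm, ← mul_assoc, ← div_eq_mul_inv, le_div_iff₀ h3]
    linarith
  have h5 : 0 ≤ τ ^ (-(3/2) : ℝ) := by positivity
  calc _ ≤ τ ^ (-(3/2) : ℝ) * (2 * ((1 + y) ^ (3/2 : ℝ))⁻¹) := by gcongr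
    _ = _ := by ring

lemma flux_kernel_le {τ x : ℝ} (hτ : 0 < τ) (hx : 0 ≤ x) :
    x / τ * pk τ x ≤ x * (τ + x ^ 2 / 2) ^ (-(3/2) : ℝ) := by
  rw [pk_eq hτ]
  have h1 := rpow_exp_le (A := x ^ 2 / 2) hτ (by positivity)
  rw [show x ^ 2 / 2 / τ = x ^ 2 / (2 * τ) by field_simp] at h1
  have h2 := inv_sqrt_le
  have h3 : 0 ≤ τ ^ (-(3/2) : ℝ) := by positivity
  calc _ = x * ((Real.sqrt (2 * Real.pi))⁻¹ * (τ ^ (-(3/2) : ℝ) * Real.exp (-(x ^ 2 / (2 * τ))))) := by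
        rw [rpow_neg_three_half hτ, rpow_neg_half hτ]; field_simp
    _ ≤ x * (1 / 2 * (2 * (τ + x ^ 2 / 2) ^ (-(3/2) : ℝ))) := by gcongr
    _ = _ := by ring

lemma int_shift_cont {r t' t A p : ℝ} (_ : r ≤ t') (htt : t' ≤ t) (hA : 0 < A) :
    ContinuousOn (fun s => (t - s + A) ^ p) (Icc r t') := by
  refine ContinuousOn.rpow_const (by fun_prop) fun s hs => Or.inl ?_
  have := hs.2
  have : 0 < t - s + A := by linarith
  exact this.ne'

lemma int_shift_le {r t' t A p : ℝ} (hrt : r ≤ t') (htt : t' ≤ t) (hA : 0 < A) (hp : 0 < p) :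
    ∫ s in r..t', (t - s + A) ^ (-(1 + p)) ≤ A ^ (-p) / p := by
  have h1 : ∀ s, (t - s + A) ^ (-(1 + p)) = (fun x => x ^ (-(1 + p))) (t + A - s) := fun s => by
    simp only; congr 1; ring
  simp_rw [h1]
  rw [intervalIntegral.integral_comp_sub_left (fun x => x ^ (-(1 + p))) (t + A)]
  rw [integral_rpow (Or.inr ⟨by linarith, ?_⟩)]
  · have e : -(1 + p) + 1 = -p := by ring
    rw [e, div_neg, ← neg_div]
    have a1 : 0 ≤ (t + A - r) ^ (-p) := Real.rpow_nonneg (by linarith) _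
    have a2 : (t + A - t') ^ (-p) ≤ A ^ (-p) := Real.rpow_le_rpow_of_nonpos hA (by linarith) (by linarith)
    refine div_le_div_of_nonneg_right ?_ hp.le
    linarith
  · rw [uIcc_of_le (by linarith)]
    intro h
    have := h.1
    linarith

lemma int_pow_le {r t' p : ℝ} (hr : 0 < r) (hrt : r ≤ t') (hp : 0 < p) :
    ∫ s in r..t', s ^ (-(1 + p)) ≤ r ^ (-p) / p := by
  rw [integral_rpow (Or.inr ⟨by linarith, ?_⟩)]
  · have e : -(1 + p) + 1 = -p := by ring
    rw [e, div_neg, ← neg_div]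
    have a1 : 0 ≤ t' ^ (-p) := Real.rpow_nonneg (by linarith) _
    refine div_le_div_of_nonneg_right ?_ hp.le
    linarith
  · rw [uIcc_of_le (by linarith)]
    intro h
    have := h.1
    linarith

lemma sqrt2_sq : Real.sqrt 2 ^ 2 = 2 := Real.sq_sqrt (by norm_num)
lemma sqrt2_pos : 0 < Real.sqrt 2 := by positivity

/-- The normalised solution in the frame moving at speed `√2`. -/
noncomputable def Vf (u : ℝ → ℝ → ℝ) (s z : ℝ) : ℝ := Real.exp (Real.sqrt 2 * z) * u s (Real.sqrt 2 * s + z)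

lemma Wf_eq_Vf (u : ℝ → ℝ → ℝ) (l s w : ℝ) : Wf u (Real.sqrt 2) l s w = Real.exp (-(Real.sqrt 2 * l)) * Vf u s (l + w) := by
  unfold Wf Vf
  rw [← mul_assoc, ← Real.exp_add, sqrt2_sq]
  congr 2
  · ring
  · ring

lemma Wf_zero_eq_Vf (u : ℝ → ℝ → ℝ) (s w : ℝ) : Wf u (Real.sqrt 2) 0 s w = Vf u s w := by
  rw [Wf_eq_Vf]; simp

namespace Sol
variable {u : ℝ → ℝ → ℝ} {q : ℝ → ℝ} {K Cq : ℝ}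

lemma Vf_nonneg (S : Sol u q K Cq) (s z : ℝ) : 0 ≤ Vf u s z := mul_nonneg (Real.exp_pos _).le (S.nonneg _ _)

lemma Vf_le (S : Sol u q K Cq) (s z : ℝ) : Vf u s z ≤ K * Real.exp (Real.sqrt 2 * z) := by
  unfold Vf
  rw [mul_comm]
  exact mul_le_mul_of_nonneg_right (S.le _ _) (Real.exp_pos _).le

lemma Vf_cont (S : Sol u q K Cq) : Continuous (fun p : ℝ × ℝ => Vf u p.1 p.2) := by
  unfold Vf
  exact Continuous.mul (by fun_prop) (S.cont.comp (by fun_prop : Continuous (fun p : ℝ × ℝ => ((p.1, Real.sqrt 2 * p.1 + p.2) : ℝ × ℝ))))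

lemma Vf_cont' (S : Sol u q K Cq) (s : ℝ) : Continuous (Vf u s) :=
  S.Vf_cont.comp (by fun_prop : Continuous (fun x : ℝ => ((s, x) : ℝ × ℝ)))

lemma flux_contOn (S : Sol u q K Cq) {κ l t w' r t' : ℝ} (htt : t' < t) : ContinuousOn (flux u κ l t w') (Icc r t') := by
  have c1 : Continuous (fun s => Wf u κ l s 0) := (S.Wf_cont κ l).comp (by fun_prop : Continuous (fun x : ℝ => ((x, 0) : ℝ × ℝ)))
  have c2 : ContinuousOn (fun s => w' / (t - s) * pk (t - s) w') (Icc r t') := by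
    unfold pk
    have hp := Real.pi_pos
    have n1 : ∀ s ∈ Icc r t', 0 < t - s := fun s hs' => by linarith [hs'.2]
    refine ContinuousOn.mul (ContinuousOn.div (by fun_prop) (by fun_prop) (fun s h => (n1 s h).ne')) (ContinuousOn.div ?_ (by fun_prop) ?_)
    · exact Real.continuous_exp.comp_continuousOn (ContinuousOn.div (by fun_prop) (by fun_prop) (fun s h => by have := n1 s h; positivity))
    · intro s h
      have := n1 s h
      positivity
  exact c1.continuousOn.mul c2

lemma flux_int_le (S : Sol u q K Cq) {κ l t w' r t' : ℝ} (hrt : r ≤ t') (htt : t' < t) {b : ℝ → ℝ}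
    (hb : ContinuousOn b (Icc r t')) (h : ∀ s ∈ Icc r t', flux u κ l t w' s ≤ b s) :
    ∫ s in r..t', flux u κ l t w' s ≤ ∫ s in r..t', b s := by
  refine intervalIntegral.integral_mono_on hrt ?_ ?_ h
  · exact (S.flux_contOn htt).intervalIntegrable_of_Icc hrt
  · exact hb.intervalIntegrable_of_Icc hrt

lemma flux_const (S : Sol u q K Cq) {κ l t w' r t' Q : ℝ} (hrt : r ≤ t') (htt : t' < t) (hw' : 0 < w')
    (h : ∀ s ∈ Icc r t', Wf u κ l s 0 ≤ Q) (hQ : 0 ≤ Q) :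
    ∫ s in r..t', flux u κ l t w' s ≤ 3 * Q := by
  have hA : 0 < w' ^ 2 / 2 := by positivity
  have h1 := int_shift_le (p := 1/2) hrt htt.le hA (by norm_num)
  have e1 : (-(1 + 1 / 2) : ℝ) = -(3/2) := by norm_num
  rw [e1] at h1
  have e2 : (w' ^ 2 / 2) ^ (-(1/2) : ℝ) / (1 / 2) ≤ 3 / w' := by
    rw [rpow_neg_half hA, Real.sqrt_div (by positivity), Real.sqrt_sq hw'.le]
    have : Real.sqrt 2 ≤ 3/2 := by
      rw [Real.sqrt_le_left (by norm_num)]; norm_num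
    rw [inv_div, div_div, div_le_div_iff₀ (by positivity) hw']
    nlinarith
  refine (S.flux_int_le hrt htt (b := fun s => Q * (w' * (t - s + w' ^ 2 / 2) ^ (-(3/2) : ℝ))) ?_ ?_).trans ?_
  · exact continuousOn_const.mul (continuousOn_const.mul (int_shift_cont hrt htt.le hA))
  · intro s hs
    have hτ : 0 < t - s := by linarith [hs.2]
    have := flux_kernel_le hτ hw'.le
    unfold flux
    have p0 := pk_nonneg (t - s) w'
    have := h s hs
    gcongr
  · rw [intervalIntegral.integral_const_mul, intervalIntegral.integral_const_mul]
    calc _ ≤ Q * (w' * (3 / w')) := by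
          gcongr
          exact h1.trans e2
      _ = _ := by field_simp

theorem Vf_conv (S : Sol u q K Cq) (h0 : Integrable (Vf u 0)) {t : ℝ} (ht : 0 < t) (z : ℝ) :
    Vf u t z ≤ ∫ y, Vf u 0 y * pk t (y - z) := by
  have hK := S.K1
  have cpk : Continuous (fun y => pk t (y - z)) :=
    pk_cont (X := ℝ) (a := fun _ => t) (b := fun x => x - z) (by fun_prop) (by fun_prop) (fun _ => ht)
  have hI : Integrable (fun y => Vf u 0 y * pk t (y - z)) := by
    refine Integrable.mono' (h0.mul_const (1 / 2 * t ^ (-(1/2) : ℝ))) ((S.Vf_cont' 0).mul cpk).aestronglyMeasurable ?_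
    refine Eventually.of_forall fun y => ?_
    have a := S.Vf_nonneg 0 y
    have b := pk_nonneg t (y - z)
    rw [Real.norm_of_nonneg (by positivity)]
    exact mul_le_mul_of_nonneg_left (pk_le_half ht _) a
  have key : ∀ l, l < z → Vf u t z ≤ (∫ y, Vf u 0 y * pk t (y - z)) + Real.exp (Real.sqrt 2 * l) * (3 * K) := by
    intro l hl
    have h1 := S.kernel_upper (r := 0) (t := t) (l := l) (κ := Real.sqrt 2) (w' := z - l) (B := 3 * K) le_rfl ht (by linarith)
      (fun t' h1 h2 => S.flux_const h1.le h2 (by linarith) (fun s _ => by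
        unfold Wf
        rw [sqrt2_sq]
        simp only [mul_zero, add_zero, zero_add]
        norm_num
        exact S.le _ _) (by linarith))
    rw [Wf_eq_Vf, sub_zero, add_sub_cancel] at h1
    have h2 : ∫ w in Ioi (0:ℝ), Wf u (Real.sqrt 2) l 0 w * kk t w (z - l) ≤ Real.exp (-(Real.sqrt 2 * l)) * ∫ y, Vf u 0 y * pk t (y - z) := by
      rw [← integral_add_left_eq_self (μ := volume) (fun y => Vf u 0 y * pk t (y - z)) l, ← integral_const_mul]
      have hI2 : Integrable (fun w => Real.exp (-(Real.sqrt 2 * l)) * (Vf u 0 (l + w) * pk t (l + w - z))) :=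
        (hI.comp_add_left l).const_mul _
      refine (setIntegral_mono_on ?_ hI2.integrableOn measurableSet_Ioi fun w hw => ?_).trans
        (setIntegral_le_integral hI2 (Eventually.of_forall fun w => ?_))
      · exact S.Wf_kk_integrable _ _ le_rfl ht
      · rw [Wf_eq_Vf, mul_assoc]
        refine mul_le_mul_of_nonneg_left (mul_le_mul_of_nonneg_left ((kk_le_pk ht).trans (le_of_eq ?_)) (S.Vf_nonneg _ _)) (Real.exp_pos _).le
        congr 1; ring
      · have a := S.Vf_nonneg 0 (l + w)
        have b := pk_nonneg t (l + w - z)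
        simp only [Pi.zero_apply]
        positivity
    have h3 := h1.trans (add_le_add_left h2 _)
    have h4 := mul_le_mul_of_nonneg_left h3 (Real.exp_pos (Real.sqrt 2 * l)).le
    rw [mul_add, ← mul_assoc, ← mul_assoc, ← Real.exp_add, add_neg_cancel, Real.exp_zero, one_mul, one_mul] at h4
    exact h4
  have lim : Tendsto (fun l => (∫ y, Vf u 0 y * pk t (y - z)) + Real.exp (Real.sqrt 2 * l) * (3 * K)) atBot
      (𝓝 ((∫ y, Vf u 0 y * pk t (y - z)) + 0 * (3 * K))) := by
    refine tendsto_const_nhds.add (Tendsto.mul_const _ ?_)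
    exact Real.tendsto_exp_atBot.comp (tendsto_id.const_mul_atBot sqrt2_pos)
  rw [zero_mul, add_zero] at lim
  refine ge_of_tendsto lim ?_
  filter_upwards [eventually_lt_atBot z] with l hl
  exact key l hl

lemma Vf_weight (S : Sol u q K Cq) (h0 : Integrable (Vf u 0)) {t : ℝ} (ht : 0 < t) {φ Φ : ℝ → ℝ}
    (hφ : Continuous φ) (φ0 : ∀ z, 0 ≤ φ z) (hΦ : ∀ y, 0 ≤ Φ y) (hI : Integrable (fun y => Φ y * Vf u 0 y))
    (h : ∀ y, ∫⁻ z, ENNReal.ofReal (φ z * pk t (y - z)) ≤ ENNReal.ofReal (Φ y)) :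
    Integrable (fun z => φ z * Vf u t z) ∧ ∫ z, φ z * Vf u t z ≤ ∫ y, Φ y * Vf u 0 y := by
  have cpk : Continuous (fun p : ℝ × ℝ => pk t (p.2 - p.1)) :=
    pk_cont (a := fun _ => t) (b := fun p : ℝ × ℝ => p.2 - p.1) (by fun_prop) (by fun_prop) (fun _ => ht)
  have cV := S.Vf_cont' 0
  have cVt := S.Vf_cont' t
  have main : ∫⁻ z, ENNReal.ofReal (φ z * Vf u t z) ≤ ENNReal.ofReal (∫ y, Φ y * Vf u 0 y) := by
    calc ∫⁻ z, ENNReal.ofReal (φ z * Vf u t z)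
        ≤ ∫⁻ z, ∫⁻ y, ENNReal.ofReal (φ z * (Vf u 0 y * pk t (y - z))) := by
          refine lintegral_mono fun z => ?_
          have h1 := S.Vf_conv h0 ht z
          have hI : Integrable (fun y => Vf u 0 y * pk t (y - z)) := by
            refine Integrable.mono' (h0.mul_const (1 / 2 * t ^ (-(1/2) : ℝ))) (cV.mul (cpk.comp (by fun_prop : Continuous (fun y : ℝ => ((z, y) : ℝ × ℝ))))).aestronglyMeasurable ?_
            refine Eventually.of_forall fun y => ?_
            have a := S.Vf_nonneg 0 y
            have b := pk_nonneg t (y - z)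
            rw [Real.norm_of_nonneg (by positivity)]
            exact mul_le_mul_of_nonneg_left (pk_le_half ht _) a
          rw [← ofReal_integral_eq_lintegral_ofReal (hI.const_mul _) (Eventually.of_forall fun y => ?_)]
          · apply ENNReal.ofReal_le_ofReal
            rw [integral_const_mul]
            exact mul_le_mul_of_nonneg_left h1 (φ0 z)
          · have a := S.Vf_nonneg 0 y
            have b := pk_nonneg t (y - z)
            have c := φ0 z
            simp only [Pi.zero_apply]
            positivity
      _ = ∫⁻ y, ∫⁻ z, ENNReal.ofReal (φ z * (Vf u 0 y * pk t (y - z))) := by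
          refine lintegral_lintegral_swap ?_
          refine Measurable.aemeasurable ?_
          refine ENNReal.measurable_ofReal.comp (Continuous.measurable ?_)
          exact (hφ.comp continuous_fst).mul ((cV.comp continuous_snd).mul cpk)
      _ ≤ ∫⁻ y, ENNReal.ofReal (Φ y * Vf u 0 y) := by
          refine lintegral_mono fun y => ?_
          have e : ∀ z, ENNReal.ofReal (φ z * (Vf u 0 y * pk t (y - z))) = ENNReal.ofReal (Vf u 0 y) * ENNReal.ofReal (φ z * pk t (y - z)) := by
            intro z
            rw [← ENNReal.ofReal_mul (S.Vf_nonneg 0 y)]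
            congr 1; ring
          simp_rw [e]
          rw [lintegral_const_mul]
          · rw [mul_comm (Φ y), ENNReal.ofReal_mul (S.Vf_nonneg 0 y)]
            exact mul_le_mul_right (h y) _
          · refine ENNReal.measurable_ofReal.comp (Continuous.measurable ?_)
            exact hφ.mul (cpk.comp (by fun_prop : Continuous (fun z : ℝ => ((z, y) : ℝ × ℝ))))
      _ = _ := by
          rw [ofReal_integral_eq_lintegral_ofReal hI (Eventually.of_forall fun y => ?_)]
          exact mul_nonneg (hΦ y) (S.Vf_nonneg 0 y)
  have nn : ∀ z, 0 ≤ φ z * Vf u t z := fun z => mul_nonneg (φ0 z) (S.Vf_nonneg t z)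
  have int : Integrable (fun z => φ z * Vf u t z) := by
    refine ⟨(hφ.mul cVt).aestronglyMeasurable, ?_⟩
    rw [hasFiniteIntegral_iff_ofReal (Eventually.of_forall nn)]
    exact main.trans_lt ENNReal.ofReal_lt_top
  refine ⟨int, ?_⟩
  rw [← ofReal_integral_eq_lintegral_ofReal int (Eventually.of_forall nn)] at main
  rwa [ENNReal.ofReal_le_ofReal_iff] at main
  exact integral_nonneg fun y => mul_nonneg (hΦ y) (S.Vf_nonneg 0 y)

end Sol
end KPPB

namespace KPPB

/-- The logarithmic-correction constant `3/(2√2)`. -/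
noncomputable def aa : ℝ := 3 / (2 * Real.sqrt 2)

lemma aa_pos : 0 < aa := by unfold aa; positivity
lemma sqrt2_aa : Real.sqrt 2 * aa = 3 / 2 := by unfold aa; have := sqrt2_pos; field_simp
lemma one_le_sqrt2 : 1 ≤ Real.sqrt 2 := by
  rw [Real.one_le_sqrt]; norm_num
lemma sqrt2_le : Real.sqrt 2 ≤ 3 / 2 := by
  rw [Real.sqrt_le_left (by norm_num)]; norm_num
lemma aa_le : aa ≤ 2 := by
  have h := sqrt2_aa; have h1 := one_le_sqrt2; have := aa_pos; nlinarith

lemma exp_aa_log {t : ℝ} (ht : 0 < t) : Real.exp (Real.sqrt 2 * (-(aa * Real.log t))) = t ^ (-(3/2) : ℝ) := by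
  rw [Real.rpow_def_of_pos ht]
  congr 1
  have := sqrt2_aa
  linear_combination (-Real.log t) * this

lemma pk_even (t x y : ℝ) : pk t (x - y) = pk t (y - x) := by
  unfold pk; congr 3; ring

lemma abs_pk_le {t x : ℝ} (ht : 0 < t) : |x| * pk t x ≤ 2 * Real.sqrt t * pk (2 * t) x := by
  have hs : 0 < Real.sqrt t := Real.sqrt_pos.mpr ht
  have hpi := Real.pi_pos
  unfold pk
  set y := |x| / Real.sqrt t with hy
  have hy0 : 0 ≤ y := by positivity
  have hx : |x| = y * Real.sqrt t := by rw [hy]; field_simp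
  have hx2 : x ^ 2 = y ^ 2 * t := by rw [← sq_abs, hx, mul_pow, Real.sq_sqrt ht.le]
  have h1 : Real.sqrt (2 * Real.pi * (2 * t)) = Real.sqrt 2 * Real.sqrt (2 * Real.pi * t) := by
    rw [← Real.sqrt_mul (by norm_num)]; congr 1; ring
  rw [h1, hx, hx2]
  have e1 : -(y ^ 2 * t) / (2 * t) = -(y ^ 2 / 4) + -(y ^ 2 / 4) := by field_simp; ring
  have e2 : -(y ^ 2 * t) / (2 * (2 * t)) = -(y ^ 2 / 4) := by field_simp; ring
  rw [e1, e2, Real.exp_add]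
  have h2 : y * Real.exp (-(y ^ 2 / 4)) ≤ 1 := by
    rw [Real.exp_neg, ← div_eq_mul_inv, div_le_one (Real.exp_pos _)]
    have := Real.add_one_le_exp (y ^ 2 / 4)
    nlinarith [sq_nonneg (y / 2 - 1)]
  have h3 := sqrt2_le
  have h4 := sqrt2_pos
  have h5 : 0 < Real.sqrt (2 * Real.pi * t) := by positivity
  set E := Real.exp (-(y ^ 2 / 4)) with hE
  have hE0 : 0 < E := Real.exp_pos _
  calc y * Real.sqrt t * (E * E / Real.sqrt (2 * Real.pi * t)) = (y * E) * (Real.sqrt t * E / Real.sqrt (2 * Real.pi * t)) := by ring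
    _ ≤ 1 * (Real.sqrt t * E / Real.sqrt (2 * Real.pi * t)) := by gcongr
    _ ≤ (2 / Real.sqrt 2) * (Real.sqrt t * E / Real.sqrt (2 * Real.pi * t)) := by
        gcongr
        rw [le_div_iff₀ h4]; linarith
    _ = _ := by field_simp

lemma weight_pk {t : ℝ} (ht : 0 < t) (y : ℝ) : ∫⁻ z, ENNReal.ofReal ((1 + max z 0) * pk t (y - z)) ≤
    ENNReal.ofReal ((1 + 2 * Real.sqrt t) * (1 + max y 0)) := by
  have i1 : Integrable (fun z => (1 + max y 0) * pk t (z - y)) := (pk_integrable ht).const_mul _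
  have i2 : Integrable (fun z => 2 * Real.sqrt t * pk (2 * t) (z - y)) := (pk_integrable (by linarith)).const_mul _
  have m0 : 0 ≤ max y 0 := le_max_right _ _
  have s0 := Real.sqrt_nonneg t
  calc _ ≤ ∫⁻ z, ENNReal.ofReal ((1 + max y 0) * pk t (z - y) + 2 * Real.sqrt t * pk (2 * t) (z - y)) := by
        refine lintegral_mono fun z => ENNReal.ofReal_le_ofReal ?_
        rw [pk_even t y z]
        have h1 := abs_pk_le (x := z - y) ht
        have h2 : max z 0 ≤ max y 0 + |z - y| := by
          have := le_abs_self (z - y)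
          have := abs_nonneg (z - y)
          apply max_le <;> linarith [le_max_left y 0]
        have h3 := pk_nonneg t (z - y)
        nlinarith
    _ = ENNReal.ofReal (∫ z, ((1 + max y 0) * pk t (z - y) + 2 * Real.sqrt t * pk (2 * t) (z - y))) := by
        refine (ofReal_integral_eq_lintegral_ofReal (i1.add i2) (Eventually.of_forall fun z => ?_)).symm
        · have := pk_nonneg t (z - y)
          have := pk_nonneg (2 * t) (z - y)
          simp only [Pi.zero_apply, Pi.add_apply]
          positivity
    _ ≤ _ := by
        apply ENNReal.ofReal_le_ofReal
        rw [integral_add i1 i2, integral_const_mul, integral_const_mul, pk_integral ht, pk_integral (by linarith)]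
        nlinarith

/-- first moment on the right and total mass -/
noncomputable def M0 (u : ℝ → ℝ → ℝ) (s : ℝ) : ℝ := ∫ y, max y 0 * Vf u s y
noncomputable def La (u : ℝ → ℝ → ℝ) (s : ℝ) : ℝ := ∫ y, Vf u s y
noncomputable def N0 (u : ℝ → ℝ → ℝ) : ℝ := ∫ y, (1 + max y 0) * Vf u 0 y

/-- finiteness of the initial weighted mass -/
abbrev FinMom (u : ℝ → ℝ → ℝ) : Prop := Integrable (fun y => (1 + max y 0) * Vf u 0 y)

namespace Sol
variable {u : ℝ → ℝ → ℝ} {q : ℝ → ℝ} {K Cq : ℝ}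

lemma Vint0 (S : Sol u q K Cq) {s : ℝ} (H : Integrable (fun y => (1 + max y 0) * Vf u s y)) : Integrable (Vf u s) := by
  refine Integrable.mono' H (S.Vf_cont' s).aestronglyMeasurable (Eventually.of_forall fun y => ?_)
  have := S.Vf_nonneg s y
  rw [Real.norm_of_nonneg this]
  nlinarith [le_max_right y 0, mul_nonneg (le_max_right y 0) this]

lemma yVint0 (S : Sol u q K Cq) {s : ℝ} (H : Integrable (fun y => (1 + max y 0) * Vf u s y)) : Integrable (fun y => max y 0 * Vf u s y) := by
  refine (H.sub (S.Vint0 H)).congr (Eventually.of_forall fun y => ?_)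
  simp only [Pi.sub_apply]; ring


lemma N0_nonneg (S : Sol u q K Cq) : 0 ≤ N0 u := integral_nonneg fun y => by
  have := S.Vf_nonneg 0 y
  have := le_max_right y 0
  simp only [Pi.zero_apply]
  positivity

lemma mass_int (S : Sol u q K Cq) (H0 : FinMom u) {t : ℝ} (ht : 0 ≤ t) : Integrable (fun z => (1 + max z 0) * Vf u t z) ∧
    ∫ z, (1 + max z 0) * Vf u t z ≤ (1 + 2 * Real.sqrt t) * N0 u := by
  rcases ht.eq_or_lt with h | h
  · subst h
    refine ⟨H0, ?_⟩
    rw [Real.sqrt_zero]; unfold N0; simp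
  · have := S.Vf_weight (S.Vint0 H0) h (φ := fun z => 1 + max z 0) (Φ := fun y => (1 + 2 * Real.sqrt t) * (1 + max y 0))
      (by fun_prop) (fun z => by positivity) (fun z => by positivity) (by simpa only [mul_assoc] using H0.const_mul (1 + 2 * Real.sqrt t))
      (fun y => weight_pk h y)
    refine ⟨this.1, this.2.trans (le_of_eq ?_)⟩
    simp only [mul_assoc]
    rw [integral_const_mul]; rfl

lemma V_int (S : Sol u q K Cq) (H0 : FinMom u) {t : ℝ} (ht : 0 ≤ t) : Integrable (Vf u t) := S.Vint0 (S.mass_int H0 ht).1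
lemma yV_int (S : Sol u q K Cq) (H0 : FinMom u) {t : ℝ} (ht : 0 ≤ t) : Integrable (fun y => max y 0 * Vf u t y) := S.yVint0 (S.mass_int H0 ht).1

lemma M0_le (S : Sol u q K Cq) (H0 : FinMom u) {t : ℝ} (ht : 0 ≤ t) : M0 u t ≤ (1 + 2 * Real.sqrt t) * N0 u := by
  refine le_trans ?_ (S.mass_int H0 ht).2
  refine integral_mono (S.yV_int H0 ht) (S.mass_int H0 ht).1 fun y => ?_
  have := S.Vf_nonneg t y
  simp only; nlinarith

lemma La_le (S : Sol u q K Cq) (H0 : FinMom u) {t : ℝ} (ht : 0 ≤ t) : La u t ≤ N0 u := by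
  have h1 : ∫ y, Vf u 0 y ≤ N0 u := by
    refine integral_mono (S.Vint0 H0) H0 fun y => ?_
    have := S.Vf_nonneg 0 y
    simp only; nlinarith [mul_nonneg (le_max_right y 0) this]
  rcases ht.eq_or_lt with h | h
  · subst h; exact h1
  · have := S.Vf_weight (S.Vint0 H0) h (φ := fun z => 1) (Φ := fun y => 1)
      (by fun_prop) (fun z => by positivity) (fun z => by positivity) (by simpa using S.Vint0 H0)
      (fun y => by
        simp only [one_mul]
        simp_rw [pk_even t y]
        rw [← ofReal_integral_eq_lintegral_ofReal (pk_integrable h) (Eventually.of_forall fun z => pk_nonneg _ _), pk_integral h])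
    simp only [one_mul] at this
    exact this.2.trans h1

lemma M0_nonneg (S : Sol u q K Cq) (t : ℝ) : 0 ≤ M0 u t := integral_nonneg fun y => mul_nonneg (le_max_right _ _) (S.Vf_nonneg t y)
lemma La_nonneg (S : Sol u q K Cq) (t : ℝ) : 0 ≤ La u t := integral_nonneg fun y => S.Vf_nonneg t y

/-- one step of the a priori estimate -/
theorem apriori_step (S : Sol u q K Cq) (H0 : FinMom u) {t : ℝ} (ht : 1 ≤ t) (z : ℝ) :
    Vf u t z ≤ 3 * K * t ^ (-(3/2) : ℝ) * (1 + max (z + aa * Real.log t) 0 * (M0 u (t / 2) + aa * Real.log t * La u (t / 2))) := by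
  have hK := S.K1
  have ht0 : 0 < t := by linarith
  set L := aa * Real.log t with hL
  have hL0 : 0 ≤ L := mul_nonneg aa_pos.le (Real.log_nonneg ht)
  have hm := S.M0_nonneg (t / 2)
  have hl := S.La_nonneg (t / 2)
  set J := M0 u (t / 2) + L * La u (t / 2) with hJ
  have hJ0 : 0 ≤ J := by positivity
  have hp : 0 < t ^ (-(3/2) : ℝ) := by positivity
  have hexp := exp_aa_log ht0
  rw [← hL] at hexp
  rcases le_or_gt z (-L) with hz | hz
  · rw [max_eq_right (by linarith), zero_mul, add_zero, mul_one]
    refine (S.Vf_le t z).trans ?_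
    have : Real.exp (Real.sqrt 2 * z) ≤ t ^ (-(3/2) : ℝ) := by
      rw [← hexp]
      apply Real.exp_le_exp.mpr
      have := sqrt2_pos
      gcongr
    calc _ ≤ K * t ^ (-(3/2) : ℝ) := by gcongr
      _ ≤ _ := by nlinarith
  · have hw' : 0 < z + L := by linarith
    rw [max_eq_left hw'.le]
    have h1 := S.kernel_upper (r := t / 2) (t := t) (l := -L) (κ := Real.sqrt 2) (w' := z + L) (B := 3 * K) (by linarith) (by linarith) hw'
      (fun t' h1 h2 => S.flux_const h1.le h2 hw' (fun s _ => by
        unfold Wf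
        rw [sqrt2_sq]
        simp only [mul_zero, add_zero, zero_add]
        norm_num
        exact S.le _ _) (by linarith))
    have ht2 : 0 < t - t / 2 := by linarith
    have i1 := S.yV_int H0 (t := t / 2) (by linarith)
    have i2 := S.V_int H0 (t := t / 2) (by linarith)
    have i3 : Integrable (fun y => (max y 0 + L) * Vf u (t / 2) y) := by
      refine (i1.add (i2.const_mul L)).congr (Eventually.of_forall fun y => ?_)
      simp only [Pi.add_apply]; ring
    have v3 : ∫ y, (max y 0 + L) * Vf u (t / 2) y = J := by
      rw [hJ, M0, La, ← integral_const_mul, ← integral_add i1 (i2.const_mul L)]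
      congr 1; ext y; ring
    have i4 := (i3.comp_add_left (-L))
    have h2 : ∫ w in Ioi (0:ℝ), Wf u (Real.sqrt 2) (-L) (t / 2) w * kk (t - t / 2) w (z + L) ≤
        Real.exp (-(Real.sqrt 2 * (-L))) * ((z + L) * (t - t / 2) ^ (-(3/2) : ℝ)) * J := by
      rw [← v3, ← integral_add_left_eq_self (μ := volume) (fun y => (max y 0 + L) * Vf u (t / 2) y) (-L), ← integral_const_mul]
      refine (setIntegral_mono_on ?_ (i4.const_mul (Real.exp (-(Real.sqrt 2 * (-L))) * ((z + L) * (t - t / 2) ^ (-(3/2) : ℝ)))).integrableOn measurableSet_Ioi fun w hw => ?_).trans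
        (setIntegral_le_integral (i4.const_mul _) (Eventually.of_forall fun w => ?_))
      · exact S.Wf_kk_integrable _ _ (by linarith) ht2
      · have hw : 0 < w := hw
        rw [Wf_eq_Vf]
        have a := S.Vf_nonneg (t / 2) (-L + w)
        have b := kk_le_lin (w := w) (w' := z + L) ht2 hw.le hw'.le
        have c : w ≤ max (-L + w) 0 + L := by linarith [le_max_left (-L + w) 0]
        have d : 0 ≤ (t - t / 2) ^ (-(3/2) : ℝ) := by positivity
        calc _ ≤ Real.exp (-(Real.sqrt 2 * (-L))) * Vf u (t / 2) (-L + w) * ((max (-L + w) 0 + L) * (z + L) * (t - t / 2) ^ (-(3/2) : ℝ)) := by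
              refine mul_le_mul_of_nonneg_left (b.trans ?_) (by positivity)
              gcongr
          _ = _ := by ring
      · have a := S.Vf_nonneg (t / 2) (-L + w)
        have d : 0 ≤ (t - t / 2) ^ (-(3/2) : ℝ) := by positivity
        have e := le_max_right (-L + w) 0
        simp only [Pi.zero_apply]
        positivity
    rw [Wf_eq_Vf, show -L + (z + L) = z by ring] at h1
    have h3 := h1.trans (add_le_add_left h2 _)
    have h4 := mul_le_mul_of_nonneg_left h3 (Real.exp_pos (Real.sqrt 2 * (-L))).le
    rw [mul_add, ← mul_assoc, ← mul_assoc, ← mul_assoc, ← Real.exp_add, add_neg_cancel, Real.exp_zero, one_mul, one_mul, hexp] at h4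
    have e3 : (t - t / 2) ^ (-(3/2) : ℝ) ≤ 3 * t ^ (-(3/2) : ℝ) := by
      rw [show t - t / 2 = (1/2) * t by ring, Real.mul_rpow (by norm_num) ht0.le]
      refine mul_le_mul_of_nonneg_right ?_ hp.le
      rw [rpow_neg_three_half (by norm_num), Real.sqrt_div (by norm_num), Real.sqrt_one]
      have := sqrt2_le
      rw [one_div, inv_inv]; linarith
    calc _ ≤ _ := h4
      _ ≤ (z + L) * (3 * t ^ (-(3/2) : ℝ)) * J + t ^ (-(3/2) : ℝ) * (3 * K) := by gcongr
      _ ≤ _ := by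
        have : 0 ≤ (z + L) * t ^ (-(3/2) : ℝ) * J := by positivity
        nlinarith

/-- growth of the first moment via the level-zero flux -/
theorem moment_step (S : Sol u q K Cq) (H0 : FinMom u) {r t : ℝ} (hr : 0 ≤ r) (hrt : r ≤ t) : M0 u t ≤ M0 u r + ∫ s in r..t, 1 / 2 * Vf u s 0 := by
  have hM : ∀ s, ∫ w in Ioi (0:ℝ), Wf u (Real.sqrt 2) 0 s w * w = M0 u s := by
    intro s
    unfold M0
    rw [← setIntegral_eq_integral_of_forall_compl_eq_zero (s := Ioi (0:ℝ)) (f := fun y => max y 0 * Vf u s y)]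
    · refine setIntegral_congr_fun measurableSet_Ioi fun w hw => ?_
      simp only [Wf_zero_eq_Vf]
      rw [max_eq_left (le_of_lt hw), mul_comm]
    · intro y hy
      rw [max_eq_right (by simpa using hy), zero_mul]
  have G := S.green_ineq (r := r) (t := t) (l := 0) (κ := Real.sqrt 2) (h := fun _ w => w) (hs := fun _ _ => 0)
    (hw := fun _ _ => 1) (hww := fun _ _ => 0) (b := fun _ => 0) (C1 := (1 + 2 * Real.sqrt t) * N0 u) hr hrt
    (by fun_prop) (by fun_prop) (by fun_prop) (by fun_prop) (fun _ => rfl) ?_ ?_ ?_ ?_ (by simp) ?_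
  · rw [hM, hM] at G
    simp only [Wf_zero_eq_Vf, mul_one, add_zero] at G
    linarith
  · intro s hs w
    have := (((hasDerivAt_id' s).sub_const s).const_mul (Real.sqrt 2)).const_sub w
    exact this.congr_deriv (by ring)
  · intro s hs w
    exact hasDerivAt_id' w
  · intro s hs w
    exact hasDerivAt_const w 1
  · intro s hs
    have hs0 : 0 ≤ s := hr.trans hs.1
    have m := S.mass_int H0 hs0
    have e : ∀ w ∈ Ioi (0:ℝ), (1 + max w 0) * Vf u s w = Wf u (Real.sqrt 2) 0 s w * (|w| + |(1:ℝ)|) := by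
      intro w hw
      rw [Wf_zero_eq_Vf, max_eq_left (le_of_lt hw), abs_of_pos hw, abs_one]; ring
    refine ⟨m.1.integrableOn.congr_fun e measurableSet_Ioi, ?_⟩
    rw [← setIntegral_congr_fun measurableSet_Ioi e]
    have m3 : (1 + 2 * Real.sqrt s) * N0 u ≤ (1 + 2 * Real.sqrt t) * N0 u := by
      have := S.N0_nonneg
      have := Real.sqrt_le_sqrt hs.2
      gcongr
    refine (setIntegral_le_integral m.1 (Eventually.of_forall fun y => ?_)).trans (m.2.trans m3)
    have := S.Vf_nonneg s y
    have := le_max_right y 0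
    simp only [Pi.zero_apply]
    positivity
  · intro s hs
    refine ⟨fun _ => 0, fun _ _ => le_rfl, fun w hw => ?_, by simp, by simp⟩
    have := mul_nonneg (S.Sf_nonneg (Real.sqrt 2) 0 s w) hw.le
    simp only [mul_zero, add_zero, zero_sub]
    linarith

end Sol
end KPPB

namespace KPPB

lemma log_small {t : ℝ} (ht : 1 ≤ t) : aa * Real.log t ≤ 32 * t ^ (1/16 : ℝ) := by
  have h1 := Real.log_le_rpow_div (by linarith : 0 ≤ t) (by norm_num : (0:ℝ) < 1/16)
  have h2 := aa_le
  have h3 := Real.log_nonneg ht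
  have h4 : 0 ≤ t ^ (1/16 : ℝ) := by positivity
  calc _ ≤ 2 * (t ^ (1/16 : ℝ) / (1/16)) := by gcongr
    _ = _ := by ring

namespace Sol
variable {u : ℝ → ℝ → ℝ} {q : ℝ → ℝ} {K Cq : ℝ}

lemma pass (S : Sol u q K Cq) (H0 : FinMom u) {p D : ℝ} (hp : 0 ≤ p) (hD : 0 ≤ D)
    (h : ∀ s, 1 / 2 ≤ s → M0 u s ≤ D * s ^ p) :
    ∃ D', 0 ≤ D' ∧ ∀ s, 1 ≤ s → Vf u s 0 ≤ D' * s ^ (p - 11/8) := by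
  have hN := S.N0_nonneg
  have hK := S.K1
  refine ⟨3 * K * (1 + 32 * (D + 32 * N0 u)), by positivity, fun t ht => ?_⟩
  have ht0 : 0 < t := by linarith
  have h1 := S.apriori_step H0 ht 0
  have hL := log_small ht
  have hL0 : 0 ≤ aa * Real.log t := mul_nonneg aa_pos.le (Real.log_nonneg ht)
  rw [zero_add, max_eq_left hL0] at h1
  have hm := h (t / 2) (by linarith)
  have hl := S.La_le H0 (t := t / 2) (by linarith)
  have hl0 := S.La_nonneg (t / 2)
  have hm0 := S.M0_nonneg (t / 2)
  have e1 : (t / 2) ^ p ≤ t ^ (p + 1/16) := by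
    calc (t / 2) ^ p ≤ t ^ p := Real.rpow_le_rpow (by linarith) (by linarith) hp
      _ ≤ _ := Real.rpow_le_rpow_of_exponent_le ht (by linarith)
  have e2 : t ^ (1/16 : ℝ) ≤ t ^ (p + 1/16) := Real.rpow_le_rpow_of_exponent_le ht (by linarith)
  have e3 : (1:ℝ) ≤ t ^ (p + 1/8) := Real.one_le_rpow ht (by linarith)
  have e4 : t ^ (1/16 : ℝ) * t ^ (p + 1/16) = t ^ (p + 1/8) := by
    rw [← Real.rpow_add ht0]; congr 1; ring
  have e5 : t ^ (-(3/2) : ℝ) * t ^ (p + 1/8) = t ^ (p - 11/8) := by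
    rw [← Real.rpow_add ht0]; congr 1; ring
  have J : M0 u (t / 2) + aa * Real.log t * La u (t / 2) ≤ (D + 32 * N0 u) * t ^ (p + 1/16) := by
    calc _ ≤ D * t ^ (p + 1/16) + 32 * t ^ (p + 1/16) * N0 u := by
          refine add_le_add (hm.trans (by gcongr)) ?_
          refine mul_le_mul (hL.trans (by gcongr)) hl hl0 (by positivity)
      _ = _ := by ring
  have LJ : aa * Real.log t * (M0 u (t / 2) + aa * Real.log t * La u (t / 2)) ≤ 32 * (D + 32 * N0 u) * t ^ (p + 1/8) := by
    calc _ ≤ (32 * t ^ (1/16 : ℝ)) * ((D + 32 * N0 u) * t ^ (p + 1/16)) := mul_le_mul hL J (by positivity) (by positivity)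
      _ = 32 * (D + 32 * N0 u) * (t ^ (1/16 : ℝ) * t ^ (p + 1/16)) := by ring
      _ = _ := by rw [e4]
  calc _ ≤ _ := h1
    _ ≤ 3 * K * t ^ (-(3/2) : ℝ) * (t ^ (p + 1/8) + 32 * (D + 32 * N0 u) * t ^ (p + 1/8)) := by gcongr
    _ = 3 * K * (1 + 32 * (D + 32 * N0 u)) * (t ^ (-(3/2) : ℝ) * t ^ (p + 1/8)) := by ring
    _ = _ := by rw [e5]

lemma flux0_cont (S : Sol u q K Cq) : Continuous (fun s => Vf u s 0) :=
  S.Vf_cont.comp (by fun_prop : Continuous (fun s : ℝ => ((s, 0) : ℝ × ℝ)))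

lemma M0_small (S : Sol u q K Cq) (H0 : FinMom u) {s : ℝ} (hs : 0 ≤ s) (h1 : s ≤ 1) : M0 u s ≤ 3 * N0 u := by
  have hN := S.N0_nonneg
  refine (S.M0_le H0 hs).trans ?_
  have : Real.sqrt s ≤ 1 := by rw [Real.sqrt_le_one]; exact h1
  nlinarith

theorem M0_bdd (S : Sol u q K Cq) (H0 : FinMom u) : ∃ Mb, 0 ≤ Mb ∧ ∀ s, 0 ≤ s → M0 u s ≤ Mb := by
  have hN := S.N0_nonneg
  obtain ⟨D1, hD1, h1⟩ := S.pass H0 (p := 1/2) (D := 4 * N0 u) (by norm_num) (by positivity) (fun s hs => by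
    refine (S.M0_le H0 (by linarith)).trans ?_
    rw [← Real.sqrt_eq_rpow]
    have : 1/2 ≤ Real.sqrt s := by
      apply Real.le_sqrt_of_sq_le; nlinarith
    nlinarith)
  obtain ⟨D2, hD2, h2⟩ := S.pass H0 (p := 1/8) (D := 6 * N0 u + 4 * D1) (by norm_num) (by positivity) (fun s hs => by
    have hs0 : 0 < s := by linarith
    rcases le_or_gt s 1 with h | h
    · refine (S.M0_small H0 (by linarith) h).trans ?_
      have : s ≤ s ^ (1/8 : ℝ) := by
        calc s = s ^ (1:ℝ) := (Real.rpow_one s).symm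
          _ ≤ _ := Real.rpow_le_rpow_of_exponent_ge hs0 h (by norm_num)
      nlinarith
    · have m := S.moment_step H0 (r := 1) (t := s) (by norm_num) h.le
      have m1 := S.M0_small H0 (s := 1) (by norm_num) le_rfl
      have m2 : ∫ x in (1:ℝ)..s, 1 / 2 * Vf u x 0 ≤ ∫ x in (1:ℝ)..s, (1/2 * D1) * x ^ (-(7/8) : ℝ) := by
        refine intervalIntegral.integral_mono_on h.le ?_ ?_ fun x hx => ?_
        · exact (continuous_const.mul S.flux0_cont).intervalIntegrable _ _
        · refine ContinuousOn.intervalIntegrable_of_Icc h.le ?_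
          exact continuousOn_const.mul (ContinuousOn.rpow_const continuousOn_id fun x hx => Or.inl (ne_of_gt (lt_of_lt_of_le one_pos hx.1)))
        · have := h1 x hx.1
          rw [show (1/2 - 11/8 : ℝ) = -(7/8) by norm_num] at this
          linarith
      rw [intervalIntegral.integral_const_mul (1/2*D1), integral_rpow (Or.inl (by norm_num))] at m2
      rw [show (-(7/8) + 1 : ℝ) = 1/8 by norm_num, Real.one_rpow] at m2
      have e : (1:ℝ) ≤ s ^ (1/8 : ℝ) := Real.one_le_rpow h.le (by norm_num)
      have e1 : 1 / 2 * D1 * ((s ^ (1/8 : ℝ) - 1) / (1/8)) ≤ 4 * D1 * s ^ (1/8:ℝ) := by nlinarith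
      nlinarith)
  refine ⟨3 * N0 u + 2 * D2, by positivity, fun s hs => ?_⟩
  rcases le_or_gt s 1 with h | h
  · refine (S.M0_small H0 hs h).trans (by linarith)
  · have m := S.moment_step H0 (r := 1) (t := s) (by norm_num) h.le
    have m1 := S.M0_small H0 (s := 1) (by norm_num) le_rfl
    have m2 : ∫ x in (1:ℝ)..s, 1 / 2 * Vf u x 0 ≤ ∫ x in (1:ℝ)..s, (1/2 * D2) * x ^ (-(1 + 1/4) : ℝ) := by
      refine intervalIntegral.integral_mono_on h.le ?_ ?_ fun x hx => ?_
      · exact (continuous_const.mul S.flux0_cont).intervalIntegrable _ _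
      · refine ContinuousOn.intervalIntegrable_of_Icc h.le ?_
        exact continuousOn_const.mul (ContinuousOn.rpow_const continuousOn_id fun x hx => Or.inl (ne_of_gt (lt_of_lt_of_le one_pos hx.1)))
      · have := h2 x hx.1
        rw [show (1/8 - 11/8 : ℝ) = -(1 + 1/4) by norm_num] at this
        linarith
    have m3 := int_pow_le (r := 1) (t' := s) (p := 1/4) (by norm_num) h.le (by norm_num)
    rw [intervalIntegral.integral_const_mul (1/2*D2)] at m2
    rw [Real.one_rpow] at m3
    nlinarith

/-- decay of total mass -/
theorem La_decay (S : Sol u q K Cq) (H0 : FinMom u) : ∃ C, 0 ≤ C ∧ ∀ t, 1 ≤ t → La u t ≤ C * t ^ (-(1/4) : ℝ) := by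
  obtain ⟨Mb, hMb, hM⟩ := S.M0_bdd H0
  have hN := S.N0_nonneg
  have hK := S.K1
  set Q := 3 * K * (1 + 33 * (Mb + 32 * N0 u)) with hQ
  have hQ0 : 0 ≤ Q := by positivity
  refine ⟨K + 2 * Q + Mb, by positivity, fun t ht => ?_⟩
  have ht0 : 0 < t := by linarith
  set R := Real.sqrt t with hR
  have hR1 : 1 ≤ R := by rw [hR, Real.one_le_sqrt]; exact ht
  have hRp : R = t ^ (1/2 : ℝ) := by rw [hR, Real.sqrt_eq_rpow]
  have s2 := sqrt2_pos
  have s1 := one_le_sqrt2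
  -- middle bound
  have mid : ∀ z, z ≤ R → Vf u t z ≤ Q * t ^ (-(7/8) : ℝ) := by
    intro z hz
    have h1 := S.apriori_step H0 ht z
    have hL := log_small ht
    have hL0 : 0 ≤ aa * Real.log t := mul_nonneg aa_pos.le (Real.log_nonneg ht)
    have hm := hM (t / 2) (by linarith)
    have hm0 := S.M0_nonneg (t / 2)
    have hl := S.La_le H0 (t := t / 2) (by linarith)
    have hl0 := S.La_nonneg (t / 2)
    have e0 : (1:ℝ) ≤ t ^ (1/16 : ℝ) := Real.one_le_rpow ht (by norm_num)
    have J : M0 u (t / 2) + aa * Real.log t * La u (t / 2) ≤ (Mb + 32 * N0 u) * t ^ (1/16:ℝ) := by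
      calc _ ≤ Mb * t ^ (1/16 : ℝ) + 32 * t ^ (1/16:ℝ) * N0 u := by
            refine add_le_add (by nlinarith) ?_
            exact mul_le_mul hL hl hl0 (by positivity)
        _ = _ := by ring
    have e1 : t ^ (1/16 : ℝ) ≤ t ^ (1/2 : ℝ) := Real.rpow_le_rpow_of_exponent_le ht (by norm_num)
    have e2 : max (z + aa * Real.log t) 0 ≤ 33 * t ^ (1/2:ℝ) := by
      refine max_le ?_ (by positivity)
      linarith
    have e4 : t ^ (1/2 : ℝ) * t ^ (1/16:ℝ) = t ^ (9/16:ℝ) := by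
      rw [← Real.rpow_add ht0]; norm_num
    have e5 : t ^ (-(3/2) : ℝ) * t ^ (5/8:ℝ) = t ^ (-(7/8):ℝ) := by
      rw [← Real.rpow_add ht0]; norm_num
    have e6 : (1:ℝ) ≤ t ^ (5/8 : ℝ) := Real.one_le_rpow ht (by norm_num)
    have e7 : t ^ (9/16 : ℝ) ≤ t ^ (5/8 : ℝ) := Real.rpow_le_rpow_of_exponent_le ht (by norm_num)
    have e8 : max (z + aa * Real.log t) 0 * (M0 u (t / 2) + aa * Real.log t * La u (t / 2)) ≤ 33 * (Mb + 32 * N0 u) * t ^ (5/8:ℝ) := by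
      calc _ ≤ (33 * t ^ (1/2:ℝ)) * ((Mb + 32 * N0 u) * t ^ (1/16:ℝ)) := mul_le_mul e2 J (by positivity) (by positivity)
        _ = 33 * (Mb + 32 * N0 u) * (t ^ (1/2 : ℝ) * t ^ (1/16:ℝ)) := by ring
        _ ≤ _ := by rw [e4]; gcongr
    calc _ ≤ _ := h1
      _ ≤ 3 * K * t ^ (-(3/2) : ℝ) * (t ^ (5/8 : ℝ) + 33 * (Mb + 32 * N0 u) * t ^ (5/8:ℝ)) := by gcongr
      _ = Q * (t ^ (-(3/2) : ℝ) * t ^ (5/8:ℝ)) := by rw [hQ]; ring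
      _ = _ := by rw [e5]
  -- pointwise splitting
  set f1 : ℝ → ℝ := indicator (Iic (-R)) (fun z => K * Real.exp (Real.sqrt 2 * z)) with hf1
  set f2 : ℝ → ℝ := indicator (Icc (-R) R) (fun _ => Q * t ^ (-(7/8) : ℝ)) with hf2
  set f3 : ℝ → ℝ := fun z => R⁻¹ * (max z 0 * Vf u t z) with hf3
  have i1 : Integrable f1 := by
    rw [hf1, integrable_indicator_iff measurableSet_Iic]
    exact (integrableOn_exp_mul_Iic s2 _).const_mul K
  have i2 : Integrable f2 := by
    rw [hf2, integrable_indicator_iff measurableSet_Icc]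
    exact continuous_const.integrableOn_Icc
  have i3 : Integrable f3 := (S.yV_int H0 ht0.le).const_mul _
  have hpos : 0 ≤ Q * t ^ (-(7/8) : ℝ) := by positivity
  have ptw : ∀ z, Vf u t z ≤ (f1 z + f2 z) + f3 z := by
    intro z
    have n1 : 0 ≤ f1 z := indicator_nonneg (fun z _ => by positivity) z
    have n2 : 0 ≤ f2 z := indicator_nonneg (fun z _ => hpos) z
    have v0 := S.Vf_nonneg t z
    have n3 : 0 ≤ f3 z := by
      simp only [hf3]
      have := le_max_right z 0
      positivity
    rcases le_or_gt z (-R) with h | h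
    · have : f1 z = K * Real.exp (Real.sqrt 2 * z) := by rw [hf1, indicator_of_mem (show z ∈ Iic (-R) from h)]
      have := S.Vf_le t z
      linarith
    · rcases le_or_gt z R with h' | h'
      · have : f2 z = Q * t ^ (-(7/8) : ℝ) := by rw [hf2, indicator_of_mem (show z ∈ Icc (-R) R from ⟨h.le, h'⟩)]
        have := mid z h'
        linarith
      · have : Vf u t z ≤ f3 z := by
          simp only [hf3]
          rw [max_eq_left (by linarith), inv_mul_eq_div, le_div_iff₀ (by linarith)]
          nlinarith
        linarith
  have v1 : ∫ z, f1 z ≤ K * R⁻¹ := by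
    rw [hf1, integral_indicator measurableSet_Iic, integral_const_mul, integral_exp_mul_Iic s2]
    gcongr
    rw [show Real.sqrt 2 * -R = -(Real.sqrt 2 * R) by ring, Real.exp_neg]
    have := Real.add_one_le_exp (Real.sqrt 2 * R)
    calc (Real.exp (Real.sqrt 2 * R))⁻¹ / Real.sqrt 2 ≤ (Real.exp (Real.sqrt 2 * R))⁻¹ := div_le_self (by positivity) s1
      _ ≤ R⁻¹ := by
        gcongr
        nlinarith
  have v2 : ∫ z, f2 z ≤ 2 * Q * t ^ (-(3/8) : ℝ) := by
    rw [hf2, integral_indicator measurableSet_Icc, setIntegral_const]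
    simp only [measureReal_def, Real.volume_Icc, smul_eq_mul]
    rw [ENNReal.toReal_ofReal (by linarith), hRp]
    have e5 : t ^ (-(7/8) : ℝ) * t ^ (1/2:ℝ) = t ^ (-(3/8):ℝ) := by
      rw [← Real.rpow_add ht0]; norm_num
    rw [← e5]
    linarith
  have v3 : ∫ z, f3 z ≤ R⁻¹ * Mb := by
    simp only [hf3]
    rw [integral_const_mul]
    have := hM t ht0.le
    unfold M0 at this
    gcongr
  have rb : R⁻¹ ≤ t ^ (-(1/4) : ℝ) := by
    rw [hR, ← rpow_neg_half ht0]
    exact Real.rpow_le_rpow_of_exponent_le ht (by norm_num)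
  have rc : t ^ (-(3/8) : ℝ) ≤ t ^ (-(1/4) : ℝ) := Real.rpow_le_rpow_of_exponent_le ht (by norm_num)
  calc La u t ≤ ∫ z, ((f1 z + f2 z) + f3 z) := integral_mono (S.V_int H0 ht0.le) ((i1.add i2).add i3) ptw
    _ = (∫ z, f1 z) + (∫ z, f2 z) + ∫ z, f3 z := by
      have i12 : Integrable (fun z => f1 z + f2 z) := i1.add i2
      rw [integral_add i12 i3, integral_add i1 i2]
    _ ≤ K * R⁻¹ + 2 * Q * t ^ (-(3/8) : ℝ) + R⁻¹ * Mb := by linarith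
    _ ≤ K * t ^ (-(1/4) : ℝ) + 2 * Q * t ^ (-(1/4) : ℝ) + t ^ (-(1/4) : ℝ) * Mb := by gcongr
    _ = _ := by ring

/-- the sharp a priori bound (A) -/
theorem apriori (S : Sol u q K Cq) (H0 : FinMom u) : ∃ A, 1 ≤ A ∧ ∀ t, 2 ≤ t → ∀ z,
    Vf u t z ≤ A * t ^ (-(3/2) : ℝ) * (1 + max (z + aa * Real.log t) 0) := by
  obtain ⟨Mb, hMb, hM⟩ := S.M0_bdd H0
  obtain ⟨C, hC, hL⟩ := S.La_decay H0
  have hK := S.K1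
  refine ⟨3 * K * (1 + (Mb + 64 * C)), ?_, fun t ht z => ?_⟩
  · have : 0 ≤ K * (Mb + 64 * C) := by positivity
    nlinarith
  have ht0 : 0 < t := by linarith
  have h1 := S.apriori_step H0 (by linarith : 1 ≤ t) z
  have hLg := log_small (by linarith : 1 ≤ t)
  have hL0 : 0 ≤ aa * Real.log t := mul_nonneg aa_pos.le (Real.log_nonneg (by linarith))
  have hl := hL (t / 2) (by linarith)
  have hl0 := S.La_nonneg (t / 2)
  have hm := hM (t / 2) (by linarith)
  have hm0 := S.M0_nonneg (t / 2)
  have e1 : (t / 2) ^ (-(1/4) : ℝ) ≤ 2 * t ^ (-(1/16) : ℝ) := by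
    rw [show t / 2 = (1/2) * t by ring, Real.mul_rpow (by norm_num) ht0.le]
    have a1 : (1/2 : ℝ) ^ (-(1/4) : ℝ) ≤ 2 := by
      calc (1/2 : ℝ) ^ (-(1/4) : ℝ) ≤ (1/2 : ℝ) ^ (-1 : ℝ) := Real.rpow_le_rpow_of_exponent_ge (by norm_num) (by norm_num) (by norm_num)
        _ = 2 := by rw [Real.rpow_neg_one]; norm_num
    have a2 : t ^ (-(1/4) : ℝ) ≤ t ^ (-(1/16) : ℝ) := Real.rpow_le_rpow_of_exponent_le (by linarith) (by norm_num)
    gcongr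
  have e2 : t ^ (1/16 : ℝ) * t ^ (-(1/16) : ℝ) = 1 := by
    rw [← Real.rpow_add ht0]; norm_num
  have LL : aa * Real.log t * La u (t / 2) ≤ 64 * C := by
    calc _ ≤ (32 * t ^ (1/16 : ℝ)) * (C * (2 * t ^ (-(1/16) : ℝ))) := mul_le_mul hLg (hl.trans (by gcongr)) hl0 (by positivity)
      _ = 64 * C * (t ^ (1/16 : ℝ) * t ^ (-(1/16) : ℝ)) := by ring
      _ = _ := by rw [e2, mul_one]
  have mx : 0 ≤ max (z + aa * Real.log t) 0 := le_max_right _ _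
  set m := max (z + aa * Real.log t) 0
  calc _ ≤ _ := h1
    _ ≤ 3 * K * t ^ (-(3/2) : ℝ) * (1 + m * (Mb + 64 * C)) := by gcongr
    _ ≤ 3 * K * t ^ (-(3/2) : ℝ) * ((1 + (Mb + 64 * C)) * (1 + m)) := by
        gcongr
        nlinarith
    _ = _ := by ring

end Sol
end KPPB

namespace KPPB

/-- decay of the nonlinearity, the only consequence of (H1) that is used -/
def QDec (q : ℝ → ℝ) (K γ : ℝ) : Prop := ∀ A, 0 ≤ A → ∃ C, 0 ≤ C ∧ ∀ w v, 0 ≤ w → 0 ≤ v → v ≤ K →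
  v ≤ A * (1 + w) * Real.exp (-(Real.sqrt 2 * w)) → q v ≤ C * (1 + w) ^ (-(2 + γ)) * v

lemma kk_pos {τ w w' : ℝ} (hτ : 0 < τ) (hw : 0 < w) (hw' : 0 < w') : 0 < kk τ w w' := by
  rw [kk_eq hτ]
  refine mul_pos (pk_pos hτ _) ?_
  rw [sub_pos, Real.exp_lt_one_iff]
  have : 0 < 2 * w * w' / τ := by positivity
  linarith

lemma setInt_pos {f : ℝ → ℝ} (hf : Continuous f) (h0 : ∀ w, 0 < w → 0 ≤ f w) (hi : IntegrableOn f (Ioi 0))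
    {w0 : ℝ} (hw0 : 0 < w0) (hp : 0 < f w0) : 0 < ∫ w in Ioi (0:ℝ), f w := by
  rw [setIntegral_pos_iff_support_of_nonneg_ae ((ae_restrict_iff' measurableSet_Ioi).mpr (Eventually.of_forall h0)) hi]
  exact (hf.isOpen_support.inter isOpen_Ioi).measure_pos _ ⟨w0, ne_of_gt hp, hw0⟩

namespace Sol
variable {u : ℝ → ℝ → ℝ} {q : ℝ → ℝ} {K Cq : ℝ}

lemma pos (S : Sol u q K Cq) {x0 : ℝ} (hx0 : 0 < u 0 x0) {t : ℝ} (ht : 0 < t) (x : ℝ) : 0 < u t x := by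
  set l := min x0 x - 1 with hl
  have l1 : l < x0 := by have := min_le_left x0 x; linarith
  have l2 : l < x := by have := min_le_right x0 x; linarith
  have G := S.kernel_lower (r := 0) (t := t) (l := l) (κ := 0) (w' := x - l) (g := Cq) (B := 0) le_rfl ht (by linarith)
    (b := fun _ => 0) (fun _ _ _ => by simp) (fun _ _ _ => by simp) (fun s hs => ⟨fun _ => 0, fun _ _ => le_rfl, fun w hw => ?_, by simp, by simp⟩)
  · have P : 0 < ∫ w in Ioi (0:ℝ), Wf u 0 l 0 w * kk (t - 0) w (x - l) := by
      have hk : Continuous (fun w => kk (t - 0) w (x - l)) := by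
        unfold kk
        exact (pk_cont continuous_const (by fun_prop) (fun _ => by linarith)).sub (pk_cont continuous_const (by fun_prop) (fun _ => by linarith))
      refine setInt_pos (w0 := x0 - l) ?_ ?_ (S.Wf_kk_integrable 0 l le_rfl (by linarith)) (by linarith) ?_
      · exact ((S.Wf_cont 0 l).comp (by fun_prop : Continuous (fun w : ℝ => ((0, w) : ℝ × ℝ)))).mul hk
      · intro w hw
        exact mul_nonneg (S.Wf_nonneg _ _ _ _) (kk_nonneg (by linarith) hw.le (by linarith))
      · refine mul_pos ?_ (kk_pos (by linarith) (by linarith) (by linarith))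
        unfold Wf
        refine mul_pos (Real.exp_pos _) ?_
        rw [show l + 0 * 0 + (x0 - l) = x0 by ring]; exact hx0
    rw [mul_zero, Real.exp_zero, one_mul, sub_zero] at G
    have h1 : 0 < Real.exp (Cq * t) * Wf u 0 l t (x - l) := by
      exact lt_of_lt_of_le P G
    have h2 : 0 < Wf u 0 l t (x - l) := pos_of_mul_pos_right h1 (Real.exp_pos _).le
    unfold Wf at h2
    have h3 := pos_of_mul_pos_right h2 (Real.exp_pos _).le
    rwa [show l + 0 * t + (x - l) = x by ring] at h3
  · have a1 : Sf u q 0 l s w ≤ Cq * Wf u 0 l s w := by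
      unfold Sf Wf
      have := S.qle (u s (l + 0 * s + w)) (S.nonneg _ _) (S.le _ _)
      have e := Real.exp_pos (0 * w + (0 ^ 2 / 2 - 1) * s)
      nlinarith
    have a2 : 0 ≤ kk (t - s) w (x - l) := kk_nonneg (by linarith [hs.2]) hw.le (by linarith)
    have a3 := mul_nonneg (Real.exp_pos (Cq * s)).le (mul_nonneg (sub_nonneg.mpr a1) a2)
    nlinarith

/-- integrability of weighted `Wf` at nonnegative level -/
lemma W_int (S : Sol u q K Cq) (H0 : FinMom u) {L s t : ℝ} (hL : 0 ≤ L) (hs : 0 ≤ s) (hst : s ≤ t) {g : ℝ → ℝ} (hg : Continuous g)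
    (hb : ∀ w, 0 < w → |g w| ≤ 2 * (1 + w)) :
    IntegrableOn (fun w => Wf u (Real.sqrt 2) L s w * g w) (Ioi 0) ∧
     ∫ w in Ioi (0:ℝ), Wf u (Real.sqrt 2) L s w * |g w| ≤ 2 * ((1 + 2 * Real.sqrt t) * N0 u) := by
  have m := S.mass_int H0 hs
  have i1 : Integrable (fun w => (1 + max (L + w) 0) * Vf u s (L + w)) := m.1.comp_add_left L
  have i2 := i1.const_mul 2
  have hW : ∀ w, Wf u (Real.sqrt 2) L s w ≤ Vf u s (L + w) := by
    intro w
    rw [Wf_eq_Vf]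
    refine mul_le_of_le_one_left (S.Vf_nonneg _ _) ?_
    rw [Real.exp_le_one_iff]
    have := sqrt2_pos
    have := mul_nonneg this.le hL
    linarith
  have hp : ∀ w, 0 < w → Wf u (Real.sqrt 2) L s w * |g w| ≤ 2 * ((1 + max (L + w) 0) * Vf u s (L + w)) := by
    intro w hw
    have h1 := hb w hw
    have h2 := S.Vf_nonneg s (L + w)
    have h3 : w ≤ max (L + w) 0 := le_max_of_le_left (by linarith)
    calc _ ≤ Vf u s (L + w) * (2 * (1 + max (L + w) 0)) := mul_le_mul (hW w) (by linarith) (abs_nonneg _) h2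
      _ = _ := by ring
  have cW : Continuous (fun w => Wf u (Real.sqrt 2) L s w) :=
    (S.Wf_cont (Real.sqrt 2) L).comp (by fun_prop : Continuous (fun w : ℝ => ((s, w) : ℝ × ℝ)))
  have i3 : IntegrableOn (fun w => Wf u (Real.sqrt 2) L s w * g w) (Ioi 0) := by
    refine Integrable.mono' i2.integrableOn (cW.mul hg).aestronglyMeasurable ?_
    refine (ae_restrict_iff' measurableSet_Ioi).mpr (Eventually.of_forall fun w hw => ?_)
    rw [Real.norm_eq_abs, abs_mul, abs_of_nonneg (S.Wf_nonneg _ _ _ _)]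
    exact hp w hw
  refine ⟨i3, ?_⟩
  have i4 : IntegrableOn (fun w => Wf u (Real.sqrt 2) L s w * |g w|) (Ioi 0) := by
    refine i3.abs.congr (Eventually.of_forall fun w => ?_)
    show |_| = _
    rw [abs_mul, abs_of_nonneg (S.Wf_nonneg _ _ _ _)]
  have m3 : (1 + 2 * Real.sqrt s) * N0 u ≤ (1 + 2 * Real.sqrt t) * N0 u := by
    have := S.N0_nonneg
    have := Real.sqrt_le_sqrt hst
    gcongr
  calc _ ≤ ∫ w in Ioi (0:ℝ), 2 * ((1 + max (L + w) 0) * Vf u s (L + w)) :=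
        setIntegral_mono_on i4 i2.integrableOn measurableSet_Ioi hp
    _ ≤ ∫ w, 2 * ((1 + max (L + w) 0) * Vf u s (L + w)) := by
        refine setIntegral_le_integral i2 (Eventually.of_forall fun y => ?_)
        have := S.Vf_nonneg s (L + y)
        have := le_max_right (L + y) 0
        simp only [Pi.zero_apply]
        positivity
    _ = 2 * ∫ z, (1 + max z 0) * Vf u s z := by
        rw [integral_const_mul, integral_add_left_eq_self (μ := volume) (fun z => (1 + max z 0) * Vf u s z) L]
    _ ≤ _ := by linarith [m.2]

lemma M0_eq (u : ℝ → ℝ → ℝ) (s : ℝ) : ∫ w in Ioi (0:ℝ), Vf u s w * w = M0 u s := by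
  unfold M0
  rw [← setIntegral_eq_integral_of_forall_compl_eq_zero (s := Ioi (0:ℝ)) (f := fun y => max y 0 * Vf u s y)]
  · refine setIntegral_congr_fun measurableSet_Ioi fun w hw => ?_
    show _ = max w 0 * Vf u s w
    rw [max_eq_left (le_of_lt hw), mul_comm]
  · intro y hy
    rw [max_eq_right (by simpa using hy), zero_mul]

lemma V_lin (S : Sol u q K Cq) (H0 : FinMom u) : ∃ A, 1 ≤ A ∧ ∀ t, 2 ≤ t → ∀ z, 0 ≤ z → Vf u t z ≤ A * (1 + z) := by
  obtain ⟨A, hA, h⟩ := S.apriori H0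
  refine ⟨3 * A, by linarith, fun t ht z hz => (h t ht z).trans ?_⟩
  have ht0 : 0 < t := by linarith
  have hl : Real.log t ≤ t := (Real.log_le_sub_one_of_pos ht0).trans (by linarith)
  have hl0 : 0 ≤ Real.log t := Real.log_nonneg (by linarith)
  have ha := aa_le
  have ha0 := aa_pos
  have h1 : aa * Real.log t ≤ 2 * t := mul_le_mul ha hl hl0 (by norm_num)
  have h2 : 0 ≤ aa * Real.log t := by positivity
  rw [max_eq_left (by linarith)]
  have h3 : 1 + (z + aa * Real.log t) ≤ 3 * t * (1 + z) := by nlinarith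
  have h4 : t ^ (-(3/2) : ℝ) * t ≤ 1 := by
    nth_rewrite 2 [← Real.rpow_one t]
    rw [← Real.rpow_add ht0]
    exact Real.rpow_le_one_of_one_le_of_nonpos (by linarith) (by norm_num)
  calc _ ≤ A * t ^ (-(3/2) : ℝ) * (3 * t * (1 + z)) := by gcongr
    _ = 3 * A * (1 + z) * (t ^ (-(3/2) : ℝ) * t) := by ring
    _ ≤ 3 * A * (1 + z) * 1 := by gcongr
    _ = _ := by ring

/-- uniform lower bound for the first moment -/
theorem M0_lower (S : Sol u q K Cq) (H0 : FinMom u) {x0 γ : ℝ} (hx0 : 0 < u 0 x0) (hγ : 0 < γ) (hγ1 : γ ≤ 1/2) (hq : QDec q K γ) :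
    ∃ c, 0 < c ∧ ∀ t, 2 ≤ t → c ≤ M0 u t := by
  obtain ⟨A, hA, hV⟩ := S.V_lin H0
  obtain ⟨C, hC, hS⟩ := hq A (by linarith)
  set a := γ / 4 with ha
  have ha0 : 0 < a := by positivity
  have ha1 : a ≤ 1/8 := by rw [ha]; linarith
  -- choose L
  obtain ⟨L, hL1, hL⟩ : ∃ L : ℝ, 0 ≤ L ∧ C * (1 + L) ^ (-(γ / 2)) ≤ a / 2 := by
    have t1 : Tendsto (fun x : ℝ => C * x ^ (-(γ / 2))) atTop (𝓝 (C * 0)) :=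
      (tendsto_rpow_neg_atTop (by positivity)).const_mul C
    rw [mul_zero] at t1
    obtain ⟨x, hx, hx1⟩ := ((t1.eventually_lt_const (by positivity : 0 < a / 2)).and (eventually_ge_atTop 1)).exists
    exact ⟨x - 1, by linarith, by rw [add_sub_cancel]; exact hx.le⟩
  set h : ℝ → ℝ := fun w => w - w * (1 + w ^ 2) ^ (-a) with hh
  set h1 : ℝ → ℝ := fun w => 1 - ((1 + w ^ 2) ^ (-a) - 2 * a * w ^ 2 * (1 + w ^ 2) ^ (-a - 1)) with hh1
  set h2 : ℝ → ℝ := fun w => w * (1 + w ^ 2) ^ (-a - 2) * (6 * a * (1 + w ^ 2) - 4 * a * (a + 1) * w ^ 2) with hh2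
  have bp : ∀ w : ℝ, 0 < 1 + w ^ 2 := fun w => by positivity
  have cr : ∀ p : ℝ, Continuous (fun w : ℝ => (1 + w ^ 2) ^ p) := fun p =>
    Continuous.rpow_const (by fun_prop) (fun w => Or.inl (bp w).ne')
  have dr : ∀ p w : ℝ, HasDerivAt (fun w : ℝ => (1 + w ^ 2) ^ p) (2 * p * w * (1 + w ^ 2) ^ (p - 1)) w := by
    intro p w
    have d1 : HasDerivAt (fun w : ℝ => 1 + w ^ 2) (2 * w) w := by
      have := ((hasDerivAt_id' w).fun_pow 2).const_add 1
      exact this.congr_deriv (by simp)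
    exact (d1.rpow_const (p := p) (Or.inl (bp w).ne')).congr_deriv (by ring)
  have pe : ∀ (p w : ℝ), (1 + w ^ 2) ^ p = (1 + w ^ 2) ^ (p - 1) * (1 + w ^ 2) := by
    intro p w
    nth_rewrite 3 [← Real.rpow_one (1 + w ^ 2)]
    rw [← Real.rpow_add (bp w)]; congr 1; ring
  have ch : Continuous h := continuous_id.sub (continuous_id.mul (cr _))
  have ch1 : Continuous h1 := continuous_const.sub ((cr _).sub ((by fun_prop : Continuous (fun w : ℝ => 2 * a * w ^ 2)).mul (cr _)))
  have ch2 : Continuous h2 := (continuous_id.mul (cr _)).mul (by fun_prop)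
  have dh : ∀ w, HasDerivAt h (h1 w) w := by
    intro w
    have := (hasDerivAt_id' w).sub ((hasDerivAt_id' w).fun_mul (dr (-a) w))
    refine this.congr_deriv ?_
    simp only [hh1]; ring
  have dh1 : ∀ w, HasDerivAt h1 (h2 w) w := by
    intro w
    have d2 : HasDerivAt (fun w : ℝ => 2 * a * w ^ 2) (4 * a * w) w := by
      have := ((hasDerivAt_id' w).fun_pow 2).const_mul (2 * a)
      exact this.congr_deriv (by simp; ring)
    have := ((dr (-a) w).sub (d2.fun_mul (dr (-a - 1) w))).const_sub 1
    refine this.congr_deriv ?_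
    simp only [hh2]
    rw [pe (-a - 1) w, show -a - 1 - 1 = -a - 2 by ring]; ring
  have r01 : ∀ w : ℝ, (1 + w ^ 2) ^ (-a) ≤ 1 := fun w =>
    Real.rpow_le_one_of_one_le_of_nonpos (by nlinarith) (by linarith)
  have rp : ∀ p w : ℝ, 0 < (1 + w ^ 2) ^ p := fun p w => Real.rpow_pos_of_pos (bp w) p
  have h_nn : ∀ w, 0 ≤ w → 0 ≤ h w := fun w hw => by
    simp only [hh]; nlinarith [r01 w]
  have h_le : ∀ w, 0 ≤ w → h w ≤ w := fun w hw => by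
    simp only [hh]; nlinarith [rp (-a) w]
  have h1_b : ∀ w, |h1 w| ≤ 2 := fun w => by
    have e1 := r01 w
    have e2 := rp (-a) w
    have e3 := rp (-a - 1) w
    have e4 := pe (-a) w
    have e5 : 2 * a * w ^ 2 * (1 + w ^ 2) ^ (-a - 1) ≤ 1 := by nlinarith [mul_nonneg (sq_nonneg w) e3.le]
    have e6 : 0 ≤ 2 * a * w ^ 2 * (1 + w ^ 2) ^ (-a - 1) := by positivity
    simp only [hh1]
    rw [abs_le]; constructor <;> linarith
  have key : ∀ w, 0 < w → C * (1 + (L + w)) ^ (-(2 + γ)) * h w ≤ 1 / 2 * h2 w := by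
    intro w hw
    have e1 : (1 + (L + w)) ^ (-(2 + γ)) ≤ (1 + L) ^ (-(γ/2)) * (1 + w ^ 2) ^ (-a - 1) := by
      have x1 : (1 + (L + w)) ^ (-(2 + γ)) = (1 + (L + w)) ^ (-(γ/2)) * (1 + (L + w)) ^ (2 * (-a - 1)) := by
        rw [← Real.rpow_add (by linarith)]; congr 1; rw [ha]; ring
      rw [x1, Real.rpow_mul (by linarith), Real.rpow_two]
      refine mul_le_mul ?_ ?_ (Real.rpow_nonneg (by positivity) _) (Real.rpow_nonneg (by linarith) _)
      · exact Real.rpow_le_rpow_of_nonpos (by linarith) (by linarith) (by linarith)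
      · exact Real.rpow_le_rpow_of_nonpos (bp w) (by nlinarith) (by linarith)
    have e2 : a * (w * (1 + w ^ 2) ^ (-a - 1)) ≤ h2 w := by
      simp only [hh2]
      rw [pe (-a - 1) w, show -a - 1 - 1 = -a - 2 by ring]
      have y1 : a * (1 + w ^ 2) ≤ 6 * a * (1 + w ^ 2) - 4 * a * (a + 1) * w ^ 2 := by nlinarith [mul_nonneg ha0.le (sq_nonneg w)]
      have y2 : 0 ≤ w * (1 + w ^ 2) ^ (-a - 2) := mul_nonneg hw.le (rp _ _).le
      nlinarith
    have e3 := rp (-a - 1) w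
    calc _ ≤ C * ((1 + L) ^ (-(γ/2)) * (1 + w ^ 2) ^ (-a - 1)) * w :=
          mul_le_mul (mul_le_mul_of_nonneg_left e1 hC) (h_le w hw.le) (h_nn w hw.le) (by positivity)
      _ = (C * (1 + L) ^ (-(γ/2))) * (w * (1 + w ^ 2) ^ (-a - 1)) := by ring
      _ ≤ a / 2 * (w * (1 + w ^ 2) ^ (-a - 1)) := mul_le_mul_of_nonneg_right hL (by positivity)
      _ ≤ _ := by linarith
  have hb : ∀ w, 0 < w → |(|h w| + |h1 w|)| ≤ 2 * (1 + w) := fun w hw => by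
    rw [abs_of_nonneg (by positivity), abs_of_nonneg (h_nn w hw.le)]
    linarith [h_le w hw.le, h1_b w]
  have hb' : ∀ w, 0 < w → |h w| ≤ 2 * (1 + w) := fun w hw => by
    rw [abs_of_nonneg (h_nn w hw.le)]
    linarith [h_le w hw.le]
  refine ⟨∫ w in Ioi (0:ℝ), Wf u (Real.sqrt 2) L 2 w * h w, ?_, fun t ht => ?_⟩
  · refine setInt_pos (w0 := 1) ?_ ?_ (S.W_int H0 hL1 (by norm_num) le_rfl ch hb').1 one_pos ?_
    · exact ((S.Wf_cont _ L).comp (by fun_prop : Continuous (fun w : ℝ => ((2, w) : ℝ × ℝ)))).mul ch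
    · intro w hw
      exact mul_nonneg (S.Wf_nonneg _ _ _ _) (h_nn w hw.le)
    · refine mul_pos (mul_pos (Real.exp_pos _) (S.pos hx0 (by norm_num) _)) ?_
      have : (1 + (1:ℝ) ^ 2) ^ (-a) < 1 := Real.rpow_lt_one_of_one_lt_of_neg (by norm_num) (by linarith)
      simp only [hh]; linarith
  · have G := S.green_ineq (r := 2) (t := t) (l := L) (κ := Real.sqrt 2) (h := fun _ w => -h w) (hs := fun _ _ => 0)
      (hw := fun _ w => -h1 w) (hww := fun _ w => -h2 w) (b := fun _ => 0) (C1 := 2 * ((1 + 2 * Real.sqrt t) * N0 u)) (by norm_num) ht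
      (ch.comp continuous_snd).neg continuous_const (ch1.comp continuous_snd).neg (ch2.comp continuous_snd).neg
      (fun _ => by simp [hh]) ?_ ?_ ?_ ?_ (by simp) ?_
    · have z1 : ∫ s in (2:ℝ)..t, (1 / 2 * Wf u (Real.sqrt 2) L s 0 * -h1 0 + 0) = 0 := by
        have : h1 0 = 0 := by simp [hh1]
        simp [this]
      rw [z1] at G
      simp only [mul_neg, integral_neg] at G
      have i1 := (S.W_int H0 hL1 (by linarith : (0:ℝ) ≤ t) le_rfl ch hb').1
      have cmp : ∫ w in Ioi (0:ℝ), Wf u (Real.sqrt 2) L t w * h w ≤ M0 u t := by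
        have i0 : Integrable (fun w => max (L + w) 0 * Vf u t (L + w)) := (S.yV_int H0 (by linarith : 0 ≤ t)).comp_add_left L
        have nn : ∀ w, 0 ≤ max (L + w) 0 * Vf u t (L + w) := fun w => mul_nonneg (le_max_right _ _) (S.Vf_nonneg _ _)
        calc _ ≤ ∫ w in Ioi (0:ℝ), max (L + w) 0 * Vf u t (L + w) := by
              refine setIntegral_mono_on i1 i0.integrableOn measurableSet_Ioi fun w hw => ?_
              have hw0 : (0:ℝ) < w := hw
              rw [Wf_eq_Vf, mul_comm]
              refine mul_le_mul ((h_le w hw0.le).trans (le_max_of_le_left (by linarith))) ?_ (mul_nonneg (Real.exp_pos _).le (S.Vf_nonneg _ _)) (le_max_right _ _)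
              refine mul_le_of_le_one_left (S.Vf_nonneg _ _) ?_
              rw [Real.exp_le_one_iff]
              have := mul_nonneg sqrt2_pos.le hL1
              linarith
          _ ≤ ∫ w, max (L + w) 0 * Vf u t (L + w) := setIntegral_le_integral i0 (Eventually.of_forall nn)
          _ = _ := integral_add_left_eq_self (μ := volume) (fun z => max z 0 * Vf u t z) L
      linarith
    · intro s hs w
      have d0 : HasDerivAt (fun σ => w - Real.sqrt 2 * (σ - s)) (-Real.sqrt 2) s := by
        have := (((hasDerivAt_id' s).sub_const s).const_mul (Real.sqrt 2)).const_sub w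
        exact this.congr_deriv (by ring)
      have d1 : HasDerivAt h (h1 w) (w - Real.sqrt 2 * (s - s)) := by
        rw [sub_self, mul_zero, sub_zero]; exact dh w
      have := (HasDerivAt.comp s d1 d0).fun_neg
      exact this.congr_deriv (by ring)
    · intro s hs w
      exact (dh w).fun_neg
    · intro s hs w
      exact (dh1 w).fun_neg
    · intro s hs
      have := S.W_int H0 hL1 (by linarith [hs.1] : (0:ℝ) ≤ s) hs.2 (g := fun w => |h w| + |h1 w|) (ch.abs.add ch1.abs) hb
      simp only [abs_neg]
      refine ⟨this.1, ?_⟩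
      refine le_trans (le_of_eq ?_) this.2
      refine integral_congr_ae (Eventually.of_forall fun w => ?_)
      simp only
      rw [abs_of_nonneg (a := |h w| + |h1 w|) (by positivity)]
    · intro s hs
      refine ⟨fun _ => 0, fun _ _ => le_rfl, fun w hw => ?_, by simp, by simp⟩
      have v := hV s (by linarith [hs.1]) (L + w) (by linarith)
      set v0 := u s (L + Real.sqrt 2 * s + w) with hv0
      have e : Vf u s (L + w) = Real.exp (Real.sqrt 2 * (L + w)) * v0 := by
        unfold Vf; rw [hv0]; congr 2; ring
      have qb := hS (L + w) v0 (by linarith) (S.nonneg _ _) (S.le _ _) (by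
        rw [e] at v
        rw [Real.exp_neg, ← div_eq_mul_inv, le_div_iff₀ (Real.exp_pos _)]
        linarith)
      have k := key w hw
      unfold Sf Wf
      rw [← hv0]
      set E := Real.exp (Real.sqrt 2 * w + (Real.sqrt 2 ^ 2 / 2 - 1) * s)
      have hE : 0 < E := Real.exp_pos _
      have n0 := S.nonneg s (L + Real.sqrt 2 * s + w)
      rw [← hv0] at n0
      have t1 : E * q v0 * h w ≤ E * (C * (1 + (L + w)) ^ (-(2 + γ)) * v0) * h w :=
        mul_le_mul_of_nonneg_right (mul_le_mul_of_nonneg_left qb hE.le) (h_nn w hw.le)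
      have t2 : (E * v0) * (C * (1 + (L + w)) ^ (-(2 + γ)) * h w) ≤ (E * v0) * (1 / 2 * h2 w) :=
        mul_le_mul_of_nonneg_left k (by positivity)
      linarith

end Sol
end KPPB

namespace KPPB
namespace Sol
variable {u : ℝ → ℝ → ℝ} {q : ℝ → ℝ} {K Cq : ℝ}

lemma phi_bounds {A w : ℝ} (hA : 0 < A) (hw : 0 ≤ w) : 0 ≤ w ^ 3 / (w ^ 2 + A) ∧ w ^ 3 / (w ^ 2 + A) ≤ w := by
  refine ⟨by positivity, ?_⟩
  rw [div_le_iff₀ (by positivity)]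
  nlinarith

/-- evolution of the truncated moment -/
lemma phi_step (S : Sol u q K Cq) (H0 : FinMom u) {Mb A t : ℝ} (hM : ∀ s, 0 ≤ s → M0 u s ≤ Mb) (hA : 0 < A) (ht : 0 ≤ t) :
    ∫ w in Ioi (0:ℝ), Vf u t w * (w ^ 3 / (w ^ 2 + A)) ≤ (∫ w in Ioi (0:ℝ), Vf u 0 w * (w ^ 3 / (w ^ 2 + A))) + 3 * Mb * t / A := by
  have bp : ∀ w : ℝ, w ^ 2 + A ≠ 0 := fun w => by positivity
  have bq : ∀ w : ℝ, 0 < w ^ 2 + A := fun w => by positivity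
  set h : ℝ → ℝ := fun w => w ^ 3 / (w ^ 2 + A) with hh
  set h1 : ℝ → ℝ := fun w => (w ^ 4 + 3 * A * w ^ 2) / (w ^ 2 + A) ^ 2 with hh1
  set h2 : ℝ → ℝ := fun w => 2 * A * w * (3 * A - w ^ 2) / (w ^ 2 + A) ^ 3 with hh2
  have ch : Continuous h := by
    refine Continuous.div (by fun_prop) (by fun_prop) bp
  have ch1 : Continuous h1 := by
    refine Continuous.div (by fun_prop) (by fun_prop) (fun w => pow_ne_zero _ (bp w))
  have ch2 : Continuous h2 := by
    refine Continuous.div (by fun_prop) (by fun_prop) (fun w => pow_ne_zero _ (bp w))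
  have d0 : ∀ w : ℝ, HasDerivAt (fun w : ℝ => w ^ 2 + A) (2 * w) w := fun w => by
    have := ((hasDerivAt_id' w).fun_pow 2).add_const A
    exact this.congr_deriv (by simp)
  have dh : ∀ w, HasDerivAt h (h1 w) w := by
    intro w
    have := ((hasDerivAt_id' w).fun_pow 3).fun_div (d0 w) (bp w)
    refine this.congr_deriv ?_
    simp only [hh1]
    have := bp w
    field_simp
    push_cast
    ring
  have dh1 : ∀ w, HasDerivAt h1 (h2 w) w := by
    intro w
    have d1 : HasDerivAt (fun w : ℝ => w ^ 4 + 3 * A * w ^ 2) (4 * w ^ 3 + 6 * A * w) w := by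
      have := ((hasDerivAt_id' w).fun_pow 4).fun_add (((hasDerivAt_id' w).fun_pow 2).const_mul (3 * A))
      exact this.congr_deriv (by push_cast; ring)
    have := d1.fun_div ((d0 w).fun_pow 2) (pow_ne_zero _ (bp w))
    refine this.congr_deriv ?_
    simp only [hh2]
    have := bp w
    field_simp
    push_cast
    ring
  have h_nn : ∀ w, 0 ≤ w → 0 ≤ h w := fun w hw => (phi_bounds hA hw).1
  have h_le : ∀ w, 0 ≤ w → h w ≤ w := fun w hw => (phi_bounds hA hw).2
  have h1_b : ∀ w, |h1 w| ≤ 2 := fun w => by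
    have : 0 ≤ h1 w := by simp only [hh1]; positivity
    rw [abs_of_nonneg this]
    simp only [hh1]
    rw [div_le_iff₀ (by positivity)]
    nlinarith [mul_nonneg hA.le (sq_nonneg w), sq_nonneg (w ^ 2), sq_nonneg A]
  have h2_le : ∀ w, 0 ≤ w → 1 / 2 * h2 w ≤ 3 / A * w := by
    intro w hw
    simp only [hh2]
    have e1 : 2 * A * w * (3 * A - w ^ 2) / (w ^ 2 + A) ^ 3 ≤ 2 * A * w * (3 * A) / A ^ 3 := by
      refine div_le_div₀ (by positivity) ?_ (by positivity) ?_
      · have : 0 ≤ 2 * A * w := by positivity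
        nlinarith [sq_nonneg w]
      · exact pow_le_pow_left₀ hA.le (by nlinarith [sq_nonneg w]) 3
    have e2 : 2 * A * w * (3 * A) / A ^ 3 = 2 * (3 / A * w) := by field_simp
    linarith
  have hb : ∀ w, 0 < w → |(|h w| + |h1 w|)| ≤ 2 * (1 + w) := fun w hw => by
    rw [abs_of_nonneg (by positivity), abs_of_nonneg (h_nn w hw.le)]
    linarith [h_le w hw.le, h1_b w]
  have iw : ∀ s, 0 ≤ s → IntegrableOn (fun w => Vf u s w * w) (Ioi 0) := fun s hs => by
    have := (S.W_int H0 (le_refl 0) hs le_rfl (g := fun w => w) continuous_id (fun w hw => by rw [abs_of_pos hw]; linarith)).1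
    simpa only [Wf_zero_eq_Vf] using this
  have G := S.green_ineq (r := 0) (t := t) (l := 0) (κ := Real.sqrt 2) (h := fun _ w => h w) (hs := fun _ _ => 0)
      (hw := fun _ w => h1 w) (hww := fun _ w => h2 w) (b := fun _ => 3 / A * Mb) (C1 := 2 * ((1 + 2 * Real.sqrt t) * N0 u)) le_rfl ht
      (ch.comp continuous_snd) continuous_const (ch1.comp continuous_snd) (ch2.comp continuous_snd)
      (fun _ => by simp [hh]) ?_ ?_ ?_ ?_ (by simp) ?_
  · have z1 : ∫ s in (0:ℝ)..t, (1 / 2 * Wf u (Real.sqrt 2) 0 s 0 * h1 0 + 3 / A * Mb) = 3 * Mb * t / A := by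
      have : h1 0 = 0 := by simp [hh1]
      simp only [this, mul_zero, zero_add, intervalIntegral.integral_const, smul_eq_mul, sub_zero]
      ring
    rw [z1] at G
    simp only [Wf_zero_eq_Vf] at G
    linarith
  · intro s hs w
    have d0 : HasDerivAt (fun σ => w - Real.sqrt 2 * (σ - s)) (-Real.sqrt 2) s := by
      have := (((hasDerivAt_id' s).sub_const s).const_mul (Real.sqrt 2)).const_sub w
      exact this.congr_deriv (by ring)
    have d1 : HasDerivAt h (h1 w) (w - Real.sqrt 2 * (s - s)) := by
      rw [sub_self, mul_zero, sub_zero]; exact dh w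
    have := (HasDerivAt.comp s d1 d0)
    exact this.congr_deriv (by ring)
  · intro s hs w
    exact (dh w)
  · intro s hs w
    exact (dh1 w)
  · intro s hs
    have := S.W_int H0 (le_refl 0) hs.1 hs.2 (g := fun w => |h w| + |h1 w|) (ch.abs.add ch1.abs) hb
    refine ⟨this.1, ?_⟩
    refine le_trans (le_of_eq ?_) this.2
    refine integral_congr_ae (Eventually.of_forall fun w => ?_)
    simp only
    rw [abs_of_nonneg (a := |h w| + |h1 w|) (by positivity)]
  · intro s hs
    refine ⟨fun w => 3 / A * (Vf u s w * w), fun w hw => ?_, fun w hw => ?_, (iw s hs.1.le).const_mul _, ?_⟩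
    · have := S.Vf_nonneg s w
      positivity
    · have k := h2_le w hw.le
      have n1 := S.Vf_nonneg s w
      have n2 := mul_nonneg (S.Sf_nonneg (Real.sqrt 2) 0 s w) (h_nn w hw.le)
      rw [Wf_zero_eq_Vf, zero_add]
      have := mul_le_mul_of_nonneg_left k n1
      linarith
    · rw [integral_const_mul, M0_eq]
      exact mul_le_mul_of_nonneg_left (hM s hs.1.le) (by positivity)

lemma phi_zero (S : Sol u q K Cq) (H0 : FinMom u) {ε : ℝ} (hε : 0 < ε) : ∃ A0, 1 ≤ A0 ∧ ∀ A, A0 ≤ A →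
    ∫ w in Ioi (0:ℝ), Vf u 0 w * (w ^ 3 / (w ^ 2 + A)) ≤ ε := by
  have iw : IntegrableOn (fun w => Vf u 0 w * w) (Ioi 0) := by
    have := (S.W_int H0 (le_refl 0) le_rfl le_rfl (s := 0) (g := fun w => w) continuous_id (fun w hw => by rw [abs_of_pos hw]; linarith)).1
    simpa only [Wf_zero_eq_Vf] using this
  have T : Tendsto (fun A : ℝ => ∫ w in Ioi (0:ℝ), Vf u 0 w * (w ^ 3 / (w ^ 2 + A))) atTop (𝓝 (∫ w in Ioi (0:ℝ), (0:ℝ))) := by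
    refine tendsto_integral_filter_of_dominated_convergence (fun w => Vf u 0 w * w) ?_ ?_ iw ?_
    · filter_upwards [eventually_gt_atTop 0] with A hA
      refine Continuous.aestronglyMeasurable ((S.Vf_cont' 0).mul ?_)
      exact Continuous.div (by fun_prop) (by fun_prop) (fun w => by positivity)
    · filter_upwards [eventually_gt_atTop 0] with A hA
      refine (ae_restrict_iff' measurableSet_Ioi).mpr (Eventually.of_forall fun w hw => ?_)
      have p := phi_bounds hA (le_of_lt hw)
      have v := S.Vf_nonneg 0 w
      rw [Real.norm_eq_abs, abs_of_nonneg (mul_nonneg v p.1)]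
      exact mul_le_mul_of_nonneg_left p.2 v
    · refine Eventually.of_forall fun w => ?_
      have t1 : Tendsto (fun A : ℝ => w ^ 2 + A) atTop atTop := tendsto_atTop_add_const_left _ _ tendsto_id
      have := (t1.const_div_atTop (w ^ 3)).const_mul (Vf u 0 w)
      rwa [mul_zero] at this
  rw [integral_zero] at T
  obtain ⟨B, hB⟩ := eventually_atTop.mp (T.eventually_lt_const hε)
  exact ⟨max B 1, le_max_right _ _, fun A hA => (hB A ((le_max_left _ _).trans hA)).le⟩

/-- the first moment lives at scale `√r` -/
theorem mass_window (S : Sol u q K Cq) (H0 : FinMom u) {x0 γ : ℝ} (hx0 : 0 < u 0 x0) (hγ : 0 < γ) (hγ1 : γ ≤ 1/2) (hq : QDec q K γ) :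
    ∃ ρ R c, 0 < ρ ∧ ρ ≤ 1 ∧ 1 ≤ R ∧ 0 < c ∧ ∀ r, 2 ≤ r →
      c ≤ ∫ y in Ioc (ρ * Real.sqrt r) (R * Real.sqrt r), Vf u r y * y := by
  obtain ⟨c0, hc0, hlow⟩ := S.M0_lower H0 hx0 hγ hγ1 hq
  obtain ⟨Mb, hMb, hM⟩ := S.M0_bdd H0
  obtain ⟨A, hA, hap⟩ := S.apriori H0
  obtain ⟨A0, hA0, hphi⟩ := S.phi_zero H0 (ε := c0 / 16) (by positivity)
  -- choose R
  set R := 1 + A0 + 48 * Mb / c0 with hR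
  have hR1 : 1 + A0 ≤ R := by
    have : 0 ≤ 48 * Mb / c0 := by positivity
    linarith
  have hR2 : 3 * Mb / R ^ 2 ≤ c0 / 16 := by
    have e1 : 48 * Mb / c0 ≤ R := by linarith
    rw [div_le_iff₀ hc0] at e1
    rw [div_le_iff₀ (by nlinarith)]
    nlinarith
  set ρ := min 1 (c0 / (136 * A)) with hρ
  have hρ0 : 0 < ρ := by rw [hρ]; positivity
  have hρ1 : ρ ≤ 1 := min_le_left _ _
  have hρ2 : 34 * A * ρ ^ 2 ≤ c0 / 4 := by
    have e1 : ρ ≤ c0 / (136 * A) := min_le_right _ _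
    rw [le_div_iff₀ (by positivity)] at e1
    have : ρ ^ 2 ≤ ρ := by nlinarith
    nlinarith
  refine ⟨ρ, R, c0 / 4, hρ0, hρ1, by linarith, by positivity, fun r hr => ?_⟩
  set Q := Real.sqrt r with hQ
  have hQ1 : 1 ≤ Q := by rw [hQ, Real.one_le_sqrt]; linarith
  have hQ2 : Q ^ 2 = r := Real.sq_sqrt (by linarith)
  have r0 : 0 < r := by linarith
  have ab : ρ * Q ≤ R * Q := by
    have : ρ ≤ R := by linarith
    gcongr
  have iw : IntegrableOn (fun w => Vf u r w * w) (Ioi 0) := by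
    have := (S.W_int H0 (le_refl 0) r0.le le_rfl (g := fun w => w) continuous_id (fun w hw => by rw [abs_of_pos hw]; linarith)).1
    simpa only [Wf_zero_eq_Vf] using this
  have ρQ : 0 < ρ * Q := by positivity
  have s1 : Ioi (0:ℝ) = Ioc 0 (ρ * Q) ∪ (Ioc (ρ * Q) (R * Q) ∪ Ioi (R * Q)) := by
    rw [Ioc_union_Ioi_eq_Ioi ab, Ioc_union_Ioi_eq_Ioi ρQ.le]
  have split : M0 u r = (∫ w in Ioc 0 (ρ * Q), Vf u r w * w) + ((∫ w in Ioc (ρ * Q) (R * Q), Vf u r w * w) + ∫ w in Ioi (R * Q), Vf u r w * w) := by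
    rw [← M0_eq, s1, setIntegral_union, setIntegral_union]
    · exact Ioc_disjoint_Ioi le_rfl
    · exact measurableSet_Ioi
    · exact iw.mono_set (fun x hx => lt_trans ρQ hx.1)
    · exact iw.mono_set (fun x hx => lt_of_lt_of_le ρQ (ab.trans (le_of_lt hx)))
    · rw [Ioc_union_Ioi_eq_Ioi ab]
      exact Ioc_disjoint_Ioi le_rfl
    · rw [Ioc_union_Ioi_eq_Ioi ab]; exact measurableSet_Ioi
    · exact iw.mono_set (fun x hx => hx.1)
    · rw [Ioc_union_Ioi_eq_Ioi ab]
      exact iw.mono_set (fun x hx => lt_trans ρQ hx)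
  -- small part
  have small : ∫ w in Ioc 0 (ρ * Q), Vf u r w * w ≤ c0 / 4 := by
    have cv : Continuous (fun w => Vf u r w * w) := (S.Vf_cont' r).mul continuous_id
    have lg := log_small (by linarith : 1 ≤ r)
    have lg2 : r ^ (1/16 : ℝ) ≤ Q := by
      rw [hQ, Real.sqrt_eq_rpow]
      exact Real.rpow_le_rpow_of_exponent_le (by linarith) (by norm_num)
    have l0 : 0 ≤ aa * Real.log r := mul_nonneg aa_pos.le (Real.log_nonneg (by linarith))
    have r32 : r ^ (-(3/2) : ℝ) * Q ^ 3 = 1 := by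
      rw [hQ, Real.sqrt_eq_rpow, ← Real.rpow_natCast, ← Real.rpow_mul r0.le, ← Real.rpow_add r0]
      norm_num
    have pb : ∀ w ∈ Ioc 0 (ρ * Q), Vf u r w * w ≤ A * r ^ (-(3/2) : ℝ) * (34 * Q) * (ρ * Q) := by
      intro w hw
      have hw0 := hw.1
      have hw1 := hw.2
      refine mul_le_mul ((hap r hr w).trans ?_) hw1 hw0.le (by positivity)
      refine mul_le_mul_of_nonneg_left ?_ (by positivity)
      rw [max_eq_left (by linarith)]
      nlinarith
    calc _ ≤ ∫ w in Ioc 0 (ρ * Q), A * r ^ (-(3/2) : ℝ) * (34 * Q) * (ρ * Q) := by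
          refine setIntegral_mono_on (cv.integrableOn_Ioc) (continuous_const.integrableOn_Ioc) measurableSet_Ioc pb
      _ = 34 * A * ρ ^ 2 * (r ^ (-(3/2) : ℝ) * Q ^ 3) := by
          rw [setIntegral_const]
          simp only [measureReal_def, Real.volume_Ioc, smul_eq_mul, sub_zero]
          rw [ENNReal.toReal_ofReal ρQ.le]; ring
      _ ≤ _ := by rw [r32, mul_one]; exact hρ2
  -- large part
  have large : ∫ w in Ioi (R * Q), Vf u r w * w ≤ c0 / 4 := by
    have RQ : 0 < R * Q := by nlinarith
    set B := R ^ 2 * r with hB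
    have RR : R ≤ R ^ 2 := by nlinarith
    have hBA : A0 ≤ B := by rw [hB]; nlinarith
    have hB0 : 0 < B := by linarith
    have ps := S.phi_step H0 hM hB0 r0.le
    have pz := hphi B hBA
    have e1 : 3 * Mb * r / B = 3 * Mb / R ^ 2 := by
      rw [hB, mul_div_mul_right _ _ r0.ne']
    rw [e1] at ps
    have ip : IntegrableOn (fun w => Vf u r w * (w ^ 3 / (w ^ 2 + B))) (Ioi 0) := by
      have := (S.W_int H0 (le_refl 0) r0.le le_rfl (g := fun w => w ^ 3 / (w ^ 2 + B)) (Continuous.div (by fun_prop) (by fun_prop) (fun w => by positivity)) (fun w hw => by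
        have := phi_bounds hB0 hw.le
        rw [abs_of_nonneg this.1]; linarith)).1
      simpa only [Wf_zero_eq_Vf] using this
    calc _ ≤ ∫ w in Ioi (R * Q), 2 * (Vf u r w * (w ^ 3 / (w ^ 2 + B))) := by
          refine setIntegral_mono_on (iw.mono_set fun x hx => lt_trans RQ hx) ((ip.mono_set fun x hx => lt_trans RQ hx).const_mul 2) measurableSet_Ioi fun w hw => ?_
          have hw' : R * Q < w := hw
          have v := S.Vf_nonneg r w
          have : w ≤ 2 * (w ^ 3 / (w ^ 2 + B)) := by
            have w0 : 0 < w := by linarith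
            have : B ≤ w ^ 2 := by
              rw [hB, ← hQ2, ← mul_pow]
              exact pow_le_pow_left₀ RQ.le hw'.le 2
            rw [← mul_div_assoc, le_div_iff₀ (by positivity)]
            nlinarith
          have := mul_le_mul_of_nonneg_left this v
          linarith
      _ = 2 * ∫ w in Ioi (R * Q), (Vf u r w * (w ^ 3 / (w ^ 2 + B))) := integral_const_mul _ _
      _ ≤ 2 * ∫ w in Ioi (0:ℝ), (Vf u r w * (w ^ 3 / (w ^ 2 + B))) := by
          refine mul_le_mul_of_nonneg_left ?_ (by norm_num)
          refine setIntegral_mono_set ip ((ae_restrict_iff' measurableSet_Ioi).mpr (Eventually.of_forall fun w hw => ?_)) (Eventually.of_forall fun x hx => lt_trans RQ hx)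
          exact mul_nonneg (S.Vf_nonneg _ _) (phi_bounds hB0 (le_of_lt hw)).1
      _ ≤ _ := by linarith
  have := hlow r hr
  linarith

end Sol
end KPPB

namespace KPPB

lemma split_int {f : ℝ → ℝ} {P X θ γ δ C1 : ℝ} (hX : 1 ≤ X) (hθ : 0 < θ) (hθ1 : θ ≤ 1)
    (hγ : 0 < γ) (hγ1 : γ ≤ 1/2) (hδ : δ = γ / 12) (hf : ∀ w, 0 < w → 0 ≤ f w) (hi : IntegrableOn f (Ioi 0))
    (hfc : AEStronglyMeasurable f (volume.restrict (Ioi 0))) (hC1 : 0 ≤ C1) (hP : 0 ≤ P)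
    (hm : ∫ w in Ioi (0:ℝ), f w ≤ 2 * P)
    (hn : ∀ w, 0 < w → w ≤ θ * Real.sqrt X → f w ≤ C1 * P * X ^ (-(3/2) + δ) * (1 + w) ^ 2) :
    IntegrableOn (fun w => (1 + w) ^ (-(2 + γ)) * f w) (Ioi 0) ∧
      ∫ w in Ioi (0:ℝ), (1 + w) ^ (-(2 + γ)) * f w ≤ (C1 + 2 * (θ ^ 3)⁻¹) * P * X ^ (-(1 + δ)) := by
  have X0 : 0 < X := by linarith
  have hδ0 : 0 < δ := by rw [hδ]; positivity
  set w1 := θ * X ^ (1/2 - 2 * δ) with hw1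
  have w10 : 0 < w1 := by positivity
  have w1le : w1 ≤ θ * Real.sqrt X := by
    rw [hw1, Real.sqrt_eq_rpow]
    exact mul_le_mul_of_nonneg_left (Real.rpow_le_rpow_of_exponent_le hX (by linarith)) hθ.le
  have r1 : ∀ w : ℝ, 0 < w → (1 + w) ^ (-(2 + γ)) ≤ 1 := fun w hw =>
    Real.rpow_le_one_of_one_le_of_nonpos (by linarith) (by linarith)
  have r2 : ∀ w : ℝ, 0 < w → (1 + w) ^ 2 * (1 + w) ^ (-(2 + γ)) ≤ 1 := fun w hw => by
    rw [← Real.rpow_two, ← Real.rpow_add (by linarith)]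
    exact Real.rpow_le_one_of_one_le_of_nonpos (by linarith) (by linarith)
  have rp : ∀ w : ℝ, 0 < w → 0 ≤ (1 + w) ^ (-(2 + γ)) := fun w hw => Real.rpow_nonneg (by linarith) _
  have mr : AEStronglyMeasurable (fun w : ℝ => (1 + w) ^ (-(2 + γ))) (volume.restrict (Ioi 0)) :=
    (Measurable.pow_const (by fun_prop) _).aestronglyMeasurable
  have i1 : IntegrableOn (fun w => (1 + w) ^ (-(2 + γ)) * f w) (Ioi 0) := by
    refine Integrable.mono' hi (mr.mul hfc) ?_
    refine (ae_restrict_iff' measurableSet_Ioi).mpr (Eventually.of_forall fun w hw => ?_)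
    rw [Real.norm_eq_abs, abs_of_nonneg (mul_nonneg (rp w hw) (hf w hw))]
    exact mul_le_of_le_one_left (hf w hw) (r1 w hw)
  refine ⟨i1, ?_⟩
  set T := w1 ^ (-(2 + γ)) with hT
  have hT0 : 0 ≤ T := by positivity
  set N := C1 * P * X ^ (-(3/2) + δ) with hN
  have hN0 : 0 ≤ N := by positivity
  have i2 : IntegrableOn (indicator (Ioc 0 w1) (fun _ => N)) (Ioi 0) := by
    refine Integrable.integrableOn ?_
    rw [integrable_indicator_iff measurableSet_Ioc]
    exact continuous_const.integrableOn_Ioc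
  have i3 : IntegrableOn (fun w => T * f w) (Ioi 0) := hi.const_mul T
  have pt : ∀ w ∈ Ioi (0:ℝ), (1 + w) ^ (-(2 + γ)) * f w ≤ indicator (Ioc 0 w1) (fun _ => N) w + T * f w := by
    intro w hw
    have hw0 : (0:ℝ) < w := hw
    have f0 := hf w hw0
    rcases le_or_gt w w1 with h | h
    · rw [indicator_of_mem (show w ∈ Ioc 0 w1 from ⟨hw0, h⟩)]
      have a1 := hn w hw0 (h.trans w1le)
      have a2 := mul_le_mul_of_nonneg_left a1 (rp w hw0)
      have a3 := mul_le_mul_of_nonneg_left (r2 w hw0) hN0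
      have a4 := mul_nonneg hT0 f0
      linarith
    · rw [indicator_of_notMem (fun hh => absurd hh.2 (not_le.mpr h)), zero_add]
      refine mul_le_mul_of_nonneg_right ?_ f0
      exact Real.rpow_le_rpow_of_nonpos w10 (by linarith) (by linarith)
  have e1 : ∫ w in Ioi (0:ℝ), indicator (Ioc 0 w1) (fun _ => N) w = w1 * N := by
    rw [setIntegral_indicator measurableSet_Ioc]
    have : Ioi (0:ℝ) ∩ Ioc 0 w1 = Ioc 0 w1 := inter_eq_right.mpr fun x hx => hx.1
    rw [this, setIntegral_const]
    simp only [measureReal_def, Real.volume_Ioc, smul_eq_mul, sub_zero]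
    rw [ENNReal.toReal_ofReal w10.le]
  have e2 : w1 * N ≤ C1 * P * X ^ (-(1 + δ)) := by
    have : X ^ (1/2 - 2 * δ) * X ^ (-(3/2) + δ) = X ^ (-(1 + δ)) := by
      rw [← Real.rpow_add X0]; congr 1; ring
    rw [← this, hw1, hN]
    have : 0 ≤ C1 * P * (X ^ (1/2 - 2 * δ) * X ^ (-(3/2) + δ)) := by positivity
    nlinarith
  have e3 : T ≤ (θ ^ 3)⁻¹ * X ^ (-(1 + δ)) := by
    rw [hT, hw1, Real.mul_rpow hθ.le (by positivity), ← Real.rpow_mul X0.le]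
    refine mul_le_mul ?_ ?_ (by positivity) (by positivity)
    · rw [← Real.rpow_natCast, ← Real.rpow_neg hθ.le]
      exact Real.rpow_le_rpow_of_exponent_ge hθ hθ1 (by push_cast; linarith)
    · refine Real.rpow_le_rpow_of_exponent_le hX ?_
      rw [hδ]; nlinarith
  calc _ ≤ ∫ w in Ioi (0:ℝ), (indicator (Ioc 0 w1) (fun _ => N) w + T * f w) :=
        setIntegral_mono_on i1 (i2.add i3) measurableSet_Ioi pt
    _ = w1 * N + T * ∫ w in Ioi (0:ℝ), f w := by
        rw [integral_add i2 i3, e1, integral_const_mul]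
    _ ≤ C1 * P * X ^ (-(1 + δ)) + ((θ ^ 3)⁻¹ * X ^ (-(1 + δ))) * (2 * P) := by
        refine add_le_add e2 ?_
        exact (mul_le_mul_of_nonneg_left hm hT0).trans (mul_le_mul_of_nonneg_right e3 (by linarith))
    _ = _ := by ring

lemma late_exp {τ τ0 r w w' : ℝ} (hτ : 0 < τ) (h : 2 * τ ≤ τ0) (hr : 0 < r) (hw : 0 ≤ w) (hw2 : w ^ 2 ≤ τ + r ^ 2)
    (hw' : 9 * r ≤ w') :
    τ ^ (-(3/2) : ℝ) * Real.exp (-((w - w') ^ 2 / (2 * τ))) ≤ 16 * (τ + r ^ 2) ^ (-(3/2) : ℝ) * Real.exp (-(w' ^ 2 / (2 * τ0))) := by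
  have a1 := rpow_exp_le hτ (A := w' ^ 2 / 10) (by positivity)
  have a2 : (τ + w' ^ 2 / 10) ^ (-(3/2) : ℝ) ≤ (τ + r ^ 2) ^ (-(3/2) : ℝ) :=
    Real.rpow_le_rpow_of_nonpos (by positivity) (by nlinarith) (by norm_num)
  have a3 : Real.exp 2 ≤ 8 := by
    have := Real.exp_one_lt_d9
    have e : Real.exp 2 = Real.exp 1 ^ 2 := by rw [← Real.exp_nat_mul]; norm_num
    rw [e]
    have := Real.exp_pos 1
    nlinarith
  have a4 : Real.exp (-((w - w') ^ 2 / (2 * τ))) ≤ Real.exp 2 * Real.exp (-(w' ^ 2 / (2 * τ0))) * Real.exp (-(w' ^ 2 / 10 / τ)) := by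
    rw [← Real.exp_add, ← Real.exp_add, Real.exp_le_exp]
    have b1 : w' ^ 2 / (2 * τ0) ≤ w' ^ 2 / (4 * τ) := by
      exact div_le_div_of_nonneg_left (by positivity) (by positivity) (by linarith)
    have b2 : w' ^ 2 / (4 * τ) + w' ^ 2 / 10 / τ ≤ 2 + (w - w') ^ 2 / (2 * τ) := by
      have e1 : w' ^ 2 / (4 * τ) + w' ^ 2 / 10 / τ = (7 / 20 * w' ^ 2) / τ := by field_simp; ring
      have e2 : 2 + (w - w') ^ 2 / (2 * τ) = (2 * τ + (w - w') ^ 2 / 2) / τ := by field_simp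
      rw [e1, e2]
      gcongr
      nlinarith [sq_nonneg (w' - 4 * w)]
    linarith
  calc _ ≤ τ ^ (-(3/2) : ℝ) * (Real.exp 2 * Real.exp (-(w' ^ 2 / (2 * τ0))) * Real.exp (-(w' ^ 2 / 10 / τ))) := by gcongr
    _ = Real.exp 2 * Real.exp (-(w' ^ 2 / (2 * τ0))) * (τ ^ (-(3/2) : ℝ) * Real.exp (-(w' ^ 2 / 10 / τ))) := by ring
    _ ≤ 8 * Real.exp (-(w' ^ 2 / (2 * τ0))) * (2 * (τ + r ^ 2) ^ (-(3/2) : ℝ)) := by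
        refine mul_le_mul (mul_le_mul_of_nonneg_right a3 (by positivity)) (a1.trans ?_) (by positivity) (by positivity)
        linarith
    _ = _ := by ring

lemma pk_div {τ x : ℝ} (hτ : 0 < τ) : 1 / τ * pk τ x = (Real.sqrt (2 * Real.pi))⁻¹ * (τ ^ (-(3/2) : ℝ) * Real.exp (-(x ^ 2 / (2 * τ)))) := by
  rw [pk_eq hτ]
  have : τ ^ (-(3/2) : ℝ) = 1 / τ * τ ^ (-(1/2) : ℝ) := by
    rw [show (-(3/2) : ℝ) = -1 + -(1/2) by norm_num, Real.rpow_add hτ, Real.rpow_neg_one]; simp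
  rw [this]; ring

lemma pk_mul {τ x : ℝ} (hτ : 0 < τ) : 1 / τ * pk τ x * τ ^ (3/2 : ℝ) = (Real.sqrt (2 * Real.pi))⁻¹ * Real.exp (-(x ^ 2 / (2 * τ))) := by
  rw [pk_div hτ]
  have : τ ^ (-(3/2) : ℝ) * τ ^ (3/2 : ℝ) = 1 := by
    rw [← Real.rpow_add hτ]; norm_num
  linear_combination (Real.sqrt (2 * Real.pi))⁻¹ * Real.exp (-(x ^ 2 / (2 * τ))) * this

lemma late_pk {τ τ0 r w w' : ℝ} (hτ : 0 < τ) (h : 2 * τ ≤ τ0) (hr : 0 < r) (hw : 0 ≤ w) (hw2 : w ^ 2 ≤ τ + r ^ 2)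
    (hw' : 9 * r ≤ w') :
    1 / τ * pk τ (w - w') ≤ 16 * (1 / τ0 * pk τ0 w') * τ0 ^ (3/2 : ℝ) * (τ + r ^ 2) ^ (-(3/2) : ℝ) := by
  have a := late_exp hτ h hr hw hw2 hw'
  rw [pk_div hτ]
  have e := pk_mul (τ := τ0) (x := w') (by linarith)
  have : 0 ≤ (Real.sqrt (2 * Real.pi))⁻¹ := by positivity
  have b := mul_le_mul_of_nonneg_left a this
  refine b.trans (le_of_eq ?_)
  linear_combination (-16) * (τ + r ^ 2) ^ (-(3/2) : ℝ) * e

lemma kk_le_mul {τ w w' : ℝ} (hτ : 0 < τ) : kk τ w w' ≤ 2 * w * w' * (1 / τ * pk τ (w - w')) := by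
  rw [kk_eq hτ]
  have := Real.add_one_le_exp (-(2 * w * w' / τ))
  have p := pk_pos hτ (w - w')
  calc _ ≤ pk τ (w - w') * (2 * w * w' / τ) := mul_le_mul_of_nonneg_left (by linarith) p.le
    _ = _ := by ring

lemma kk_sinh {τ w w' : ℝ} (hτ : 0 < τ) : kk τ w w' = pk τ w' * Real.exp (-(w ^ 2 / (2 * τ))) * (2 * Real.sinh (w * w' / τ)) := by
  unfold kk
  rw [pk_eq hτ, pk_eq hτ, pk_eq hτ, Real.sinh_eq]
  have e1 : Real.exp (-((w - w') ^ 2 / (2 * τ))) = Real.exp (-(w' ^ 2 / (2 * τ))) * Real.exp (-(w ^ 2 / (2 * τ))) * Real.exp (w * w' / τ) := by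
    rw [← Real.exp_add, ← Real.exp_add]; congr 1; field_simp; ring
  have e2 : Real.exp (-((w + w') ^ 2 / (2 * τ))) = Real.exp (-(w' ^ 2 / (2 * τ))) * Real.exp (-(w ^ 2 / (2 * τ))) * Real.exp (-(w * w' / τ)) := by
    rw [← Real.exp_add, ← Real.exp_add]; congr 1; field_simp; ring
  rw [e1, e2]; ring

lemma sinh_le_mul {x : ℝ} : Real.sinh x ≤ x * Real.exp x := by
  rw [Real.sinh_eq]
  have := Real.add_one_le_exp (-(2 * x))
  have e : Real.exp (-x) = Real.exp x * Real.exp (-(2 * x)) := by rw [← Real.exp_add]; congr 1; ring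
  rw [e]
  have := Real.exp_pos x
  nlinarith

lemma sinh_conv {x y : ℝ} (hx : 0 ≤ x) (hxy : x ≤ y) : y * Real.sinh x ≤ x * Real.sinh y := by
  have cv : ConvexOn ℝ (Ici (0:ℝ)) Real.sinh := by
    refine convexOn_of_deriv2_nonneg (convex_Ici 0) Real.continuous_sinh.continuousOn Real.differentiable_sinh.differentiableOn ?_ ?_
    · rw [Real.deriv_sinh]; exact Real.differentiable_cosh.differentiableOn
    · intro x hx
      rw [interior_Ici] at hx
      simp only [Function.iterate_succ, Function.iterate_zero, Function.comp_apply, id, Real.deriv_sinh, Real.deriv_cosh]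
      exact Real.sinh_nonneg_iff.mpr (le_of_lt hx)
  rcases hx.eq_or_lt with h | h
  · rw [← h]; simp
  have y0 : 0 < y := by linarith
  have := cv.2 (show (0:ℝ) ∈ Ici 0 from le_refl (0:ℝ)) (show y ∈ Ici (0:ℝ) from y0.le)
    (show 0 ≤ 1 - x / y by rw [sub_nonneg, div_le_one y0]; exact hxy) (show 0 ≤ x / y by positivity) (by ring)
  simp only [smul_eq_mul, mul_zero, zero_add, Real.sinh_zero] at this
  rw [div_mul_cancel₀ _ y0.ne'] at this
  calc _ ≤ y * (x / y * Real.sinh y) := mul_le_mul_of_nonneg_left this y0.le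
    _ = _ := by field_simp

lemma early_pk {τ τ0 w' : ℝ} (hτ : 0 < τ) (h : τ0 ≤ 2 * τ) (h1 : τ ≤ τ0) :
    pk τ w' ≤ 2 * pk τ0 w' * Real.exp (-((w' / τ0) ^ 2 * (τ0 / τ) * (τ0 - τ) / 2)) := by
  have h0 : 0 < τ0 := by linarith
  rw [pk_eq hτ, pk_eq h0]
  have e : Real.exp (-(w' ^ 2 / (2 * τ))) = Real.exp (-(w' ^ 2 / (2 * τ0))) * Real.exp (-((w' / τ0) ^ 2 * (τ0 / τ) * (τ0 - τ) / 2)) := by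
    rw [← Real.exp_add]; congr 1; field_simp; ring
  have a : τ ^ (-(1/2) : ℝ) ≤ 2 * τ0 ^ (-(1/2) : ℝ) := by
    calc τ ^ (-(1/2) : ℝ) ≤ (4⁻¹ * τ0) ^ (-(1/2) : ℝ) := Real.rpow_le_rpow_of_nonpos (by positivity) (by linarith) (by norm_num)
      _ = (4⁻¹ : ℝ) ^ (-(1/2) : ℝ) * τ0 ^ (-(1/2) : ℝ) := Real.mul_rpow (by norm_num) h0.le
      _ = _ := by
        congr 1
        rw [show (4⁻¹ : ℝ) = 2 ^ (-2 : ℝ) by rw [Real.rpow_neg (by norm_num)]; norm_num, ← Real.rpow_mul (by norm_num)]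
        norm_num
  rw [e]
  have : 0 ≤ (Real.sqrt (2 * Real.pi))⁻¹ * (Real.exp (-(w' ^ 2 / (2 * τ0))) * Real.exp (-((w' / τ0) ^ 2 * (τ0 / τ) * (τ0 - τ) / 2))) := by positivity
  have := mul_le_mul_of_nonneg_right a this
  linarith

set_option maxHeartbeats 1000000 in
lemma early_kk {r ρ τ τ0 w w' : ℝ} (hr : 0 < r) (hρ : 0 < ρ) (hρ1 : ρ ≤ 1) (hτ : 0 < τ) (h : τ0 ≤ 2 * τ) (h1 : τ ≤ τ0)
    (hw' : 0 < w') (hw : 0 < w) (hws : w ≤ ρ / 4 * Real.sqrt (r + (τ0 - τ))) :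
    kk τ w w' ≤ 32 / ρ * w * (pk τ0 w' * (Real.sinh (w' / τ0 * (ρ * Real.sqrt r)) / Real.sqrt r)) := by
  have h0 : 0 < τ0 := by linarith
  set μ := w' / τ0 with hμ
  have hμ0 : 0 < μ := by positivity
  set Q := Real.sqrt r with hQ
  have hQ0 : 0 < Q := Real.sqrt_pos.mpr hr
  have hQ2 : Q ^ 2 = r := Real.sq_sqrt hr.le
  set l := τ0 / τ with hl
  have hl1 : 1 ≤ l := by rw [hl, one_le_div hτ]; exact h1
  have hl2 : l ≤ 2 := by rw [hl, div_le_iff₀ hτ]; exact h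
  have ek := early_pk (w' := w') hτ h h1
  rw [← hμ, ← hl] at ek
  set p0 := pk τ0 w' with hp0
  have p00 : 0 < p0 := pk_pos h0 _
  have e0 : w * w' / τ = l * μ * w := by rw [hl, hμ]; field_simp
  have k1 : kk τ w w' ≤ 2 * p0 * Real.exp (-(μ ^ 2 * l * (τ0 - τ) / 2)) * (2 * Real.sinh (l * μ * w)) := by
    rw [kk_sinh hτ, e0]
    have s0 : 0 ≤ Real.sinh (l * μ * w) := Real.sinh_nonneg_iff.mpr (by positivity)
    refine mul_le_mul_of_nonneg_right ?_ (by positivity)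
    refine (mul_le_of_le_one_right (pk_pos hτ _).le ?_).trans ek
    rw [Real.exp_le_one_iff]
    have : 0 ≤ w ^ 2 / (2 * τ) := by positivity
    linarith
  set Z := Real.sinh (μ * (ρ * Q)) / Q with hZ
  have Z1 : ρ * μ ≤ Z := by
    rw [hZ, le_div_iff₀ hQ0]
    have := Real.self_le_sinh_iff.mpr (by positivity : 0 ≤ μ * (ρ * Q))
    linarith
  have Z0 : 0 < Z := lt_of_lt_of_le (by positivity) Z1
  rcases le_or_gt (2 * w) (ρ * Q) with c | c
  · have m1 : Real.sinh (l * μ * w) ≤ Real.sinh (2 * μ * w) := by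
      rw [Real.sinh_le_sinh]
      gcongr
    have m2 := sinh_conv (x := 2 * μ * w) (y := μ * (ρ * Q)) (by positivity) (by nlinarith)
    have m3 : Real.sinh (2 * μ * w) ≤ 2 * w / ρ * Z := by
      have e : 2 * w / ρ * Z = (2 * μ * w * Real.sinh (μ * (ρ * Q))) / (μ * (ρ * Q)) := by
        rw [hZ]; field_simp
      rw [e, le_div_iff₀ (by positivity)]
      linarith
    have m4 : Real.exp (-(μ ^ 2 * l * (τ0 - τ) / 2)) ≤ 1 := by
      rw [Real.exp_le_one_iff]
      have : 0 ≤ μ ^ 2 * l * (τ0 - τ) := mul_nonneg (by positivity) (by linarith)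
      linarith
    have s0 : 0 ≤ Real.sinh (l * μ * w) := Real.sinh_nonneg_iff.mpr (by positivity)
    calc _ ≤ _ := k1
      _ ≤ 2 * p0 * 1 * (2 * (2 * w / ρ * Z)) := by
        refine mul_le_mul (mul_le_mul_of_nonneg_left m4 (by positivity)) (by linarith) (by positivity) (by positivity)
      _ = 8 / ρ * w * (p0 * Z) := by ring
      _ ≤ _ := by gcongr; norm_num
  · set s := r + (τ0 - τ) with hs
    have s0 : 0 < s := by linarith
    have q1 : w ^ 2 ≤ ρ ^ 2 / 16 * s := by
      have := pow_le_pow_left₀ hw.le hws 2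
      rw [mul_pow, Real.sq_sqrt s0.le] at this
      linarith
    have q2 : ρ ^ 2 * r < 4 * w ^ 2 := by
      have := pow_lt_pow_left₀ c (by positivity) two_ne_zero
      rw [mul_pow, hQ2] at this
      linarith
    have q3 : 4 * r < s := by
      have : 0 < ρ ^ 2 := by positivity
      nlinarith
    have q4 : w ^ 2 ≤ τ0 - τ := by
      have : ρ ^ 2 ≤ 1 := by nlinarith
      nlinarith
    have ex : -(μ ^ 2 * l * (τ0 - τ) / 2) + l * μ * w ≤ 1 := by
      have : μ * w - μ ^ 2 * (τ0 - τ) / 2 ≤ 1 / 2 := by nlinarith [sq_nonneg (μ * w - 1), mul_nonneg (sq_nonneg μ) (sub_nonneg.mpr q4)]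
      nlinarith
    have ex2 : Real.exp (-(μ ^ 2 * l * (τ0 - τ) / 2)) * Real.exp (l * μ * w) ≤ 3 := by
      rw [← Real.exp_add]
      have := Real.exp_one_lt_d9
      have := Real.exp_le_exp.mpr ex
      linarith
    calc _ ≤ _ := k1
      _ ≤ 2 * p0 * Real.exp (-(μ ^ 2 * l * (τ0 - τ) / 2)) * (2 * (l * μ * w * Real.exp (l * μ * w))) := by
        refine mul_le_mul_of_nonneg_left ?_ (by positivity)
        linarith [sinh_le_mul (x := l * μ * w)]
      _ = 4 * p0 * (l * μ * w) * (Real.exp (-(μ ^ 2 * l * (τ0 - τ) / 2)) * Real.exp (l * μ * w)) := by ring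
      _ ≤ 4 * p0 * (2 * μ * w) * 3 := by gcongr
      _ = 24 * (ρ * (1 / ρ)) * w * (p0 * μ) := by
        rw [mul_one_div_cancel hρ.ne']; ring
      _ = 24 / ρ * w * (p0 * (ρ * μ)) := by ring
      _ ≤ 32 / ρ * w * (p0 * Z) := by
        have z2 : p0 * (ρ * μ) ≤ p0 * Z := mul_le_mul_of_nonneg_left Z1 p00.le
        have z3 : 24 / ρ * w ≤ 32 / ρ * w := by gcongr; norm_num
        exact mul_le_mul z3 z2 (by positivity) (by positivity)

end KPPB

namespace KPPB

/-- slope correction -/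
noncomputable def cc (r t : ℝ) : ℝ := -(aa * Real.log t / (t - r))

/-- normalising constant -/
noncomputable def DD (r t : ℝ) : ℝ := Real.exp (Real.sqrt 2 * cc r t * r)

lemma DD_pos (r t : ℝ) : 0 < DD r t := Real.exp_pos _

/-- weighted solution seen from the tilted line -/
noncomputable def WW (u : ℝ → ℝ → ℝ) (r t s w : ℝ) : ℝ := Wf u (Real.sqrt 2 + cc r t) (-(cc r t * r)) s w

lemma WW_eq (u : ℝ → ℝ → ℝ) (r t s w : ℝ) : WW u r t s w =
    DD r t * Real.exp (cc r t * w + (cc r t) ^ 2 * s / 2) * Vf u s (w + cc r t * (s - r)) := by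
  unfold WW Wf DD Vf
  set c := cc r t
  rw [← Real.exp_add, ← mul_assoc, ← Real.exp_add]
  have e := sqrt2_sq
  congr 2
  · linear_combination (s / 2) * e
  · ring

section geom
variable {r t : ℝ} (hr : 2 ≤ r) (ht : 8 * r ≤ t)

lemma cc_nonpos (hr : 2 ≤ r) (ht : 8 * r ≤ t) : cc r t ≤ 0 := by
  unfold cc
  have := Real.log_nonneg (by linarith : 1 ≤ t)
  have := aa_pos
  have : 0 ≤ aa * Real.log t / (t - r) := div_nonneg (by positivity) (by linarith)
  linarith

lemma cc_sqrt (hr : 2 ≤ r) (ht : 8 * r ≤ t) : -cc r t * Real.sqrt t ≤ 37 := by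
  have t0 : 0 < t := by linarith
  have lg := log_small (by linarith : 1 ≤ t)
  unfold cc
  rw [neg_neg, div_mul_eq_mul_div, div_le_iff₀ (by linarith)]
  have e : t ^ (1/16 : ℝ) * Real.sqrt t ≤ t := by
    rw [Real.sqrt_eq_rpow, ← Real.rpow_add t0]
    nth_rewrite 2 [← Real.rpow_one t]
    exact Real.rpow_le_rpow_of_exponent_le (by linarith) (by norm_num)
  have := mul_le_mul_of_nonneg_right lg (Real.sqrt_nonneg t)
  linarith

lemma cc_sq (hr : 2 ≤ r) (ht : 8 * r ≤ t) : (cc r t) ^ 2 * t ≤ 1369 := by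
  have h1 := cc_sqrt hr ht
  have h2 := cc_nonpos hr ht
  have t0 : 0 < t := by linarith
  have h3 : 0 ≤ -cc r t * Real.sqrt t := mul_nonneg (by linarith) (Real.sqrt_nonneg t)
  have h4 := pow_le_pow_left₀ h3 h1 2
  rw [mul_pow, Real.sq_sqrt t0.le] at h4
  linarith

lemma chord (hr : 2 ≤ r) (ht : 8 * r ≤ t) {s : ℝ} (h1 : r ≤ s) (h2 : s ≤ t) : 0 ≤ aa * Real.log s + cc r t * (s - r) := by
  have t0 : 0 < t - r := by linarith
  have cv := strictConcaveOn_log_Ioi.concaveOn.2 (show r ∈ Ioi (0:ℝ) by simp; linarith) (show t ∈ Ioi (0:ℝ) by simp; linarith)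
    (show 0 ≤ (t - s) / (t - r) from div_nonneg (by linarith) t0.le) (show 0 ≤ (s - r) / (t - r) from div_nonneg (by linarith) t0.le)
    (by field_simp; ring)
  simp only [smul_eq_mul] at cv
  have e : (t - s) / (t - r) * r + (s - r) / (t - r) * t = s := by field_simp; ring
  rw [e] at cv
  have n1 : 0 ≤ (t - s) / (t - r) * Real.log r := mul_nonneg (div_nonneg (by linarith) t0.le) (Real.log_nonneg (by linarith))
  unfold cc
  have e2 : aa * Real.log s + -(aa * Real.log t / (t - r)) * (s - r) = aa * (Real.log s - (s - r) / (t - r) * Real.log t) := by ring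
  rw [e2]
  exact mul_nonneg aa_pos.le (by linarith)

end geom

namespace Sol
variable {u : ℝ → ℝ → ℝ} {q : ℝ → ℝ} {K Cq : ℝ}

lemma WW_upper (S : Sol u q K Cq) {A : ℝ} (hA : 1 ≤ A) (hap : ∀ t, 2 ≤ t → ∀ z,
    Vf u t z ≤ A * t ^ (-(3/2) : ℝ) * (1 + max (z + aa * Real.log t) 0)) {r t s w : ℝ} (hr : 2 ≤ r) (ht : 8 * r ≤ t)
    (h1 : r ≤ s) (h2 : s ≤ t) (hw : 0 ≤ w) :
    WW u r t s w ≤ DD r t * Real.exp 700 * A * s ^ (-(3/2) : ℝ) * (1 + w + (aa * Real.log s + cc r t * (s - r))) := by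
  have ch := chord hr ht h1 h2
  have c0 := cc_nonpos hr ht
  have c2 := cc_sq hr ht
  have D0 := DD_pos r t
  rw [WW_eq]
  have v := hap s (by linarith) (w + cc r t * (s - r))
  rw [max_eq_left (by linarith)] at v
  have e1 : Real.exp (cc r t * w + (cc r t) ^ 2 * s / 2) ≤ Real.exp 700 := by
    rw [Real.exp_le_exp]
    have : cc r t * w ≤ 0 := mul_nonpos_of_nonpos_of_nonneg c0 hw
    have : (cc r t) ^ 2 * s ≤ (cc r t) ^ 2 * t := mul_le_mul_of_nonneg_left h2 (sq_nonneg _)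
    linarith
  calc _ ≤ DD r t * Real.exp 700 * (A * s ^ (-(3/2) : ℝ) * (1 + (w + cc r t * (s - r) + aa * Real.log s))) :=
        mul_le_mul (mul_le_mul_of_nonneg_left e1 D0.le) v (S.Vf_nonneg _ _) (by positivity)
    _ = _ := by ring

theorem W_bounds (S : Sol u q K Cq) (H0 : FinMom u) {δ : ℝ} (hδ : 0 < δ) (hδ1 : δ ≤ 1) : ∃ C, 0 ≤ C ∧ ∀ r t, 2 ≤ r → 8 * r ≤ t →
    ∀ s, r ≤ s → s ≤ t → ∀ w, 0 ≤ w → WW u r t s w ≤ DD r t * C * (1 + w) * s ^ (-(3/2) + δ) ∧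
      (2 * (t - s) ≤ t - r → WW u r t s w ≤ DD r t * C * (1 + w) * (t - r) ^ (-(3/2) : ℝ) * (t - s + r ^ 2) ^ δ) := by
  obtain ⟨A, hA, hap⟩ := S.apriori H0
  refine ⟨Real.exp 700 * A * 3 * (1 + 4 / δ), by positivity, fun r t hr ht s h1 h2 w hw => ?_⟩
  have U := S.WW_upper hA hap hr ht h1 h2 hw
  have ch := chord hr ht h1 h2
  have c0 := cc_nonpos hr ht
  have D0 := DD_pos r t
  have s0 : 0 < s := by linarith
  have t0 : 0 < t := by linarith
  have a0 := aa_pos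
  have a2 := aa_le
  have lgs : ∀ x : ℝ, 1 ≤ x → aa * Real.log x ≤ 2 / δ * x ^ δ := fun x hx => by
    have l := Real.log_le_rpow_div (by linarith : 0 ≤ x) hδ
    have l0 := Real.log_nonneg hx
    calc _ ≤ 2 * (x ^ δ / δ) := mul_le_mul a2 l l0 (by norm_num)
      _ = _ := by ring
  constructor
  · refine U.trans ?_
    have g : 1 + w + (aa * Real.log s + cc r t * (s - r)) ≤ 3 * (1 + 4 / δ) * (1 + w) * s ^ δ := by
      have g1 : cc r t * (s - r) ≤ 0 := mul_nonpos_of_nonpos_of_nonneg c0 (by linarith)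
      have g2 := lgs s (by linarith)
      have g3 : 1 ≤ s ^ δ := Real.one_le_rpow (by linarith) hδ.le
      have g4 : 0 ≤ 2 / δ * s ^ δ := by positivity
      have g5 : 1 + w ≤ (1 + w) * s ^ δ := le_mul_of_one_le_right (by linarith) g3
      have g6 : 2 / δ * s ^ δ ≤ (1 + w) * (2 / δ * s ^ δ) := le_mul_of_one_le_left g4 (by linarith)
      have g7 : 0 ≤ (1 + w) * s ^ δ := by positivity
      have g8 : 0 ≤ (1 + w) * (2 / δ * s ^ δ) := by positivity
      have e : 3 * (1 + 4 / δ) * (1 + w) * s ^ δ = 3 * ((1 + w) * s ^ δ) + 6 * ((1 + w) * (2 / δ * s ^ δ)) := by ring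
      rw [e]; linarith
    calc _ ≤ DD r t * Real.exp 700 * A * s ^ (-(3/2) : ℝ) * (3 * (1 + 4 / δ) * (1 + w) * s ^ δ) :=
          mul_le_mul_of_nonneg_left g (by positivity)
      _ = _ := by rw [Real.rpow_add s0]; ring
  · intro hl
    refine U.trans ?_
    have T0 : 0 < t - r := by linarith
    set τ := t - s with hτ
    have τ0 : 0 ≤ τ := by linarith
    have B1 : 1 ≤ τ + r ^ 2 := by nlinarith
    have g : aa * Real.log s + cc r t * (s - r) ≤ 4 / δ * (τ + r ^ 2) ^ δ := by
      have l1 : Real.log s ≤ Real.log t := Real.log_le_log s0 h2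
      have e1 : aa * Real.log t + cc r t * (s - r) = aa * Real.log t * (τ / (t - r)) := by
        unfold cc; rw [hτ]; field_simp; ring
      have e2 := lgs t (by linarith)
      have e3 : t ^ δ ≤ 2 * (t - r) ^ δ := by
        calc t ^ δ ≤ (2 * (t - r)) ^ δ := Real.rpow_le_rpow t0.le (by linarith) hδ.le
          _ = 2 ^ δ * (t - r) ^ δ := Real.mul_rpow (by norm_num) T0.le
          _ ≤ 2 ^ (1:ℝ) * (t - r) ^ δ := by
              gcongr
              norm_num
          _ = _ := by rw [Real.rpow_one]
      have x0 : 0 ≤ τ / (t - r) := by positivity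
      have x1 : τ / (t - r) ≤ 1 := by rw [div_le_one T0]; linarith
      have e4 : τ / (t - r) ≤ (τ / (t - r)) ^ δ := by
        rcases x0.eq_or_lt with h | h
        · rw [← h, Real.zero_rpow hδ.ne']
        · calc τ / (t - r) = (τ / (t - r)) ^ (1:ℝ) := (Real.rpow_one _).symm
            _ ≤ _ := Real.rpow_le_rpow_of_exponent_ge h x1 hδ1
      have e5 : (t - r) ^ δ * (τ / (t - r)) ^ δ = τ ^ δ := by
        rw [← Real.mul_rpow T0.le x0]; congr 1; field_simp
      have e6 : τ ^ δ ≤ (τ + r ^ 2) ^ δ := Real.rpow_le_rpow τ0 (by nlinarith) hδ.le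
      calc _ ≤ aa * Real.log t + cc r t * (s - r) := by gcongr
        _ = aa * Real.log t * (τ / (t - r)) := e1
        _ ≤ (2 / δ * (2 * (t - r) ^ δ)) * (τ / (t - r)) ^ δ := by
            refine mul_le_mul (e2.trans ?_) e4 x0 (by positivity)
            exact mul_le_mul_of_nonneg_left e3 (by positivity)
        _ = 4 / δ * ((t - r) ^ δ * (τ / (t - r)) ^ δ) := by ring
        _ ≤ _ := by rw [e5]; gcongr
    have g' : 1 + w + (aa * Real.log s + cc r t * (s - r)) ≤ (1 + 4 / δ) * (1 + w) * (τ + r ^ 2) ^ δ := by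
      have g3 : 1 ≤ (τ + r ^ 2) ^ δ := Real.one_le_rpow B1 hδ.le
      have g4 : 0 ≤ 4 / δ * (τ + r ^ 2) ^ δ := by positivity
      have g5 : 1 + w ≤ (1 + w) * (τ + r ^ 2) ^ δ := le_mul_of_one_le_right (by linarith) g3
      have g6 : 4 / δ * (τ + r ^ 2) ^ δ ≤ (1 + w) * (4 / δ * (τ + r ^ 2) ^ δ) := le_mul_of_one_le_left g4 (by linarith)
      linarith
    have sb : s ^ (-(3/2) : ℝ) ≤ 3 * (t - r) ^ (-(3/2) : ℝ) := by
      calc s ^ (-(3/2) : ℝ) ≤ (2⁻¹ * (t - r)) ^ (-(3/2) : ℝ) := Real.rpow_le_rpow_of_nonpos (by positivity) (by linarith) (by norm_num)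
        _ = (2⁻¹ : ℝ) ^ (-(3/2) : ℝ) * (t - r) ^ (-(3/2) : ℝ) := Real.mul_rpow (by norm_num) T0.le
        _ ≤ _ := by
          refine mul_le_mul_of_nonneg_right ?_ (by positivity)
          rw [Real.rpow_neg (by norm_num), Real.inv_rpow (by norm_num), inv_inv]
          have : ((2:ℝ) ^ (3/2 : ℝ)) ^ 2 = 8 := by
            rw [← Real.rpow_natCast, ← Real.rpow_mul (by norm_num)]; norm_num
          have p : 0 < (2:ℝ) ^ (3/2 : ℝ) := by positivity
          nlinarith
    calc _ ≤ DD r t * Real.exp 700 * A * (3 * (t - r) ^ (-(3/2) : ℝ)) * ((1 + 4 / δ) * (1 + w) * (τ + r ^ 2) ^ δ) :=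
          mul_le_mul (mul_le_mul_of_nonneg_left sb (by positivity)) g' (by linarith) (by positivity)
      _ = _ := by ring

theorem S_bound (S : Sol u q K Cq) (H0 : FinMom u) {γ : ℝ} (hγ : 0 < γ) (hq : QDec q K γ) : ∃ C, 0 ≤ C ∧ ∀ r t, 2 ≤ r → 8 * r ≤ t →
    ∀ s, r ≤ s → s ≤ t → ∀ w, 0 ≤ w →
      Sf u q (Real.sqrt 2 + cc r t) (-(cc r t * r)) s w ≤ C * ((1 + w) ^ (-(2 + γ)) * WW u r t s w) := by
  obtain ⟨A, hA, hap⟩ := S.apriori H0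
  obtain ⟨C, hC, hS⟩ := hq A (by linarith)
  refine ⟨C, hC, fun r t hr ht s h1 h2 w hw => ?_⟩
  have ch := chord hr ht h1 h2
  have s0 : 0 < s := by linarith
  set c := cc r t with hc
  set v0 := u s (-(c * r) + (Real.sqrt 2 + c) * s + w) with hv0
  set z := w + c * (s - r) with hz
  set ζ := z + aa * Real.log s with hζ
  have hζw : w ≤ ζ := by linarith
  have v := hap s (by linarith) z
  rw [max_eq_left (by linarith)] at v
  have e : Vf u s z = Real.exp (Real.sqrt 2 * z) * v0 := by
    unfold Vf; rw [hv0]; congr 2; rw [hz]; ring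
  have ve : v0 = Real.exp (-(Real.sqrt 2 * z)) * Vf u s z := by
    rw [e, ← mul_assoc, ← Real.exp_add]; simp
  have vb : v0 ≤ A * (1 + ζ) * Real.exp (-(Real.sqrt 2 * ζ)) := by
    rw [ve]
    have x1 : Real.exp (-(Real.sqrt 2 * ζ)) = Real.exp (-(Real.sqrt 2 * z)) * s ^ (-(3/2) : ℝ) := by
      rw [← exp_aa_log s0, ← Real.exp_add]; congr 1; rw [hζ]; ring
    rw [x1]
    calc _ ≤ Real.exp (-(Real.sqrt 2 * z)) * (A * s ^ (-(3/2) : ℝ) * (1 + ζ)) := mul_le_mul_of_nonneg_left v (Real.exp_pos _).le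
      _ = _ := by ring
  have n0 : 0 ≤ v0 := S.nonneg _ _
  have qb := hS ζ v0 (by linarith) n0 (S.le _ _) vb
  have rb : (1 + ζ) ^ (-(2 + γ)) ≤ (1 + w) ^ (-(2 + γ)) := Real.rpow_le_rpow_of_nonpos (by linarith) (by linarith) (by linarith)
  unfold Sf WW Wf
  rw [← hc, ← hv0]
  set E := Real.exp ((Real.sqrt 2 + c) * w + ((Real.sqrt 2 + c) ^ 2 / 2 - 1) * s)
  have hE : 0 < E := Real.exp_pos _
  calc E * q v0 ≤ E * (C * (1 + w) ^ (-(2 + γ)) * v0) := by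
        refine mul_le_mul_of_nonneg_left (qb.trans ?_) hE.le
        exact mul_le_mul_of_nonneg_right (mul_le_mul_of_nonneg_left rb hC) n0
    _ = _ := by ring

theorem P_lower (S : Sol u q K Cq) (H0 : FinMom u) {x0 γ : ℝ} (hx0 : 0 < u 0 x0) (hγ : 0 < γ) (hγ1 : γ ≤ 1/2) (hq : QDec q K γ) :
    ∃ ρ c3, 0 < ρ ∧ ρ ≤ 1 ∧ 0 < c3 ∧ ∀ r t w', 2 ≤ r → 8 * r ≤ t → 0 < w' →
      DD r t * c3 * (pk (t - r) w' * (Real.sinh (w' / (t - r) * (ρ * Real.sqrt r)) / Real.sqrt r))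
        ≤ ∫ y in Ioi (0:ℝ), WW u r t r y * kk (t - r) y w' := by
  obtain ⟨ρ, R, c, hρ, hρ1, hR, hc, hm⟩ := S.mass_window H0 hx0 hγ hγ1 hq
  refine ⟨ρ, Real.exp (-(37 * R)) * Real.exp (-(R ^ 2)) * 2 / ρ * c, hρ, hρ1, by positivity, fun r t w' hr ht hw' => ?_⟩
  set Q := Real.sqrt r with hQ
  have hQ0 : 0 < Q := Real.sqrt_pos.mpr (by linarith)
  have hQ2 : Q ^ 2 = r := Real.sq_sqrt (by linarith)
  have T0 : 0 < t - r := by linarith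
  set μ := w' / (t - r) with hμ
  have hμ0 : 0 < μ := by positivity
  have D0 := DD_pos r t
  set sh := Real.sinh (μ * (ρ * Q)) with hsh
  have sh0 : 0 ≤ sh := Real.sinh_nonneg_iff.mpr (by positivity)
  set N := DD r t * Real.exp (-(37 * R)) * (pk (t - r) w' * Real.exp (-(R ^ 2)) * (2 * (sh / (ρ * Q)))) with hN
  have p0 := pk_pos T0 w'
  have hN0 : 0 ≤ N := by positivity
  have ik := S.Wf_kk_integrable (Real.sqrt 2 + cc r t) (-(cc r t * r)) (s := r) (τ := t - r) (w' := w') (by linarith) T0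
  have ρQ : 0 < ρ * Q := by positivity
  have cv : Continuous (fun w => N * (Vf u r w * w)) := continuous_const.mul ((S.Vf_cont' r).mul continuous_id)
  have pt : ∀ y ∈ Ioc (ρ * Q) (R * Q), N * (Vf u r y * y) ≤ WW u r t r y * kk (t - r) y w' := by
    intro y hy
    have y0 : 0 < y := lt_trans ρQ hy.1
    have v0 := S.Vf_nonneg r y
    have c0 := cc_nonpos hr ht
    have w1 : DD r t * Real.exp (-(37 * R)) * Vf u r y ≤ WW u r t r y := by
      rw [WW_eq, sub_self, mul_zero, add_zero]
      refine mul_le_mul_of_nonneg_right (mul_le_mul_of_nonneg_left ?_ D0.le) v0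
      rw [Real.exp_le_exp]
      have a1 := cc_sqrt hr ht
      have a2 : Q ≤ Real.sqrt t := Real.sqrt_le_sqrt (by linarith)
      have a3 : -cc r t * y ≤ 37 * R := by
        calc -cc r t * y ≤ -cc r t * (R * Real.sqrt t) := by
              refine mul_le_mul_of_nonneg_left (hy.2.trans ?_) (by linarith)
              exact mul_le_mul_of_nonneg_left a2 (by linarith)
          _ = R * (-cc r t * Real.sqrt t) := by ring
          _ ≤ R * 37 := mul_le_mul_of_nonneg_left a1 (by linarith)
          _ = _ := by ring
      have : 0 ≤ (cc r t) ^ 2 * r / 2 := by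
        have : 0 ≤ r := by linarith
        positivity
      linarith
    have k1 : pk (t - r) w' * Real.exp (-(R ^ 2)) * (2 * (sh / (ρ * Q))) * y ≤ kk (t - r) y w' := by
      rw [kk_sinh T0]
      have b1 : Real.exp (-(R ^ 2)) ≤ Real.exp (-(y ^ 2 / (2 * (t - r)))) := by
        rw [Real.exp_le_exp, neg_le_neg_iff, div_le_iff₀ (by linarith)]
        have := pow_le_pow_left₀ y0.le hy.2 2
        rw [mul_pow, hQ2] at this
        nlinarith [sq_nonneg R]
      have b2 := sinh_conv (x := μ * (ρ * Q)) (y := μ * y) (by positivity) (mul_le_mul_of_nonneg_left hy.1.le hμ0.le)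
      have b3 : sh / (ρ * Q) * y ≤ Real.sinh (y * w' / (t - r)) := by
        rw [show y * w' / (t - r) = μ * y by rw [hμ]; ring, div_mul_eq_mul_div, div_le_iff₀ ρQ]
        rw [← hsh] at b2
        have : μ * (y * sh) ≤ μ * (ρ * Q * Real.sinh (μ * y)) := by linarith
        have := le_of_mul_le_mul_left this hμ0
        linarith
      calc _ = pk (t - r) w' * Real.exp (-(R ^ 2)) * (2 * (sh / (ρ * Q) * y)) := by ring
        _ ≤ _ := by
          refine mul_le_mul (mul_le_mul_of_nonneg_left b1 p0.le) (by linarith) (by positivity) (by positivity)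
    calc N * (Vf u r y * y) = (DD r t * Real.exp (-(37 * R)) * Vf u r y) * (pk (t - r) w' * Real.exp (-(R ^ 2)) * (2 * (sh / (ρ * Q))) * y) := by rw [hN]; ring
      _ ≤ _ := mul_le_mul w1 k1 (by positivity) (S.Wf_nonneg _ _ _ _)
  calc _ = N * c := by rw [hN]; field_simp
    _ ≤ N * ∫ y in Ioc (ρ * Q) (R * Q), Vf u r y * y := mul_le_mul_of_nonneg_left (hm r hr) hN0
    _ = ∫ y in Ioc (ρ * Q) (R * Q), N * (Vf u r y * y) := (integral_const_mul _ _).symm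
    _ ≤ ∫ y in Ioc (ρ * Q) (R * Q), WW u r t r y * kk (t - r) y w' :=
        setIntegral_mono_on cv.integrableOn_Ioc (ik.mono_set fun x hx => lt_trans ρQ hx.1) measurableSet_Ioc pt
    _ ≤ _ := by
        refine setIntegral_mono_set ik ((ae_restrict_iff' measurableSet_Ioi).mpr (Eventually.of_forall fun w hw => ?_)) (Eventually.of_forall fun x hx => lt_trans ρQ hx.1)
        exact mul_nonneg (S.Wf_nonneg _ _ _ _) (kk_nonneg T0 (le_of_lt hw) hw'.le)

end Sol
end KPPB

namespace KPPB

lemma exp_shift_le {X δ : ℝ} (hX : 1 ≤ X) (hδ : δ ≤ 1/24) : X ^ (-(3/2) + δ) ≤ X ^ (-(1 + δ)) :=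
  Real.rpow_le_rpow_of_exponent_le hX (by linarith)

namespace Sol
variable {u : ℝ → ℝ → ℝ} {q : ℝ → ℝ} {K Cq : ℝ}

/-- collected data for fixed `r, t, w'` -/
structure Dat (u : ℝ → ℝ → ℝ) (C ρ c3 δ r t w' : ℝ) : Prop where
  hC : 0 ≤ C
  hρ : 0 < ρ
  hρ1 : ρ ≤ 1
  hc3 : 0 < c3
  hδ0 : 0 < δ
  hδ : δ ≤ 1/24
  hr : 2 ≤ r
  ht : 8 * r ≤ t
  hw' : 9 * r ≤ w'
  hW : ∀ s, r ≤ s → s ≤ t → ∀ w, 0 ≤ w → WW u r t s w ≤ DD r t * C * (1 + w) * s ^ (-(3/2) + δ) ∧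
      (2 * (t - s) ≤ t - r → WW u r t s w ≤ DD r t * C * (1 + w) * (t - r) ^ (-(3/2) : ℝ) * (t - s + r ^ 2) ^ δ)
  hP : DD r t * c3 * (pk (t - r) w' * (Real.sinh (w' / (t - r) * (ρ * Real.sqrt r)) / Real.sqrt r))
        ≤ ∫ y in Ioi (0:ℝ), WW u r t r y * kk (t - r) y w'

variable {C ρ c3 δ r t w' : ℝ}

lemma Dat.muP (D : Dat u C ρ c3 δ r t w') :
    DD r t * (w' / (t - r) * pk (t - r) w') ≤ (∫ y in Ioi (0:ℝ), WW u r t r y * kk (t - r) y w') / (ρ * c3) := by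
  have hρ := D.hρ
  have hc3 := D.hc3
  have hr := D.hr
  have ht := D.ht
  have h0 : 0 < t - r := by linarith
  have hw' : 0 < w' := by linarith [D.hw']
  have Q0 : 0 < Real.sqrt r := Real.sqrt_pos.mpr (by linarith)
  have p0 := pk_pos h0 w'
  have D0 := DD_pos r t
  rw [le_div_iff₀ (by positivity)]
  refine le_trans ?_ D.hP
  have a : w' / (t - r) * ρ ≤ Real.sinh (w' / (t - r) * (ρ * Real.sqrt r)) / Real.sqrt r := by
    rw [le_div_iff₀ Q0]
    calc _ = w' / (t - r) * (ρ * Real.sqrt r) := by ring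
      _ ≤ _ := Real.self_le_sinh_iff.mpr (by positivity)
  calc _ = DD r t * c3 * (pk (t - r) w' * (w' / (t - r) * ρ)) := by ring
    _ ≤ _ := mul_le_mul_of_nonneg_left (mul_le_mul_of_nonneg_left a p0.le) (by positivity)

lemma Dat.P0 (D : Dat u C ρ c3 δ r t w') : 0 ≤ ∫ y in Ioi (0:ℝ), WW u r t r y * kk (t - r) y w' := by
  have hr := D.hr
  have ht := D.ht
  have hw' : 0 < w' := by linarith [D.hw']
  have h0 : 0 < t - r := by linarith
  have hρ := D.hρ
  have hc3 := D.hc3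
  have p0 := pk_pos h0 w'
  have D0 := DD_pos r t
  have h := D.muP
  have : 0 ≤ (∫ y in Ioi (0:ℝ), WW u r t r y * kk (t - r) y w') / (ρ * c3) := le_trans (by positivity) h
  by_contra hn
  push Not at hn
  have := div_neg_of_neg_of_pos hn (by positivity : 0 < ρ * c3)
  linarith

lemma Dat.near_early (S : Sol u q K Cq) (D : Dat u C ρ c3 δ r t w') {s w : ℝ} (h1 : r ≤ s) (h2 : s < t) (he : t - r ≤ 2 * (t - s))
    (hw : 0 < w) (hws : w ≤ ρ / 4 * Real.sqrt s) :
    WW u r t s w * kk (t - s) w w' ≤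
      32 * C / (ρ * c3) * (∫ y in Ioi (0:ℝ), WW u r t r y * kk (t - r) y w') * s ^ (-(3/2) + δ) * (1 + w) ^ 2 := by
  set P := ∫ y in Ioi (0:ℝ), WW u r t r y * kk (t - r) y w' with hPd
  have hr := D.hr
  have ht := D.ht
  have hC := D.hC
  have hρ := D.hρ
  have hc3 := D.hc3
  have hw' : 0 < w' := by linarith [D.hw']
  have h0 : 0 < t - r := by linarith
  have D0 := DD_pos r t
  have s0 : 0 < s := by linarith
  have a := (D.hW s h1 h2.le w hw.le).1
  have b := early_kk (r := r) (ρ := ρ) (τ := t - s) (τ0 := t - r) (w := w) (w' := w') (by linarith) hρ D.hρ1 (by linarith) he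
    (by linarith) hw' hw (by rw [show r + (t - r - (t - s)) = s by ring]; exact hws)
  have k0 := kk_nonneg (τ := t - s) (w := w) (w' := w') (by linarith) hw.le hw'.le
  have hP := D.hP
  rw [← hPd] at hP
  set Y := pk (t - r) w' * (Real.sinh (w' / (t - r) * (ρ * Real.sqrt r)) / Real.sqrt r) with hY
  have hP0 : 0 ≤ P := D.P0
  have hX : 0 < s ^ (-(3/2) + δ) := Real.rpow_pos_of_pos s0 _
  set X := s ^ (-(3/2) + δ)
  have hY' : DD r t * Y ≤ P / c3 := by
    rw [le_div_iff₀ hc3]; linarith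
  calc WW u r t s w * kk (t - s) w w' ≤ (DD r t * C * (1 + w) * X) * (32 / ρ * w * Y) :=
        mul_le_mul a b k0 (by positivity)
    _ = 32 * C / ρ * X * ((1 + w) * w) * (DD r t * Y) := by ring
    _ ≤ 32 * C / ρ * X * ((1 + w) * w) * (P / c3) := mul_le_mul_of_nonneg_left hY' (by positivity)
    _ = 32 * C / (ρ * c3) * P * X * ((1 + w) * w) := by field_simp
    _ ≤ _ := mul_le_mul_of_nonneg_left (by nlinarith) (by positivity)

lemma Dat.near_late (S : Sol u q K Cq) (D : Dat u C ρ c3 δ r t w') {s w : ℝ} (h1 : r ≤ s) (h2 : s < t) (he : 2 * (t - s) ≤ t - r)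
    (hw : 0 < w) (hws : w ≤ Real.sqrt (t - s + r ^ 2)) :
    WW u r t s w * kk (t - s) w w' ≤
      32 * C / (ρ * c3) * (∫ y in Ioi (0:ℝ), WW u r t r y * kk (t - r) y w') * (t - s + r ^ 2) ^ (-(3/2) + δ) * (1 + w) ^ 2 := by
  have hm := D.muP
  have hP0 := D.P0
  set P := ∫ y in Ioi (0:ℝ), WW u r t r y * kk (t - r) y w' with hPd
  have hr := D.hr
  have ht := D.ht
  have hC := D.hC
  have hρ := D.hρ
  have hc3 := D.hc3
  have hw' : 0 < w' := by linarith [D.hw']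
  have h0 : 0 < t - r := by linarith
  have D0 := DD_pos r t
  have s0 : 0 < s := by linarith
  have τ0 : 0 < t - s := by linarith
  have A0 : 0 < t - s + r ^ 2 := by positivity
  have a := (D.hW s h1 h2.le w hw.le).2 he
  have w2 : w ^ 2 ≤ t - s + r ^ 2 := by
    rw [← Real.sq_sqrt A0.le]; exact pow_le_pow_left₀ hw.le hws 2
  have b := late_pk (w' := w') τ0 he (by linarith : 0 < r) hw.le w2 D.hw'
  have b2 := (kk_le_mul (w := w) (w' := w') τ0).trans (mul_le_mul_of_nonneg_left b (by positivity))
  have k0 := kk_nonneg (τ := t - s) (w := w) (w' := w') τ0 hw.le hw'.le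
  set X := t - s + r ^ 2 with hX
  have eX : X ^ δ * X ^ (-(3/2) : ℝ) = X ^ (-(3/2) + δ) := by
    rw [← Real.rpow_add A0]; congr 1; ring
  have eT : (t - r) ^ (-(3/2) : ℝ) * (t - r) ^ (3/2 : ℝ) = 1 := by
    rw [← Real.rpow_add h0]; norm_num
  have X1 : 0 < X ^ (-(3/2) + δ) := Real.rpow_pos_of_pos A0 _
  calc WW u r t s w * kk (t - s) w w' ≤ _ := mul_le_mul a b2 k0 (by positivity)
    _ = 32 * C * (X ^ δ * X ^ (-(3/2) : ℝ)) * ((t - r) ^ (-(3/2) : ℝ) * (t - r) ^ (3/2 : ℝ)) * ((1 + w) * w)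
          * (DD r t * (w' / (t - r) * pk (t - r) w')) := by ring
    _ = 32 * C * X ^ (-(3/2) + δ) * ((1 + w) * w) * (DD r t * (w' / (t - r) * pk (t - r) w')) := by rw [eX, eT, mul_one]
    _ ≤ 32 * C * X ^ (-(3/2) + δ) * ((1 + w) * w) * (P / (ρ * c3)) := mul_le_mul_of_nonneg_left hm (by positivity)
    _ = 32 * C / (ρ * c3) * P * X ^ (-(3/2) + δ) * ((1 + w) * w) := by field_simp
    _ ≤ _ := mul_le_mul_of_nonneg_left (by nlinarith) (by positivity)

/-- the time profile of the error terms -/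
noncomputable def prof (δ r t s : ℝ) : ℝ := s ^ (-(1 + δ)) + (t - s + r ^ 2) ^ (-(1 + δ))

lemma prof_cont {δ r t t' : ℝ} (hr : 2 ≤ r) (hrt : r ≤ t') (htt : t' ≤ t) : ContinuousOn (prof δ r t) (Icc r t') := by
  refine ContinuousOn.add ?_ (int_shift_cont hrt htt (by positivity))
  refine ContinuousOn.rpow_const (by fun_prop) fun s hs => Or.inl ?_
  have : 0 < s := by linarith [hs.1]
  exact this.ne'

lemma prof_int {δ r t t' : ℝ} (hδ : 0 < δ) (hr : 2 ≤ r) (hrt : r ≤ t') (htt : t' ≤ t) :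
    ∫ s in r..t', prof δ r t s ≤ 2 / δ * r ^ (-δ) := by
  have i1 : IntervalIntegrable (fun s => s ^ (-(1 + δ))) volume r t' := by
    refine ContinuousOn.intervalIntegrable_of_Icc hrt ?_
    refine ContinuousOn.rpow_const (by fun_prop) fun s hs => Or.inl ?_
    have : 0 < s := by linarith [hs.1]
    exact this.ne'
  have i2 : IntervalIntegrable (fun s => (t - s + r ^ 2) ^ (-(1 + δ))) volume r t' :=
    ContinuousOn.intervalIntegrable_of_Icc hrt (int_shift_cont hrt htt (by positivity))
  unfold prof
  rw [intervalIntegral.integral_add i1 i2]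
  have h1 := int_pow_le (p := δ) (by linarith : 0 < r) hrt hδ
  have h2 := int_shift_le (p := δ) (A := r ^ 2) hrt htt (by positivity) hδ
  have h3 : (r ^ 2) ^ (-δ) ≤ r ^ (-δ) := Real.rpow_le_rpow_of_nonpos (by linarith) (by nlinarith) (by linarith)
  have h4 := div_le_div_of_nonneg_right h3 hδ.le
  calc _ ≤ r ^ (-δ) / δ + r ^ (-δ) / δ := by linarith
    _ = _ := by ring

lemma Dat.flux_le (S : Sol u q K Cq) (D : Dat u C ρ c3 δ r t w') {s : ℝ} (h1 : r ≤ s) (h2 : s < t) :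
    flux u (Real.sqrt 2 + cc r t) (-(cc r t * r)) t w' s ≤
      32 * C / (ρ * c3) * (∫ y in Ioi (0:ℝ), WW u r t r y * kk (t - r) y w') * prof δ r t s := by
  have hm := D.muP
  have hP0 := D.P0
  set P := ∫ y in Ioi (0:ℝ), WW u r t r y * kk (t - r) y w' with hPd
  have hr := D.hr
  have ht := D.ht
  have hC := D.hC
  have hρ := D.hρ
  have hc3 := D.hc3
  have hw' : 0 < w' := by linarith [D.hw']
  have h0 : 0 < t - r := by linarith
  have D0 := DD_pos r t
  have s0 : 0 < s := by linarith
  have τ0 : 0 < t - s := by linarith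
  have A1 : 1 ≤ t - s + r ^ 2 := by nlinarith
  have A0 : 0 < t - s + r ^ 2 := by positivity
  have p0 := pk_pos h0 w'
  have pτ := pk_pos τ0 w'
  have e1 := exp_shift_le (X := s) (by linarith) D.hδ
  have e2 := exp_shift_le A1 D.hδ
  have n1 : 0 < s ^ (-(1 + δ)) := Real.rpow_pos_of_pos s0 _
  have n2 : 0 < (t - s + r ^ 2) ^ (-(1 + δ)) := Real.rpow_pos_of_pos A0 _
  have n3 : 0 < s ^ (-(3/2) + δ) := Real.rpow_pos_of_pos s0 _
  have n4 : 0 < (t - s + r ^ 2) ^ (-(3/2) + δ) := Real.rpow_pos_of_pos A0 _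
  have hW := D.hW s h1 h2.le 0 le_rfl
  have k0 : 0 ≤ w' / (t - s) * pk (t - s) w' := by positivity
  have fe : flux u (Real.sqrt 2 + cc r t) (-(cc r t * r)) t w' s = WW u r t s 0 * (w' / (t - s) * pk (t - s) w') := rfl
  rw [fe]
  unfold prof
  rcases le_total (t - r) (2 * (t - s)) with he | he
  · have a := hW.1
    have b : w' / (t - s) ≤ 2 * (w' / (t - r)) := by
      rw [← mul_div_assoc, div_le_div_iff₀ τ0 h0]
      calc _ ≤ w' * (2 * (t - s)) := mul_le_mul_of_nonneg_left he hw'.le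
        _ = _ := by ring
    have c : pk (t - s) w' ≤ 2 * pk (t - r) w' := by
      refine (early_pk τ0 he (by linarith)).trans (mul_le_of_le_one_right (by positivity) ?_)
      rw [Real.exp_le_one_iff]
      have : 0 ≤ (w' / (t - r)) ^ 2 * ((t - r) / (t - s)) * (t - r - (t - s)) / 2 := by
        have : 0 ≤ t - r - (t - s) := by linarith
        positivity
      linarith
    calc _ ≤ (DD r t * C * (1 + 0) * s ^ (-(3/2) + δ)) * (2 * (w' / (t - r)) * (2 * pk (t - r) w')) :=
          mul_le_mul a (mul_le_mul b c pτ.le (by positivity)) k0 (by positivity)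
      _ = 4 * C * s ^ (-(3/2) + δ) * (DD r t * (w' / (t - r) * pk (t - r) w')) := by ring
      _ ≤ 4 * C * s ^ (-(3/2) + δ) * (P / (ρ * c3)) := mul_le_mul_of_nonneg_left hm (by positivity)
      _ ≤ 32 * C * s ^ (-(3/2) + δ) * (P / (ρ * c3)) := by
        refine mul_le_mul_of_nonneg_right (mul_le_mul_of_nonneg_right (by linarith) n3.le) (by positivity)
      _ = 32 * C / (ρ * c3) * P * s ^ (-(3/2) + δ) := by field_simp
      _ ≤ _ := mul_le_mul_of_nonneg_left (by linarith) (by positivity)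
  · have a := hW.2 he
    have b := late_pk (w := 0) (w' := w') τ0 he (by linarith : 0 < r) le_rfl (by rw [zero_pow two_ne_zero]; exact A0.le) D.hw'
    have ev : pk (t - s) (0 - w') = pk (t - s) w' := by unfold pk; rw [zero_sub, neg_sq]
    rw [ev] at b
    have b2 : w' / (t - s) * pk (t - s) w' ≤ w' * (16 * (1 / (t - r) * pk (t - r) w') * (t - r) ^ (3/2 : ℝ) * (t - s + r ^ 2) ^ (-(3/2) : ℝ)) := by
      calc _ = w' * (1 / (t - s) * pk (t - s) w') := by ring
        _ ≤ _ := mul_le_mul_of_nonneg_left b hw'.le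
    set X := t - s + r ^ 2 with hX
    have eX : X ^ δ * X ^ (-(3/2) : ℝ) = X ^ (-(3/2) + δ) := by
      rw [← Real.rpow_add A0]; congr 1; ring
    have eT : (t - r) ^ (-(3/2) : ℝ) * (t - r) ^ (3/2 : ℝ) = 1 := by
      rw [← Real.rpow_add h0]; norm_num
    calc _ ≤ _ := mul_le_mul a b2 k0 (by positivity)
      _ = 16 * C * (X ^ δ * X ^ (-(3/2) : ℝ)) * ((t - r) ^ (-(3/2) : ℝ) * (t - r) ^ (3/2 : ℝ))
          * (DD r t * (w' / (t - r) * pk (t - r) w')) := by ring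
      _ = 16 * C * X ^ (-(3/2) + δ) * (DD r t * (w' / (t - r) * pk (t - r) w')) := by rw [eX, eT, mul_one]
      _ ≤ 16 * C * X ^ (-(3/2) + δ) * (P / (ρ * c3)) := mul_le_mul_of_nonneg_left hm (by positivity)
      _ ≤ 32 * C * X ^ (-(3/2) + δ) * (P / (ρ * c3)) := by
        refine mul_le_mul_of_nonneg_right (mul_le_mul_of_nonneg_right (by linarith) n4.le) (by positivity)
      _ = 32 * C / (ρ * c3) * P * X ^ (-(3/2) + δ) := by field_simp
      _ ≤ _ := mul_le_mul_of_nonneg_left (by linarith) (by positivity)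

lemma Dat.flux_int (S : Sol u q K Cq) (D : Dat u C ρ c3 δ r t w') {t' : ℝ} (h1 : r ≤ t') (h2 : t' < t) :
    ∫ s in r..t', flux u (Real.sqrt 2 + cc r t) (-(cc r t * r)) t w' s ≤
      64 * C / (ρ * c3 * δ) * r ^ (-δ) * (∫ y in Ioi (0:ℝ), WW u r t r y * kk (t - r) y w') := by
  have hP0 := D.P0
  have hC := D.hC
  have hρ := D.hρ
  have hc3 := D.hc3
  have hδ0 := D.hδ0
  have h := S.flux_int_le (κ := Real.sqrt 2 + cc r t) (l := -(cc r t * r)) (w' := w') h1 h2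
    (b := fun s => 32 * C / (ρ * c3) * (∫ y in Ioi (0:ℝ), WW u r t r y * kk (t - r) y w') * prof δ r t s)
    (continuousOn_const.mul (prof_cont D.hr h1 h2.le)) (fun s hs => D.flux_le S hs.1 (lt_of_le_of_lt hs.2 h2))
  rw [intervalIntegral.integral_const_mul] at h
  refine h.trans ((mul_le_mul_of_nonneg_left (prof_int hδ0 D.hr h1 h2.le) (by positivity)).trans (le_of_eq ?_))
  field_simp
  ring

/-- the two-sided kernel estimate -/
theorem Dat.main (S : Sol u q K Cq) (D : Dat u C ρ c3 δ r t w') {γ Cs : ℝ} (hγ : 0 < γ) (hγ1 : γ ≤ 1/2) (hδγ : δ = γ / 12)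
    (hCs : 0 ≤ Cs) (hS : ∀ s, r ≤ s → s ≤ t → ∀ w, 0 ≤ w →
      Sf u q (Real.sqrt 2 + cc r t) (-(cc r t * r)) s w ≤ Cs * ((1 + w) ^ (-(2 + γ)) * WW u r t s w))
    (hsm : 64 * C / (ρ * c3 * δ) * r ^ (-δ) ≤ 1) :
    (1 - Cs * (32 * C / (ρ * c3) + 2 * ((ρ / 4) ^ 3)⁻¹) * (2 / δ) * r ^ (-δ)) * (∫ y in Ioi (0:ℝ), WW u r t r y * kk (t - r) y w') ≤ WW u r t t w' ∧
    WW u r t t w' ≤ (1 + 64 * C / (ρ * c3 * δ) * r ^ (-δ)) * (∫ y in Ioi (0:ℝ), WW u r t r y * kk (t - r) y w') := by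
  have hP0 := D.P0
  have hC := D.hC
  have hρ := D.hρ
  have hρ1 := D.hρ1
  have hc3 := D.hc3
  have hδ0 := D.hδ0
  have hr := D.hr
  have ht := D.ht
  have hw' : 0 < w' := by linarith [D.hw']
  have fl : ∀ t', r ≤ t' → t' < t → _ := fun t' h1 h2 => D.flux_int S h1 h2
  have UK := S.kernel_upper (κ := Real.sqrt 2 + cc r t) (l := -(cc r t * r)) (by linarith : 0 ≤ r) (by linarith : r < t) hw'
    (fun t' h1 h2 => fl t' h1.le h2)
  have F2 : ∀ s, r ≤ s → s < t → ∫ w in Ioi (0:ℝ), WW u r t s w * kk (t - s) w w' ≤ 2 * ∫ y in Ioi (0:ℝ), WW u r t r y * kk (t - r) y w' := by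
    intro s h1 h2
    have h := S.kernel_upper' (κ := Real.sqrt 2 + cc r t) (l := -(cc r t * r)) (by linarith : 0 ≤ r) h1 h2 hw' (fl s h1 h2)
    have := mul_le_mul_of_nonneg_right hsm hP0
    rw [two_mul]
    refine h.trans (add_le_add_right (this.trans (by rw [one_mul])) _)
  set P := ∫ y in Ioi (0:ℝ), WW u r t r y * kk (t - r) y w' with hPd
  constructor
  swap
  · calc _ ≤ _ := UK
      _ = _ := by rw [add_mul, one_mul, hPd]; rfl
  set CC := Cs * (32 * C / (ρ * c3) + 2 * ((ρ / 4) ^ 3)⁻¹) with hCC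
  have hCC0 : 0 ≤ CC := by positivity
  have KL := S.kernel_lower (κ := Real.sqrt 2 + cc r t) (l := -(cc r t * r)) (g := 0) (w' := w')
    (b := fun s => CC * P * prof δ r t s) (B := CC * P * (2 / δ * r ^ (-δ))) (by linarith : 0 ≤ r) (by linarith : r < t) hw'
    (fun t' h1 h2 => (continuousOn_const.mul (prof_cont hr h1.le h2.le)).intervalIntegrable_of_Icc h1.le)
    (fun t' h1 h2 => by
      rw [intervalIntegral.integral_const_mul]
      exact mul_le_mul_of_nonneg_left (prof_int hδ0 hr h1.le h2.le) (by positivity)) ?_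
  · simp only [zero_mul, Real.exp_zero, one_mul] at KL
    refine le_trans (le_of_eq ?_) KL
    rw [hPd]
    simp only [WW]
    ring
  intro s hs
  have h1 := hs.1
  have h2 := hs.2
  have s0 : 0 < s := by linarith
  have τ0 : 0 < t - s := by linarith
  have A1 : 1 ≤ t - s + r ^ 2 := by nlinarith
  have A0 : 0 < t - s + r ^ 2 := by positivity
  have n1 : 0 < s ^ (-(1 + δ)) := Real.rpow_pos_of_pos s0 _
  have n2 : 0 < (t - s + r ^ 2) ^ (-(1 + δ)) := Real.rpow_pos_of_pos A0 _
  have Wn : ∀ w, 0 ≤ WW u r t s w := fun w => S.Wf_nonneg _ _ s w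
  have kn : ∀ w, 0 < w → 0 ≤ kk (t - s) w w' := fun w hw => kk_nonneg τ0 hw.le hw'.le
  have fi : IntegrableOn (fun w => WW u r t s w * kk (t - s) w w') (Ioi 0) :=
    S.Wf_kk_integrable (Real.sqrt 2 + cc r t) (-(cc r t * r)) s0.le τ0
  have key : IntegrableOn (fun w => (1 + w) ^ (-(2 + γ)) * (WW u r t s w * kk (t - s) w w')) (Ioi 0) ∧
      ∫ w in Ioi (0:ℝ), (1 + w) ^ (-(2 + γ)) * (WW u r t s w * kk (t - s) w w') ≤
        (32 * C / (ρ * c3) + 2 * ((ρ / 4) ^ 3)⁻¹) * P * prof δ r t s := by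
    have th : 2 * ((1:ℝ) ^ 3)⁻¹ ≤ 2 * ((ρ / 4) ^ 3)⁻¹ := by
      refine mul_le_mul_of_nonneg_left (inv_anti₀ (by positivity) ?_) (by norm_num)
      exact pow_le_pow_left₀ (by positivity) (by linarith) 3
    rcases le_total (t - r) (2 * (t - s)) with he | he
    · have h := split_int (X := s) (θ := ρ / 4) (P := P) (C1 := 32 * C / (ρ * c3)) (by linarith) (by positivity) (by linarith) hγ hγ1 hδγ
        (fun w hw => mul_nonneg (Wn w) (kn w hw)) fi fi.aestronglyMeasurable (by positivity) hP0 (F2 s h1.le h2)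
        (fun w hw hws => D.near_early S h1.le h2 he hw hws)
      refine ⟨h.1, h.2.trans (mul_le_mul_of_nonneg_left ?_ (by positivity))⟩
      unfold prof; linarith
    · have h := split_int (X := t - s + r ^ 2) (θ := 1) (P := P) (C1 := 32 * C / (ρ * c3)) A1 (by norm_num) (by norm_num) hγ hγ1 hδγ
        (fun w hw => mul_nonneg (Wn w) (kn w hw)) fi fi.aestronglyMeasurable (by positivity) hP0 (F2 s h1.le h2)
        (fun w hw hws => D.near_late S h1.le h2 he hw (by simpa using hws))
      refine ⟨h.1, h.2.trans ?_⟩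
      refine mul_le_mul (mul_le_mul_of_nonneg_right (by linarith) hP0) ?_ n2.le (by positivity)
      unfold prof; linarith
  refine ⟨fun w => Cs * ((1 + w) ^ (-(2 + γ)) * (WW u r t s w * kk (t - s) w w')), fun w hw => ?_, fun w hw => ?_, key.1.const_mul _, ?_⟩
  · have := Wn w
    have := kn w hw
    positivity
  · simp only [zero_mul, Real.exp_zero, one_mul, sub_zero]
    calc _ ≤ Cs * ((1 + w) ^ (-(2 + γ)) * WW u r t s w) * kk (t - s) w w' :=
          mul_le_mul_of_nonneg_right (hS s h1.le h2.le w hw.le) (kn w hw)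
      _ = _ := by ring
  · rw [integral_const_mul]
    calc _ ≤ Cs * ((32 * C / (ρ * c3) + 2 * ((ρ / 4) ^ 3)⁻¹) * P * prof δ r t s) := mul_le_mul_of_nonneg_left key.2 hCs
      _ = _ := by rw [hCC]; ring

theorem sandwich (S : Sol u q K Cq) (H0 : FinMom u) {x0 γ : ℝ} (hx0 : 0 < u 0 x0) (hγ : 0 < γ) (hγ1 : γ ≤ 1/2) (hq : QDec q K γ) :
    ∃ C r0, 0 ≤ C ∧ 2 ≤ r0 ∧ (∀ r, r0 ≤ r → C * r ^ (-(γ / 12)) ≤ 1 / 2) ∧ ∀ r t w', r0 ≤ r → 8 * r ≤ t → 9 * r ≤ w' →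
      (1 - C * r ^ (-(γ / 12))) * (∫ y in Ioi (0:ℝ), WW u r t r y * kk (t - r) y w') ≤ WW u r t t w' ∧
      WW u r t t w' ≤ (1 + C * r ^ (-(γ / 12))) * (∫ y in Ioi (0:ℝ), WW u r t r y * kk (t - r) y w') := by
  obtain ⟨C, hC, hW⟩ := S.W_bounds H0 (δ := γ / 12) (by positivity) (by linarith)
  obtain ⟨Cs, hCs, hS⟩ := S.S_bound H0 hγ hq
  obtain ⟨ρ, c3, hρ, hρ1, hc3, hP⟩ := S.P_lower H0 hx0 hγ hγ1 hq
  set C1 := 64 * C / (ρ * c3 * (γ / 12)) with hC1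
  set C2 := Cs * (32 * C / (ρ * c3) + 2 * ((ρ / 4) ^ 3)⁻¹) * (2 / (γ / 12)) with hC2
  have hC10 : 0 ≤ C1 := by positivity
  have hC20 : 0 ≤ C2 := by positivity
  have lim : Tendsto (fun r : ℝ => (C1 + C2) * r ^ (-(γ / 12))) atTop (𝓝 0) := by
    simpa using (tendsto_rpow_neg_atTop (by positivity : 0 < γ / 12)).const_mul (C1 + C2)
  obtain ⟨R, hR⟩ := eventually_atTop.mp (lim.eventually (ge_mem_nhds (by norm_num : (0:ℝ) < 1/2)))
  refine ⟨C1 + C2, max R 2, by positivity, le_max_right _ _, fun r hr => hR r ((le_max_left _ _).trans hr), fun r t w' hr ht hw' => ?_⟩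
  have hr2 : 2 ≤ r := (le_max_right _ _).trans hr
  have hsm := hR r ((le_max_left _ _).trans hr)
  have rp : 0 < r ^ (-(γ / 12)) := Real.rpow_pos_of_pos (by linarith) _
  have D : Dat u C ρ c3 (γ / 12) r t w' := ⟨hC, hρ, hρ1, hc3, by positivity, by linarith, hr2, ht, hw',
    fun s h1 h2 w hw => hW r t hr2 ht s h1 h2 w hw, hP r t w' hr2 ht (by linarith)⟩
  have m1 : 0 ≤ C1 * r ^ (-(γ / 12)) := by positivity
  have m2 : 0 ≤ C2 * r ^ (-(γ / 12)) := by positivity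
  have h := D.main S hγ hγ1 rfl hCs (hS r t hr2 ht) (by rw [← hC1]; linarith)
  rw [← hC1, ← hC2] at h
  have P0 := D.P0
  exact ⟨(mul_le_mul_of_nonneg_right (by linarith) P0).trans h.1, h.2.trans (mul_le_mul_of_nonneg_right (by linarith) P0)⟩

end Sol
end KPPB

namespace KPPB

lemma mFun_eq {r t : ℝ} (h : r < t) : mFun t = Real.sqrt 2 * t + cc r t * (t - r) := by
  unfold mFun cc aa
  have : t - r ≠ 0 := by linarith
  field_simp
  ring

lemma kap (c : ℝ) : (Real.sqrt 2 + c) ^ 2 / 2 - 1 = Real.sqrt 2 * c + c ^ 2 / 2 := by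
  have e := sqrt2_sq
  linear_combination (1/2) * e

lemma WW_end (u : ℝ → ℝ → ℝ) {r t x : ℝ} (h : r < t) : WW u r t t (x - mFun t) =
    Real.exp ((Real.sqrt 2 + cc r t) * (x - mFun t) + (Real.sqrt 2 * cc r t + (cc r t) ^ 2 / 2) * t) * u t x := by
  unfold WW Wf
  rw [kap]
  congr 2
  rw [mFun_eq h]; ring

lemma P_end (u : ℝ → ℝ → ℝ) {r t x : ℝ} (h : r < t) : ∫ y in Ioi (0:ℝ), WW u r t r y * kk (t - r) y (x - mFun t) =
    Real.exp ((Real.sqrt 2 + cc r t) * (x - mFun t) + (Real.sqrt 2 * cc r t + (cc r t) ^ 2 / 2) * t) * PsiFun u r t x := by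
  unfold PsiFun
  have h0 : 0 < t - r := by linarith
  rw [← mul_assoc, ← integral_const_mul]
  congr 1
  funext y
  rw [kk_eq h0]
  unfold WW Wf pk
  rw [kap]
  have hm := mFun_eq h
  set c := cc r t
  set w := x - mFun t with hw
  have hx : x = w + Real.sqrt 2 * t + c * (t - r) := by rw [hw, hm]; ring
  have e1 : -(c * r) + (Real.sqrt 2 + c) * r + y = Real.sqrt 2 * r + y := by ring
  have e2 : -(2 * y * w / (t - r)) = -(2 * w * y) / (t - r) := by ring
  rw [e1, e2]
  have e3 : Real.exp ((Real.sqrt 2 + c) * y + (Real.sqrt 2 * c + c ^ 2 / 2) * r) * Real.exp (-(y - w) ^ 2 / (2 * (t - r))) =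
      Real.exp ((Real.sqrt 2 + c) * w + (Real.sqrt 2 * c + c ^ 2 / 2) * t) * Real.exp (-(Real.sqrt 2 * (x - Real.sqrt 2 * t))) *
      Real.exp (Real.sqrt 2 * y) * Real.exp (-(x - Real.sqrt 2 * t - y) ^ 2 / (2 * (t - r))) := by
    rw [← Real.exp_add, ← Real.exp_add, ← Real.exp_add, ← Real.exp_add]
    congr 1
    rw [hx]
    field_simp
    ring
  linear_combination (u r (Real.sqrt 2 * r + y) / Real.sqrt (2 * Real.pi * (t - r)) * (1 - Real.exp (-(2 * w * y) / (t - r)))) * e3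

lemma finMom_of {u : ℝ → ℝ → ℝ} {q : ℝ → ℝ} {K Cq : ℝ} (S : Sol u q K Cq) (hint : ∫⁻ y in Ioi (0 : ℝ),
      ENNReal.ofReal (y * Real.exp (Real.sqrt 2 * y) * u 0 y) < ⊤) : FinMom u := by
  have cu : Continuous (u 0) := S.cont.comp (by fun_prop : Continuous (fun x : ℝ => ((0, x) : ℝ × ℝ)))
  have cf : Continuous (fun y => (1 + max y 0) * Vf u 0 y) := by
    unfold Vf; simp only [mul_zero, zero_add]; fun_prop
  have hf0 : ∀ y, 0 ≤ Vf u 0 y := fun y => mul_nonneg (Real.exp_pos _).le (S.nonneg _ _)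
  have hV : ∀ y, Vf u 0 y = Real.exp (Real.sqrt 2 * y) * u 0 y := fun y => by unfold Vf; simp
  have s2 := sqrt2_pos
  unfold FinMom
  rw [← integrableOn_univ, ← Iic_union_Ioi (a := (1:ℝ))]
  refine IntegrableOn.union ?_ ?_
  · have g : IntegrableOn (fun y => 2 * K * Real.exp (Real.sqrt 2 * y)) (Iic (1:ℝ)) :=
      (integrableOn_exp_mul_Iic s2 1).const_mul _
    refine Integrable.mono' g cf.aestronglyMeasurable ?_
    filter_upwards [ae_restrict_mem measurableSet_Iic] with y hy
    have hy : y ≤ 1 := hy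
    have m : max y 0 ≤ 1 := max_le hy (by norm_num)
    have m0 : 0 ≤ max y 0 := le_max_right _ _
    rw [Real.norm_of_nonneg (mul_nonneg (by linarith) (hf0 y)), hV]
    have k := S.le 0 y
    have k0 := S.nonneg 0 y
    have ep := Real.exp_pos (Real.sqrt 2 * y)
    calc _ ≤ 2 * (Real.exp (Real.sqrt 2 * y) * K) := mul_le_mul (by linarith) (mul_le_mul_of_nonneg_left k ep.le) (by positivity) (by norm_num)
      _ = _ := by ring
  · have g0 : IntegrableOn (fun y => y * Real.exp (Real.sqrt 2 * y) * u 0 y) (Ioi (0:ℝ)) := by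
      refine ⟨(by fun_prop : Continuous _).aestronglyMeasurable, ?_⟩
      rw [hasFiniteIntegral_iff_ofReal]
      · exact hint
      · filter_upwards [ae_restrict_mem measurableSet_Ioi] with y hy
        have hy : 0 < y := hy
        have := S.nonneg 0 y
        simp only [Pi.zero_apply]
        positivity
    have g := (g0.mono_set (Ioi_subset_Ioi (by norm_num : (0:ℝ) ≤ 1))).const_mul 2
    refine Integrable.mono' g cf.aestronglyMeasurable ?_
    filter_upwards [ae_restrict_mem measurableSet_Ioi] with y hy
    have hy : 1 < y := hy
    rw [max_eq_left (by linarith : 0 ≤ y), Real.norm_of_nonneg (mul_nonneg (by linarith) (hf0 y))]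
    have := hf0 y
    calc _ ≤ (2 * y) * Vf u 0 y := mul_le_mul_of_nonneg_right (by linarith) this
      _ = _ := by rw [hV]; ring

end KPPB


/-- Sandwich bound for KPP solutions far to the right (Proposition 2.5): under (H1),
with ψ(1) = 0 and 1 the largest root of ψ, for a nontrivial bounded nonnegative solution u
with ∫₀^∞ y e^{√2 y} u(0,y) dy < ∞, there are r₀ > 0 and γ(r) ↓ 1 such that
γ(r)⁻¹ Ψ(r,t,x) ≤ u(t,x) ≤ γ(r) Ψ(r,t,x) for all r ≥ r₀, t ≥ 8r, x ≥ m(t) + 9r. -/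
theorem kpp_sandwich_bound
    (β : ℝ) (hβ : 0 ≤ β) (n : Measure ℝ) [SigmaFinite n]
    (hn : ∫⁻ y in Ioi (0 : ℝ), ENNReal.ofReal (min (y ^ 2) y) ∂n < ⊤)
    (γ₀ : ℝ) (hγ₀ : 0 < γ₀)
    (hH1 : ∫⁻ y in Ioi (1 : ℝ), ENNReal.ofReal (y * Real.log y ^ (2 + γ₀)) ∂n < ⊤)
    (hpsi1 : psi β n 1 = 0) (hlargest : ∀ l : ℝ, 1 < l → psi β n l ≠ 0)
    (u : ℝ → ℝ → ℝ) (hu : IsKPPSolution β n u)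
    (hbdd : ∃ C : ℝ, ∀ x : ℝ, u 0 x ≤ C)
    (hnontriv : ∃ x : ℝ, u 0 x ≠ 0)
    (hint : ∫⁻ y in Ioi (0 : ℝ),
      ENNReal.ofReal (y * Real.exp (Real.sqrt 2 * y) * u 0 y) < ⊤) :
    ∃ r₀ : ℝ, 0 < r₀ ∧ ∃ γfn : ℝ → ℝ,
      (∀ r : ℝ, r₀ ≤ r → 1 ≤ γfn r) ∧ Tendsto γfn atTop (𝓝 1) ∧
      ∀ r : ℝ, r₀ ≤ r → ∀ t : ℝ, 8 * r ≤ t → ∀ x : ℝ, mFun t + 9 * r ≤ x →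
        (γfn r)⁻¹ * PsiFun u r t x ≤ u t x ∧ u t x ≤ γfn r * PsiFun u r t x := by
  obtain ⟨K, Cq, S⟩ := KPPB.sol_of_kpp hβ hn hpsi1 hu hbdd
  obtain ⟨x0, hx0⟩ := hnontriv
  have hx0' : 0 < u (max 0 0) x0 := by
    rw [max_self]; exact lt_of_le_of_ne (hu.1 0 le_rfl x0) (Ne.symm hx0)
  have H0 : KPPB.FinMom (fun t x => u (max t 0) x) := KPPB.finMom_of S (by simpa only [max_self] using hint)
  set γ := min γ₀ (1/2) with hγd
  have hγ : 0 < γ := lt_min hγ₀ (by norm_num)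
  have hγ1 : γ ≤ 1/2 := min_le_right _ _
  have hq : KPPB.QDec (fun v => KPPB.qf β n (max v 0)) K γ := by
    intro A hA
    obtain ⟨C, hC, h⟩ := KPPB.qf_decay hβ hn hγ (min_le_left _ _) (by linarith) hH1 K S.K1 A hA
    refine ⟨C, hC, fun w v hw hv hvK hvA => ?_⟩
    simp only [max_eq_left hv]
    exact h w v hw hv hvK hvA
  obtain ⟨C, r0, hC, hr0, hsm, hm⟩ := S.sandwich H0 (x0 := x0) hx0' hγ hγ1 hq
  refine ⟨r0, by linarith, fun r => 1 + 2 * (C * r ^ (-(γ / 12))), fun r hr => ?_, ?_, fun r hr t ht x hx => ?_⟩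
  · have : 0 ≤ C * r ^ (-(γ / 12)) := mul_nonneg hC (Real.rpow_nonneg (by linarith) _)
    linarith
  · simpa using ((((tendsto_rpow_neg_atTop (by positivity : 0 < γ / 12)).const_mul C).const_mul 2).const_add 1)
  · have hr2 : 2 ≤ r := hr0.trans hr
    have hrt : r < t := by linarith
    have h := hm r t (x - mFun t) hr ht (by linarith)
    rw [KPPB.WW_end _ hrt, KPPB.P_end _ hrt] at h
    have eP : PsiFun (fun t x => u (max t 0) x) r t x = PsiFun u r t x := by
      unfold PsiFun
      simp only [max_eq_left (by linarith : 0 ≤ r)]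
    rw [eP] at h
    simp only [max_eq_left (by linarith : 0 ≤ t)] at h
    set E := Real.exp ((Real.sqrt 2 + KPPB.cc r t) * (x - mFun t) + (Real.sqrt 2 * KPPB.cc r t + (KPPB.cc r t) ^ 2 / 2) * t) with hE
    have E0 : 0 < E := Real.exp_pos _
    have hs := hsm r hr
    have hs0 : 0 ≤ C * r ^ (-(γ / 12)) := mul_nonneg hC (Real.rpow_nonneg (by linarith) _)
    set ε := C * r ^ (-(γ / 12)) with hε
    set Q := PsiFun u r t x with hQd
    have l : (1 - ε) * Q ≤ u t x := by
      refine le_of_mul_le_mul_left ?_ E0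
      linarith [h.1]
    have v : u t x ≤ (1 + ε) * Q := by
      refine le_of_mul_le_mul_left ?_ E0
      linarith [h.2]
    have Q0 : 0 ≤ Q := by
      have := hu.1 t (by linarith) x
      by_contra hneg
      push Not at hneg
      nlinarith
    refine ⟨le_trans (mul_le_mul_of_nonneg_right ?_ Q0) l, v.trans (mul_le_mul_of_nonneg_right (by linarith) Q0)⟩
    rw [inv_le_iff_one_le_mul₀ (by linarith)]
    nlinarith
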